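/- Fix a ∈ [−1,1], μ > 0 and γ > 1. For any τ ∈ (0,1) and any initial data (v₀, u₀, S₀) with (v₀ − 1, u₀, √τ S₀) ∈ H²(ℝ), inf_x v₀(x) > 0 and inf_x (2τ a S₀(x) + μ) > 0, there exists T > 0 such that the Cauchy problem for the relaxed system has a unique solution (v, u, S) on [0, T] × ℝ with (v − 1, u, √τ S) ∈ C⁰([0,T]; H²(ℝ)) ∩ C¹([0,T]; H¹(ℝ)), v(t,x) > 0 and 2τ a S(t,x) + μ > 0 for all (t,x) ∈ [0,T] × ℝ. -/

import Mathlib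

open MeasureTheory Filter Set intervalIntegral

noncomputable section

/-- Squared `H^k(ℝ)` norm: sum of the squared `L²` norms of the derivatives up to order `k`. -/
def HSq (k : ℕ) (f : ℝ → ℝ) : ℝ :=
  ∑ j ∈ Finset.range (k + 1), ∫ x : ℝ, (iteratedDeriv j f x) ^ 2

/-- Classical membership in `H^k(ℝ)`. -/
def MemH (k : ℕ) (f : ℝ → ℝ) : Prop :=
  ContDiff ℝ k f ∧ ∀ j ≤ k, Integrable fun x => (iteratedDeriv j f x) ^ 2

/-- Partial derivative in time. -/
def pt (f : ℝ → ℝ → ℝ) (t x : ℝ) : ℝ := deriv (fun s => f s x) t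

/-- Partial derivative in space. -/
def px (f : ℝ → ℝ → ℝ) (t x : ℝ) : ℝ := deriv (f t) x

/-- Continuity of `t ↦ f t` as an `H^k`-valued map on `I`. -/
def ContH (k : ℕ) (I : Set ℝ) (f : ℝ → ℝ → ℝ) : Prop :=
  ∀ s ∈ I, Tendsto (fun t => HSq k fun x => f t x - f s x) (nhdsWithin s I) (nhds 0)

/-- `f ∈ C⁰(I; H^k) ∩ C¹(I; H^(k-1))`. -/
def RegH (k : ℕ) (I : Set ℝ) (f : ℝ → ℝ → ℝ) : Prop :=
  (∀ t ∈ I, MemH k (f t)) ∧ ContH k I f ∧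
  (∀ x, ∀ t ∈ I, DifferentiableAt ℝ (fun s => f s x) t) ∧
  (∀ t ∈ I, MemH (k - 1) fun x => pt f t x) ∧ ContH (k - 1) I fun t x => pt f t x

/-- The 1-d isentropic compressible Navier–Stokes system with Oldroyd-type constitutive
law, in Lagrangian coordinates, at a point `(t, x)`:
`v_t = u_x`, `u_t + (v^(-γ))_x = S_x`, `τ (S_t - (2 a S / v) u_x) + S = μ u_x / v`. -/
def RelaxedSystem (a μ γ τ : ℝ) (v u S : ℝ → ℝ → ℝ) (t x : ℝ) : Prop :=
  pt v t x = px u t x ∧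
  pt u t x + deriv (fun y => v t y ^ (-γ)) x = px S t x ∧
  τ * (pt S t x - 2 * a * S t x / v t x * px u t x) + S t x = μ * px u t x / v t x

/-- The energy functional `E(t)`. -/
def En (τ : ℝ) (v u S : ℝ → ℝ → ℝ) (t : ℝ) : ℝ :=
  sSup ((fun s => HSq 2 (fun x => v s x - 1) + HSq 2 (u s) + τ * HSq 2 (S s)) '' Icc 0 t)

/-- The dissipation functional `D(t)`. -/
def Dn (v u S : ℝ → ℝ → ℝ) (t : ℝ) : ℝ :=
  HSq 1 (fun x => px v t x) + HSq 1 (fun x => px u t x) + HSq 2 (S t)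

/-- A solution of the relaxed system on `[0,T] × ℝ` in the class
`C⁰([0,T]; H²) ∩ C¹([0,T]; H¹)` with `v > 0` and `2τaS + μ > 0`. -/
def IsSolOn (a μ γ τ T : ℝ) (v u S : ℝ → ℝ → ℝ) : Prop :=
  (∀ t ∈ Icc (0 : ℝ) T, ∀ x : ℝ,
      0 < v t x ∧ 0 < 2 * τ * a * S t x + μ ∧ RelaxedSystem a μ γ τ v u S t x) ∧
  RegH 2 (Icc 0 T) (fun t x => v t x - 1) ∧ RegH 2 (Icc 0 T) u ∧ RegH 2 (Icc 0 T) S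


/-- `(v, u, S)` is a solution of the Cauchy problem for the relaxed system on
`[0,T] × ℝ` with data `(v₀, u₀, S₀)`, in the class stated in Theorem 2.1:
`(v - 1, u, √τ S) ∈ C⁰([0,T];H²) ∩ C¹([0,T];H¹)`, `v > 0` and `2τaS + μ > 0`. -/
def IsLocalSolution (a μ γ τ T : ℝ) (v₀ u₀ S₀ : ℝ → ℝ) (v u S : ℝ → ℝ → ℝ) : Prop :=
  (∀ x : ℝ, v 0 x = v₀ x ∧ u 0 x = u₀ x ∧ S 0 x = S₀ x) ∧
  (∀ t ∈ Icc (0 : ℝ) T, ∀ x : ℝ,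
      0 < v t x ∧ 0 < 2 * τ * a * S t x + μ ∧ RelaxedSystem a μ γ τ v u S t x) ∧
  RegH 2 (Icc 0 T) (fun t x => v t x - 1) ∧ RegH 2 (Icc 0 T) u ∧
  RegH 2 (Icc 0 T) (fun t x => Real.sqrt τ * S t x)

section

/-- A continuous time weight with values in `[0, 1]`, supported in `[-1, 1]`, of mass at most `σ`. -/
structure Clock (χ : ℝ → ℝ) (σ : ℝ) : Prop where
  cont : Continuous χ
  nonneg : ∀ s, 0 ≤ χ s
  le_one : ∀ s, χ s ≤ 1
  supp : ∀ s, 1 ≤ |s| → χ s = 0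
  mass : ∫ s, χ s ≤ σ

section Clock

variable {χ : ℝ → ℝ} {σ : ℝ} {G : Type*} [NormedAddCommGroup G] [NormedSpace ℝ G]

theorem Clock.integrable (h : Clock χ σ) : Integrable χ :=
  h.cont.integrable_of_hasCompactSupport
    (HasCompactSupport.of_support_subset_isCompact (isCompact_Icc (a := (-1 : ℝ)) (b := 1)) fun s hs => by
      by_contra hc
      exact hs (h.supp s (by
        rw [mem_Icc, ← abs_le] at hc
        linarith)))

theorem Clock.sigma_nonneg (h : Clock χ σ) : 0 ≤ σ :=
  (integral_nonneg h.nonneg).trans h.mass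

theorem Clock.integral_uIoc_le (h : Clock χ σ) (a b : ℝ) : ∫ s in uIoc a b, χ s ≤ σ :=
  (setIntegral_le_integral h.integrable (Eventually.of_forall h.nonneg)).trans h.mass

theorem Clock.norm_integral_le (h : Clock χ σ) {g : ℝ → G} {C : ℝ} (hC : 0 ≤ C) {a b : ℝ}
    (hg : ∀ s ∈ uIoc a b, |s| < 1 → ‖g s‖ ≤ C) : ‖∫ s in a..b, χ s • g s‖ ≤ σ * C := by
  have h1 : ‖∫ s in a..b, χ s • g s‖ ≤ ∫ s in uIoc a b, χ s * C := by
    rw [norm_intervalIntegral_eq]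
    refine norm_integral_le_of_norm_le ((h.integrable.mul_const C).restrict) ?_
    refine (ae_restrict_iff' measurableSet_uIoc).2 (Eventually.of_forall fun s hs => ?_)
    rw [norm_smul, Real.norm_of_nonneg (h.nonneg s)]
    by_cases hs1 : |s| < 1
    · exact mul_le_mul_of_nonneg_left (hg s hs hs1) (h.nonneg s)
    · simp [h.supp s (not_lt.1 hs1)]
  refine h1.trans ?_
  rw [MeasureTheory.integral_mul_const]
  exact mul_le_mul_of_nonneg_right (h.integral_uIoc_le a b) hC

theorem Clock.norm_integral_le' (h : Clock χ σ) {g : ℝ → G} {C : ℝ} (hg : ∀ s, ‖g s‖ ≤ C) (a b : ℝ) :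
    ‖∫ s in a..b, χ s • g s‖ ≤ σ * C :=
  h.norm_integral_le ((norm_nonneg _).trans (hg 0)) fun s _ _ => hg s

/-- The trapezoidal weight equal to `1` on `[-T, T]` and supported in `[-2T, 2T]`. -/
def hat (T t : ℝ) : ℝ := max 0 (min 1 (2 - |t| / T))

theorem hat_eq_one {T t : ℝ} (hT : 0 < T) (ht : |t| ≤ T) : hat T t = 1 := by
  have : |t| / T ≤ 1 := (div_le_one hT).2 ht
  rw [hat, min_eq_left (by linarith)]
  exact max_eq_right zero_le_one

theorem clock_hat {T : ℝ} (hT : 0 < T) (hT1 : T ≤ 1 / 2) : Clock (hat T) (4 * T) := by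
  have hz : ∀ s, 2 * T ≤ |s| → hat T s = 0 := fun s hs => by
    have : 2 ≤ |s| / T := (le_div_iff₀ hT).2 hs
    exact max_eq_left ((min_le_right _ _).trans (by linarith))
  have hle : ∀ s, hat T s ≤ 1 := fun s => max_le zero_le_one (min_le_left _ _)
  refine ⟨by unfold hat; fun_prop, fun s => le_max_left _ _, hle,
    fun s hs => hz s (by linarith), ?_⟩
  have h1 : ∫ s, hat T s = ∫ s in Icc (-(2 * T)) (2 * T), hat T s := by
    refine (setIntegral_eq_integral_of_forall_compl_eq_zero fun s hs => hz s ?_).symm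
    rw [mem_Icc, ← abs_le] at hs
    linarith
  rw [h1]
  calc ∫ s in Icc (-(2 * T)) (2 * T), hat T s ≤ ∫ s in Icc (-(2 * T)) (2 * T), (1 : ℝ) := by
        refine setIntegral_mono_on ?_ (by simp) measurableSet_Icc fun s _ => hle s
        exact (by unfold hat; fun_prop : Continuous (hat T)).continuousOn.integrableOn_Icc
    _ = 4 * T := by
        simp [Measure.real, Real.volume_Icc]
        rw [ENNReal.toReal_ofReal (by linarith)]; ring

end Clock

theorem hasDerivAt_intervalIntegral_of_continuous {G : Type*} [NormedAddCommGroup G]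
    [NormedSpace ℝ G] {F F' : ℝ → ℝ → G}
    (hF : Continuous (Function.uncurry F)) (hF' : Continuous (Function.uncurry F'))
    (hd : ∀ x t, HasDerivAt (fun x => F x t) (F' x t) x) (a b x : ℝ) :
    HasDerivAt (fun x => ∫ t in a..b, F x t) (∫ t in a..b, F' x t) x := by
  obtain ⟨C, hC⟩ := ((isCompact_closedBall x 1).prod (isCompact_uIcc (a := a) (b := b))).exists_bound_of_continuousOn
    hF'.continuousOn
  refine (intervalIntegral.hasDerivAt_integral_of_dominated_loc_of_deriv_le (bound := fun _ => C)
    (Metric.closedBall_mem_nhds x one_pos) ?_ ?_ ?_ ?_ ?_ ?_).2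
  · exact Eventually.of_forall fun y => (hF.comp (by fun_prop : Continuous fun t : ℝ => (y, t))).aestronglyMeasurable
  · exact (hF.comp (by fun_prop : Continuous fun t : ℝ => (x, t))).intervalIntegrable _ _
  · exact (hF'.comp (by fun_prop : Continuous fun t : ℝ => (x, t))).aestronglyMeasurable
  · exact Eventually.of_forall fun t ht y hy => hC (y, t) ⟨hy, uIoc_subset_uIcc ht⟩
  · simp
  · exact Eventually.of_forall fun t _ y _ => hd y t

end

section

/-- A bounded speed `lam (t, x)` with bounded continuous `x`-derivative `lam'`. -/
structure Speed (lam lam' : ℝ × ℝ → ℝ) (Λ Λ' : ℝ) : Prop where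
  cont : Continuous lam
  cont' : Continuous lam'
  deriv : ∀ t x, HasDerivAt (fun y => lam (t, y)) (lam' (t, x)) x
  bound : ∀ p, |lam p| ≤ Λ
  bound' : ∀ p, |lam' p| ≤ Λ'

/-- `φ (s, t, x)` is the position at time `s` of the characteristic through `(t, x)`. -/
structure IsFlow (χ : ℝ → ℝ) (lam : ℝ × ℝ → ℝ) (φ : ℝ × ℝ × ℝ → ℝ) : Prop where
  cont : Continuous φ
  init : ∀ t x, φ (t, t, x) = x
  deriv : ∀ s t x, HasDerivAt (fun s => φ (s, t, x)) (χ s * lam (s, φ (s, t, x))) s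

section Flow

variable {χ : ℝ → ℝ} {σ Λ Λ' : ℝ} {lam lam' : ℝ × ℝ → ℝ} {φ : ℝ × ℝ × ℝ → ℝ}

theorem Speed.lipschitz (hs : Speed lam lam' Λ Λ') (t x y : ℝ) :
    |lam (t, x) - lam (t, y)| ≤ Λ' * |x - y| := by
  have := Convex.norm_image_sub_le_of_norm_hasDerivWithin_le (s := univ)
    (f := fun y => lam (t, y)) (f' := fun y => lam' (t, y)) (C := Λ') (x := y) (y := x)
    (fun y _ => (hs.deriv t y).hasDerivWithinAt) (fun y _ => hs.bound' (t, y)) convex_univ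
    (mem_univ _) (mem_univ _)
  simpa using this

theorem Speed.nonneg (hs : Speed lam lam' Λ Λ') : 0 ≤ Λ := (abs_nonneg _).trans (hs.bound 0)

theorem Speed.nonneg' (hs : Speed lam lam' Λ Λ') : 0 ≤ Λ' := (abs_nonneg _).trans (hs.bound' 0)

open BoundedContinuousFunction in
theorem exists_flow (h : Clock χ σ) (hs : Speed lam lam' Λ Λ') (hσ : σ * Λ' ≤ 1 / 4) :
    ∃ φ, IsFlow χ lam φ := by
  have hχ := h.cont
  have hlam := hs.cont
  have hc : ∀ ψ : ℝ × ℝ × ℝ →ᵇ ℝ, Continuous fun p : ℝ × ℝ × ℝ =>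
      ∫ r in p.2.1..p.1, χ r • lam (r, p.2.2 + ψ (r, p.2.1, p.2.2)) := fun ψ => by
    have hψ := ψ.continuous
    have h2 : Continuous fun q : (ℝ × ℝ × ℝ) × ℝ =>
        ∫ r in (0 : ℝ)..q.2, χ r • lam (r, q.1.2.2 + ψ (r, q.1.2.1, q.1.2.2)) := by
      refine continuous_parametric_intervalIntegral_of_continuous
        (f := fun (q : (ℝ × ℝ × ℝ) × ℝ) r => χ r • lam (r, q.1.2.2 + ψ (r, q.1.2.1, q.1.2.2)))
        ?_ continuous_snd
      fun_prop
    have h3 : (fun p : ℝ × ℝ × ℝ =>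
        ∫ r in p.2.1..p.1, χ r • lam (r, p.2.2 + ψ (r, p.2.1, p.2.2))) = fun p =>
        (∫ r in (0 : ℝ)..p.1, χ r • lam (r, p.2.2 + ψ (r, p.2.1, p.2.2))) -
        ∫ r in (0 : ℝ)..p.2.1, χ r • lam (r, p.2.2 + ψ (r, p.2.1, p.2.2)) := by
      funext p
      rw [integral_interval_sub_left]
      all_goals exact (by fun_prop : Continuous fun r =>
        χ r • lam (r, p.2.2 + ψ (r, p.2.1, p.2.2))).intervalIntegrable _ _
    rw [h3]
    exact (h2.comp (by fun_prop : Continuous fun p : ℝ × ℝ × ℝ => (p, p.1))).sub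
      (h2.comp (by fun_prop : Continuous fun p : ℝ × ℝ × ℝ => (p, p.2.1)))
  let F : (ℝ × ℝ × ℝ →ᵇ ℝ) → (ℝ × ℝ × ℝ →ᵇ ℝ) := fun ψ =>
    BoundedContinuousFunction.ofNormedAddCommGroup _ (hc ψ) (σ * Λ) fun p =>
      h.norm_integral_le' (g := fun r => lam (r, p.2.2 + ψ (r, p.2.1, p.2.2)))
        (fun _ => hs.bound _) _ _
  have hF : ∀ ψ p, F ψ p = ∫ r in p.2.1..p.1, χ r • lam (r, p.2.2 + ψ (r, p.2.1, p.2.2)) :=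
    fun _ _ => rfl
  have hcontr : ContractingWith (1 / 4) F := by
    refine ⟨by rw [← NNReal.coe_lt_coe]; norm_num, LipschitzWith.of_dist_le_mul fun ψ₁ ψ₂ => ?_⟩
    have hd : (0 : ℝ) ≤ dist ψ₁ ψ₂ := dist_nonneg
    rw [BoundedContinuousFunction.dist_le (by positivity)]
    intro p
    rw [hF, hF, Real.dist_eq, ← intervalIntegral.integral_sub]
    · simp_rw [← smul_sub]
      have hψ₁ := ψ₁.continuous
      have h1 := h.norm_integral_le' (g := fun r => lam (r, p.2.2 + ψ₁ (r, p.2.1, p.2.2)) -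
        lam (r, p.2.2 + ψ₂ (r, p.2.1, p.2.2))) (C := Λ' * dist ψ₁ ψ₂) (fun r => by
          refine (hs.lipschitz _ _ _).trans ?_
          refine mul_le_mul_of_nonneg_left ?_ hs.nonneg'
          rw [add_sub_add_left_eq_sub, ← Real.dist_eq]
          exact BoundedContinuousFunction.dist_coe_le_dist _) p.2.1 p.1
      rw [Real.norm_eq_abs] at h1
      refine h1.trans ?_
      simp only [NNReal.coe_div, NNReal.coe_one, NNReal.coe_ofNat]
      nlinarith
    all_goals
      have hψ₁ := ψ₁.continuous
      have hψ₂ := ψ₂.continuous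
      refine Continuous.intervalIntegrable ?_ _ _
      fun_prop
  set ψ := hcontr.fixedPoint
  have hψF : F ψ = ψ := hcontr.fixedPoint_isFixedPt
  have hψ : ∀ s t x, ψ (s, t, x) = ∫ r in t..s, χ r • lam (r, x + ψ (r, t, x)) := fun s t x => by
    conv_lhs => rw [← hψF]
    exact hF _ _
  have hψc := ψ.continuous
  refine ⟨fun p => p.2.2 + ψ p, by fun_prop, fun t x => by simp [hψ t t x], fun s t x => ?_⟩
  have h1 : HasDerivAt (fun s => ∫ r in t..s, χ r • lam (r, x + ψ (r, t, x)))
      (χ s • lam (s, x + ψ (s, t, x))) s := by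
    have hc : Continuous fun r => χ r • lam (r, x + ψ (r, t, x)) := by fun_prop
    exact (hc.integral_hasStrictDerivAt t s).hasDerivAt
  have h2 := h1.const_add x
  simp only [← hψ] at h2
  simpa using h2

theorem IsFlow.integral_eq (h : IsFlow χ lam φ) (hχ : Continuous χ) (hl : Continuous lam)
    (s r t x : ℝ) : ∫ q in r..s, χ q * lam (q, φ (q, t, x)) = φ (s, t, x) - φ (r, t, x) := by
  have hc := h.cont
  exact integral_eq_sub_of_hasDerivAt (fun q _ => h.deriv q t x)
    (Continuous.intervalIntegrable (by fun_prop) _ _)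

theorem IsFlow.comp_eq (h : IsFlow χ lam φ) (hχ : Clock χ σ) (hs : Speed lam lam' Λ Λ')
    (s r t x : ℝ) : φ (s, r, φ (r, t, x)) = φ (s, t, x) := by
  have hv : ∀ t, LipschitzWith (Real.toNNReal Λ') fun y => χ t * lam (t, y) := fun t => by
    refine LipschitzWith.of_dist_le_mul fun y z => ?_
    rw [Real.dist_eq, Real.dist_eq, ← mul_sub, abs_mul, abs_of_nonneg (hχ.nonneg t),
      Real.coe_toNNReal _ hs.nonneg']
    have := hs.lipschitz t y z
    have := hχ.nonneg t
    have := hχ.le_one t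
    have := abs_nonneg (lam (t, y) - lam (t, z))
    nlinarith
  have := ODE_solution_unique_univ (v := fun t y => χ t * lam (t, y)) (s := fun _ => univ)
    (K := Real.toNNReal Λ') (t₀ := r)
    (f := fun s => φ (s, r, φ (r, t, x))) (g := fun s => φ (s, t, x))
    (fun t => (hv t).lipschitzOnWith) (fun s => ⟨h.deriv s _ _, mem_univ _⟩)
    (fun s => ⟨h.deriv s _ _, mem_univ _⟩) (by simp [h.init])
  exact congrFun this s

/-- The `x`-derivative of the flow. -/
def flowJac (χ : ℝ → ℝ) (lam' : ℝ × ℝ → ℝ) (φ : ℝ × ℝ × ℝ → ℝ) (p : ℝ × ℝ × ℝ) : ℝ :=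
  Real.exp (∫ r in p.2.1..p.1, χ r * lam' (r, φ (r, p.2.1, p.2.2)))

theorem continuous_intervalIntegral_prod {X : Type*} [TopologicalSpace X]
    {G : Type*} [NormedAddCommGroup G] [NormedSpace ℝ G] {f : X → ℝ → G} {a b : X → ℝ}
    (hf : Continuous (Function.uncurry f)) (ha : Continuous a) (hb : Continuous b) :
    Continuous fun p => ∫ r in a p..b p, f p r := by
  have h2 : ∀ c : X → ℝ, Continuous c → Continuous fun p => ∫ r in (0 : ℝ)..c p, f p r :=
    fun c hc => continuous_parametric_intervalIntegral_of_continuous hf hc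
  have h3 : (fun p => ∫ r in a p..b p, f p r) = fun p =>
      (∫ r in (0 : ℝ)..b p, f p r) - ∫ r in (0 : ℝ)..a p, f p r := by
    funext p
    rw [integral_interval_sub_left]
    all_goals exact (hf.comp (by fun_prop : Continuous fun r : ℝ => (p, r))).intervalIntegrable _ _
  rw [h3]
  exact (h2 b hb).sub (h2 a ha)

theorem continuous_flowJac (h : IsFlow χ lam φ) (hχ : Clock χ σ) (hs : Speed lam lam' Λ Λ') :
    Continuous (flowJac χ lam' φ) := by
  have h1 := h.cont
  have h2 := hχ.cont
  have h3 := hs.cont'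
  refine Real.continuous_exp.comp (continuous_intervalIntegral_prod
    (f := fun (p : ℝ × ℝ × ℝ) r => χ r * lam' (r, φ (r, p.2.1, p.2.2))) ?_ ?_ ?_) <;> fun_prop

theorem flowJac_pos (p : ℝ × ℝ × ℝ) : 0 < flowJac χ lam' φ p := Real.exp_pos _

theorem flowJac_le (hχ : Clock χ σ) (hs : Speed lam lam' Λ Λ') (hσ : σ * Λ' ≤ 1 / 4)
    (p : ℝ × ℝ × ℝ) : flowJac χ lam' φ p ≤ 2 := by
  have h1 := hχ.norm_integral_le' (g := fun r => lam' (r, φ (r, p.2.1, p.2.2)))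
    (fun _ => hs.bound' _) p.2.1 p.1
  have h2 := (abs_le.1 (h1.trans hσ)).2
  refine (Real.exp_le_exp.2 h2).trans ?_
  have := Real.exp_one_lt_d9
  have h4 : Real.exp (1 / 4) ^ 4 = Real.exp 1 := by rw [← Real.exp_nat_mul]; norm_num
  by_contra hc
  push Not at hc
  have : (2 : ℝ) ^ 4 < Real.exp (1 / 4) ^ 4 := by gcongr
  linarith

theorem IsFlow.hasDerivAt (h : IsFlow χ lam φ) (hχ : Clock χ σ) (hs : Speed lam lam' Λ Λ')
    (s t x : ℝ) : HasDerivAt (fun y => φ (s, t, y)) (flowJac χ lam' φ (s, t, x)) x := by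
  have h1 := h.cont
  have h2 := hχ.cont
  have h3 := hs.cont'
  let m : ℝ × ℝ → ℝ := fun p =>
    ∫ θ in (0 : ℝ)..1, lam' (p.1, φ (p.1, t, x) + θ * (φ (p.1, t, p.2) - φ (p.1, t, x)))
  have hm : Continuous m := by
    refine continuous_intervalIntegral_prod (f := fun (p : ℝ × ℝ) θ =>
      lam' (p.1, φ (p.1, t, x) + θ * (φ (p.1, t, p.2) - φ (p.1, t, x)))) ?_ ?_ ?_ <;> fun_prop
  have hmeq : ∀ r y, lam (r, φ (r, t, y)) - lam (r, φ (r, t, x)) =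
      m (r, y) * (φ (r, t, y) - φ (r, t, x)) := fun r y => by
    have := integral_eq_sub_of_hasDerivAt (a := 0) (b := 1)
      (f := fun θ => lam (r, φ (r, t, x) + θ * (φ (r, t, y) - φ (r, t, x))))
      (f' := fun θ => lam' (r, φ (r, t, x) + θ * (φ (r, t, y) - φ (r, t, x))) *
        (φ (r, t, y) - φ (r, t, x)))
      (fun θ _ => by
        have e : HasDerivAt (fun θ : ℝ => φ (r, t, x) + θ * (φ (r, t, y) - φ (r, t, x)))
            (φ (r, t, y) - φ (r, t, x)) θ := by
          simpa using ((hasDerivAt_id θ).mul_const (φ (r, t, y) - φ (r, t, x))).const_add (φ (r, t, x))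
        exact (hs.deriv r _).comp θ e)
      (Continuous.intervalIntegrable (by fun_prop) _ _)
    rw [intervalIntegral.integral_mul_const] at this
    simp only [one_mul, zero_mul, add_zero, add_sub_cancel] at this
    rw [← this]
  have hslope : ∀ y, φ (s, t, y) - φ (s, t, x) = (y - x) * Real.exp (∫ r in t..s, χ r * m (r, y)) := by
    intro y
    have hc : Continuous fun r => χ r * m (r, y) := by fun_prop
    have hd : ∀ q, HasDerivAt (fun q => (φ (q, t, y) - φ (q, t, x)) *
        Real.exp (-∫ r in t..q, χ r * m (r, y))) 0 q := fun q => by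
      have e1 : HasDerivAt (fun q => ∫ r in t..q, χ r * m (r, y)) (χ q * m (q, y)) q :=
        (hc.integral_hasStrictDerivAt t q).hasDerivAt
      refine (((h.deriv q t y).sub (h.deriv q t x)).mul e1.neg.exp).congr_deriv ?_
      simp only [Pi.sub_apply, Pi.neg_apply]
      linear_combination (χ q * Real.exp (-∫ r in t..q, χ r * m (r, y))) * hmeq q y
    have := is_const_of_deriv_eq_zero (fun q => (hd q).differentiableAt) (fun q => (hd q).deriv) s t
    simp only [h.init, integral_same, neg_zero, Real.exp_zero, mul_one] at this
    rw [← this, mul_assoc, ← Real.exp_add]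
    simp
  rw [hasDerivAt_iff_tendsto_slope]
  have hcont : Continuous fun y => Real.exp (∫ r in t..s, χ r * m (r, y)) := by
    refine Real.continuous_exp.comp (continuous_intervalIntegral_prod
      (f := fun y r => χ r * m (r, y)) ?_ ?_ ?_) <;> fun_prop
  have h4 : flowJac χ lam' φ (s, t, x) = Real.exp (∫ r in t..s, χ r * m (r, x)) := by
    simp [flowJac, m]
  rw [h4]
  refine ((hcont.tendsto x).mono_left nhdsWithin_le_nhds).congr' ?_
  filter_upwards [self_mem_nhdsWithin] with y hy
  rw [slope_def_field, hslope y]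
  field_simp [sub_ne_zero.2 hy]

theorem IsFlow.jac_mul (h : IsFlow χ lam φ) (hχ : Clock χ σ) (hs : Speed lam lam' Λ Λ')
    (s r t x : ℝ) :
    flowJac χ lam' φ (s, r, φ (r, t, x)) * flowJac χ lam' φ (r, t, x) =
      flowJac χ lam' φ (s, t, x) := by
  have h1 := (h.hasDerivAt hχ hs s r (φ (r, t, x))).comp x (h.hasDerivAt hχ hs r t x)
  have h2 : (fun y => φ (s, r, y)) ∘ (fun y => φ (r, t, y)) = fun y => φ (s, t, y) :=
    funext fun y => h.comp_eq hχ hs s r t y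
  rw [h2] at h1
  exact h1.unique (h.hasDerivAt hχ hs s t x)

end Flow

end

section

/-- The clock time elapsed between `0` and `t`. -/
def clk (χ : ℝ → ℝ) (t : ℝ) : ℝ := |∫ s in (0 : ℝ)..t, χ s|

/-- The radial variable which decreases along characteristics of speed at most `Λ`
followed towards time `0`. -/
def rad (χ : ℝ → ℝ) (Λ : ℝ) (p : ℝ × ℝ) : ℝ := |p.2| + Λ * clk χ p.1

section Cone

variable {χ : ℝ → ℝ} {σ Λ Λ' : ℝ} {lam lam' : ℝ × ℝ → ℝ} {φ : ℝ × ℝ × ℝ → ℝ}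

@[simp] theorem clk_zero : clk χ 0 = 0 := by simp [clk]

@[simp] theorem rad_zero (x : ℝ) : rad χ Λ (0, x) = |x| := by simp [rad]

theorem clk_nonneg (t : ℝ) : 0 ≤ clk χ t := abs_nonneg _

theorem Clock.clk_le (h : Clock χ σ) (t : ℝ) : clk χ t ≤ σ := by
  have := h.norm_integral_le' (g := fun _ => (1 : ℝ)) (C := 1) (by simp) 0 t
  simpa [clk] using this

theorem Clock.continuous_clk (h : Clock χ σ) : Continuous (clk χ) :=
  (continuous_intervalIntegral_prod (f := fun (_ : ℝ) r => χ r)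
    (h.cont.comp continuous_snd) continuous_const continuous_id).abs

theorem Clock.continuous_rad (h : Clock χ σ) : Continuous (rad χ Λ) := by
  have := h.continuous_clk
  unfold rad
  fun_prop

theorem Clock.clk_of_nonneg (h : Clock χ σ) {t : ℝ} (ht : 0 ≤ t) :
    clk χ t = ∫ s in (0 : ℝ)..t, χ s :=
  abs_of_nonneg (integral_nonneg ht fun s _ => h.nonneg s)

theorem Clock.clk_of_nonpos (h : Clock χ σ) {t : ℝ} (ht : t ≤ 0) :
    clk χ t = -∫ s in (0 : ℝ)..t, χ s := by
  rw [integral_symm, neg_neg, clk, integral_symm, abs_neg]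
  exact abs_of_nonneg (integral_nonneg ht fun s _ => h.nonneg s)

theorem Clock.clk_add (h : Clock χ σ) {s t : ℝ} (hs : s ∈ uIcc 0 t) :
    clk χ s + |∫ r in s..t, χ r| = clk χ t := by
  have hi : ∀ a b, IntervalIntegrable χ volume a b := fun a b => h.cont.intervalIntegrable a b
  have hadd := integral_add_adjacent_intervals (hi 0 s) (hi s t)
  rcases le_total 0 t with ht | ht
  · rw [uIcc_of_le ht] at hs
    rw [h.clk_of_nonneg hs.1, h.clk_of_nonneg ht,
      abs_of_nonneg (integral_nonneg hs.2 fun s _ => h.nonneg s), hadd]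
  · rw [uIcc_of_ge ht] at hs
    rw [h.clk_of_nonpos hs.2, h.clk_of_nonpos ht, integral_symm t s, abs_neg,
      abs_of_nonneg (integral_nonneg hs.1 fun s _ => h.nonneg s), ← hadd, integral_symm s t]
    ring

theorem IsFlow.abs_sub_le (h : IsFlow χ lam φ) (hχ : Clock χ σ) (hs : Speed lam lam' Λ Λ')
    (s r t x : ℝ) : |φ (s, t, x) - φ (r, t, x)| ≤ Λ * |∫ q in r..s, χ q| := by
  rw [← h.integral_eq hχ.cont hs.cont, ← Real.norm_eq_abs]
  refine (norm_integral_le_abs_of_norm_le (μ := volume) (g := fun q => Λ * χ q) ?_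
    ((hχ.cont.const_mul Λ).intervalIntegrable _ _)).trans ?_
  · refine Eventually.of_forall fun q => ?_
    rw [norm_mul, Real.norm_of_nonneg (hχ.nonneg q), mul_comm]
    exact mul_le_mul_of_nonneg_right (hs.bound _) (hχ.nonneg q)
  · rw [intervalIntegral.integral_const_mul, abs_mul, abs_of_nonneg hs.nonneg]

theorem IsFlow.rad_le (h : IsFlow χ lam φ) (hχ : Clock χ σ) (hs : Speed lam lam' Λ Λ')
    {s t : ℝ} (hst : s ∈ uIcc 0 t) (x : ℝ) : rad χ Λ (s, φ (s, t, x)) ≤ rad χ Λ (t, x) := by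
  have h1 := h.abs_sub_le hχ hs s t t x
  rw [h.init, integral_symm, abs_neg] at h1
  have h2 := hχ.clk_add hst
  have h3 := abs_add_le (φ (s, t, x) - x) x
  rw [sub_add_cancel] at h3
  simp only [rad]
  rw [← h2]
  linarith

theorem Clock.abs_integral_le_exp (h : Clock χ σ) {g : ℝ → ℝ} {C N t : ℝ} (hN : 0 < N) (hC : 0 ≤ C)
    (hg : ∀ s ∈ uIcc 0 t, |g s| ≤ C * Real.exp (N * clk χ s)) :
    |∫ s in (0 : ℝ)..t, χ s * g s| ≤ C / N * Real.exp (N * clk χ t) := by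
  have hcl := h.continuous_clk
  have hχ := h.cont
  have hm : ∀ s, HasDerivAt (fun s => ∫ r in (0 : ℝ)..s, χ r) (χ s) s := fun s =>
    (hχ.integral_hasStrictDerivAt 0 s).hasDerivAt
  have hexp : |∫ s in (0 : ℝ)..t, C * (χ s * Real.exp (N * clk χ s))| =
      C * ((Real.exp (N * clk χ t) - 1) / N) := by
    rw [intervalIntegral.integral_const_mul, abs_mul, abs_of_nonneg hC]
    congr 1
    have hpos : 0 ≤ (Real.exp (N * clk χ t) - 1) / N :=
      div_nonneg (sub_nonneg.2 (Real.one_le_exp (mul_nonneg hN.le (clk_nonneg t)))) hN.le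
    rcases le_total 0 t with ht | ht
    · have e : ∫ s in (0 : ℝ)..t, χ s * Real.exp (N * clk χ s) =
          ∫ s in (0 : ℝ)..t, χ s * Real.exp (N * ∫ r in (0 : ℝ)..s, χ r) :=
        integral_congr fun s hs => by
          rw [uIcc_of_le ht] at hs
          simp only [h.clk_of_nonneg hs.1]
      have hc : Continuous fun s => ∫ r in (0 : ℝ)..s, χ r :=
        continuous_iff_continuousAt.2 fun s => (hm s).continuousAt
      rw [e, integral_eq_sub_of_hasDerivAt (f := fun s => Real.exp (N * ∫ r in (0 : ℝ)..s, χ r) / N)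
        (fun s _ => ((((hm s).const_mul N).exp).div_const N).congr_deriv (by field_simp))
        (Continuous.intervalIntegrable (by fun_prop) _ _)]
      · simp only [integral_same, mul_zero, Real.exp_zero, ← h.clk_of_nonneg ht, ← sub_div]
        exact abs_of_nonneg hpos
    · have e : ∫ s in (0 : ℝ)..t, χ s * Real.exp (N * clk χ s) =
          ∫ s in (0 : ℝ)..t, χ s * Real.exp (N * -∫ r in (0 : ℝ)..s, χ r) :=
        integral_congr fun s hs => by
          rw [uIcc_of_ge ht] at hs
          simp only [h.clk_of_nonpos hs.2]
      have hc : Continuous fun s => ∫ r in (0 : ℝ)..s, χ r :=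
        continuous_iff_continuousAt.2 fun s => (hm s).continuousAt
      rw [e, integral_eq_sub_of_hasDerivAt
        (f := fun s => -(Real.exp (N * -∫ r in (0 : ℝ)..s, χ r) / N))
        (fun s _ => (((((hm s).neg.const_mul N).exp).div_const N).neg).congr_deriv (by
          simp only [Pi.neg_apply]
          field_simp)) (Continuous.intervalIntegrable (by fun_prop) _ _)]
      simp only [integral_same, neg_zero, mul_zero, Real.exp_zero, ← h.clk_of_nonpos ht]
      rw [← abs_neg, ← abs_of_nonneg hpos, sub_div]
      congr 1
      ring
  rw [← Real.norm_eq_abs]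
  refine (norm_integral_le_abs_of_norm_le (μ := volume) (g := fun s => C * (χ s * Real.exp (N * clk χ s))) ?_
    (Continuous.intervalIntegrable (by fun_prop) _ _)).trans ?_
  · refine (ae_restrict_iff' measurableSet_uIoc).2 (Eventually.of_forall fun s hs => ?_)
    rw [norm_mul, Real.norm_of_nonneg (h.nonneg s), mul_left_comm]
    exact mul_le_mul_of_nonneg_left (hg s (uIoc_subset_uIcc hs)) (h.nonneg s)
  · rw [hexp, div_mul_eq_mul_div, mul_div_assoc]
    gcongr
    linarith

/-- A Grönwall inequality on a backward cone for functions integrated along several families of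
characteristics. -/
theorem cone_gronwall {ι : Type*} [Fintype ι] {lam lam' : ι → ℝ × ℝ → ℝ} {φ : ι → ℝ × ℝ × ℝ → ℝ}
    (hχ : Clock χ σ) (hs : ∀ i, Speed (lam i) (lam' i) Λ Λ') (hφ : ∀ i, IsFlow χ (lam i) (φ i))
    (hΛ : 0 ≤ Λ) {f : ℝ × ℝ → ι → ℝ} {R a A D N : ℝ} {I : Set ℝ} (hI : I.OrdConnected) (h0 : (0 : ℝ) ∈ I)
    (hf : ContinuousOn f (I ×ˢ univ)) (hA : 0 ≤ A) (hD : 0 ≤ D) (ha : 0 ≤ a) (hN : 0 < N) (hAN : 2 * A ≤ N)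
    (hint : ∀ t ∈ I, ∀ x, rad χ Λ (t, x) ≤ R → ∀ i, ∃ g : ℝ → ℝ,
      (∀ s ∈ uIcc 0 t, |g s| ≤ A * ‖f (s, φ i (s, t, x))‖ + D * Real.exp (N * clk χ s)) ∧
      |f (t, x) i| ≤ a + |∫ s in (0 : ℝ)..t, χ s * g s|) :
    ∀ t ∈ I, ∀ x, rad χ Λ (t, x) ≤ R → ‖f (t, x)‖ ≤ (2 * a + 2 * D / N) * Real.exp (N * clk χ t) := by
  intro t₀ ht₀ x₀ hx₀
  have hcl := hχ.continuous_clk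
  have hrad := hχ.continuous_rad (Λ := Λ)
  let K : Set (ℝ × ℝ) := (uIcc 0 t₀ ×ˢ univ) ∩ {p | rad χ Λ p ≤ R}
  have hsub : uIcc 0 t₀ ⊆ I := hI.uIcc_subset h0 ht₀
  have hK : IsCompact K := by
    refine ((isCompact_uIcc (a := 0) (b := t₀)).prod (isCompact_Icc (a := -R) (b := R))).of_isClosed_subset
      ((isClosed_Icc.prod isClosed_univ).inter (isClosed_le hrad continuous_const)) ?_
    rintro ⟨s, y⟩ ⟨⟨h1, -⟩, h2⟩
    refine ⟨h1, abs_le.1 ?_⟩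
    have := mul_nonneg hΛ (clk_nonneg (χ := χ) s)
    simp only [mem_ofPred_eq, rad] at h2
    linarith
  have hmem : (t₀, x₀) ∈ K := ⟨⟨right_mem_uIcc, mem_univ _⟩, hx₀⟩
  obtain ⟨⟨t, x⟩, ⟨⟨ht, -⟩, hx⟩, hmax⟩ := hK.exists_isMaxOn (f := fun p => ‖f p‖ * Real.exp (-(N * clk χ p.1)))
    ⟨_, hmem⟩ (ContinuousOn.mul (hf.mono fun p hp => ⟨hsub hp.1.1, mem_univ _⟩).norm
      (by fun_prop))
  obtain ⟨X, hX⟩ : ∃ X, X = ‖f (t, x)‖ * Real.exp (-(N * clk χ t)) := ⟨_, rfl⟩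
  have hX0 : 0 ≤ X := by rw [hX]; positivity
  have hall : ∀ p ∈ K, ‖f p‖ ≤ X * Real.exp (N * clk χ p.1) := fun p hp => by
    have := hmax hp
    simp only [mem_ofPred_eq] at this
    rw [← hX, Real.exp_neg, ← div_eq_mul_inv, div_le_iff₀ (Real.exp_pos _)] at this
    exact this
  have hb : ‖f (t, x)‖ ≤ (a + (A * X + D) / N) * Real.exp (N * clk χ t) := by
    have he : 1 ≤ Real.exp (N * clk χ t) := Real.one_le_exp (mul_nonneg hN.le (clk_nonneg t))
    refine (pi_norm_le_iff_of_nonneg (by positivity)).2 fun i => ?_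
    obtain ⟨g, hg, hle⟩ := hint t (hsub ht) x hx i
    have := hχ.abs_integral_le_exp (g := g) (C := A * X + D) (t := t) hN (by positivity) fun s hs' => by
      refine (hg s hs').trans ?_
      have h1 : (s, φ i (s, t, x)) ∈ K :=
        ⟨⟨(uIcc_subset_uIcc_left ht) hs', mem_univ _⟩, ((hφ i).rad_le hχ (hs i) hs' x).trans hx⟩
      have := mul_le_mul_of_nonneg_left (hall _ h1) hA
      simp only at this
      linarith
    rw [Real.norm_eq_abs]
    nlinarith
  have hX2 : X ≤ a + (A * X + D) / N := by
    refine hX.le.trans ?_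
    rw [Real.exp_neg, ← div_eq_mul_inv, div_le_iff₀ (Real.exp_pos _)]
    exact hb
  have h5 : A * X / N ≤ X / 2 := by
    rw [div_le_div_iff₀ hN two_pos]
    nlinarith
  refine (hall _ hmem).trans (mul_le_mul_of_nonneg_right ?_ (Real.exp_pos _).le)
  rw [add_div] at hX2
  have : 2 * D / N = 2 * (D / N) := by ring
  linarith

end Cone

end

section

theorem hasDerivWithinAt_sub_along {f f' : ℝ × ℝ → ℝ} {I : Set ℝ} {X : ℝ → ℝ} {X' t : ℝ}
    (hd : ∀ s ∈ I, ∀ y, HasDerivAt (fun y => f (s, y)) (f' (s, y)) y)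
    (hc : ContinuousWithinAt f' (I ×ˢ univ) (t, X t)) (hX : HasDerivWithinAt X X' I t) :
    HasDerivWithinAt (fun s => f (s, X s) - f (s, X t)) (f' (t, X t) * X') I t := by
  have key : (fun s => f (s, X s) - f (s, X t) - f' (t, X t) * (X s - X t)) =o[nhdsWithin t I]
      fun s => s - t := by
    have h1 : (fun s => f (s, X s) - f (s, X t) - f' (t, X t) * (X s - X t)) =o[nhdsWithin t I]
        fun s => X s - X t := by
      rw [Asymptotics.isLittleO_iff]
      intro ε hε
      obtain ⟨δ, hδ, hball⟩ := Metric.continuousWithinAt_iff.1 hc ε hε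
      have hXc := Metric.continuousWithinAt_iff.1 hX.continuousWithinAt δ hδ
      obtain ⟨δ', hδ', hX'⟩ := hXc
      filter_upwards [self_mem_nhdsWithin, mem_nhdsWithin_of_mem_nhds (Metric.ball_mem_nhds t hδ'),
        mem_nhdsWithin_of_mem_nhds (Metric.ball_mem_nhds t hδ)] with s hs hs' hs''
      have hseg := Convex.norm_image_sub_le_of_norm_hasDerivWithin_le (s := Metric.ball (X t) δ)
        (f := fun y => f (s, y) - f' (t, X t) * y) (f' := fun y => f' (s, y) - f' (t, X t)) (C := ε)
        (x := X t) (y := X s)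
        (fun y _ => ((hd s hs y).sub (by simpa using (hasDerivAt_id y).const_mul (f' (t, X t)))).hasDerivWithinAt)
        (fun y hy => by
          have : dist (s, y) (t, X t) < δ := by
            rw [Prod.dist_eq]
            exact max_lt hs'' hy
          have := hball (x := (s, y)) ⟨hs, mem_univ _⟩ this
          rw [Real.dist_eq] at this
          exact this.le) (convex_ball _ _) (Metric.mem_ball_self hδ) (hX' hs hs')
      refine (congrArg norm ?_).trans_le hseg
      ring
    exact h1.trans_isBigO hX.hasFDerivWithinAt.isBigO_sub
  rw [hasDerivWithinAt_iff_isLittleO]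
  have h2 := key.add ((hasDerivWithinAt_iff_isLittleO.1 hX).const_mul_left (f' (t, X t)))
  refine h2.congr_left fun s => ?_
  simp only [smul_eq_mul]
  ring

/-- The map `q` is `C²` and, together with its derivative, bounded and Lipschitz with constant `M`
on the ball of radius `B`. -/
structure BallBound {G H : Type*} [NormedAddCommGroup G] [NormedSpace ℝ G] [NormedAddCommGroup H]
    [NormedSpace ℝ H] (q : G → H) (B M : ℝ) : Prop where
  contDiff : ContDiff ℝ 2 q
  bound : ∀ z, ‖z‖ ≤ B → ‖q z‖ ≤ M
  bound' : ∀ z, ‖z‖ ≤ B → ‖fderiv ℝ q z‖ ≤ M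
  lip' : ∀ z z', ‖z‖ ≤ B → ‖z'‖ ≤ B → ‖fderiv ℝ q z - fderiv ℝ q z'‖ ≤ M * ‖z - z'‖

section BallBound

variable {G H : Type*} [NormedAddCommGroup G] [NormedSpace ℝ G] [NormedAddCommGroup H]
    [NormedSpace ℝ H] {q : G → H} {B M M' : ℝ}

theorem BallBound.mono (h : BallBound q B M) (hM : M ≤ M') : BallBound q B M' :=
  ⟨h.contDiff, fun z hz => (h.bound z hz).trans hM, fun z hz => (h.bound' z hz).trans hM,
    fun z z' hz hz' => (h.lip' z z' hz hz').trans (by gcongr)⟩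

theorem BallBound.hasFDerivAt (h : BallBound q B M) (z : G) : HasFDerivAt q (fderiv ℝ q z) z :=
  (h.contDiff.differentiable (by norm_num) z).hasFDerivAt

theorem BallBound.continuous_fderiv (h : BallBound q B M) : Continuous (fderiv ℝ q) :=
  h.contDiff.continuous_fderiv (by norm_num)

theorem BallBound.lip (h : BallBound q B M) {z z' : G} (hz : ‖z‖ ≤ B) (hz' : ‖z'‖ ≤ B) :
    ‖q z - q z'‖ ≤ M * ‖z - z'‖ :=
  Convex.norm_image_sub_le_of_norm_hasFDerivWithin_le (s := Metric.closedBall 0 B)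
    (fun z _ => (h.hasFDerivAt z).hasFDerivWithinAt)
    (fun z hz => h.bound' z (mem_closedBall_zero_iff.1 hz)) (convex_closedBall _ _)
    (mem_closedBall_zero_iff.2 hz') (mem_closedBall_zero_iff.2 hz)

theorem exists_ballBound [ProperSpace G] (hq : ContDiff ℝ 2 q) (B : ℝ) : ∃ M, BallBound q B M := by
  have hK := isCompact_closedBall (0 : G) B
  have hc1 : ContDiff ℝ 1 (fderiv ℝ q) := hq.fderiv_right (by norm_num)
  obtain ⟨M1, h1⟩ := hK.exists_bound_of_continuousOn hq.continuous.continuousOn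
  obtain ⟨M2, h2⟩ := hK.exists_bound_of_continuousOn hc1.continuous.continuousOn
  obtain ⟨K, hL⟩ := hc1.contDiffOn.exists_lipschitzOnWith one_ne_zero (convex_closedBall (0 : G) B) hK
  refine ⟨max M1 (max M2 K), hq, fun z hz => (h1 z (mem_closedBall_zero_iff.2 hz)).trans (le_max_left _ _),
    fun z hz => (h2 z (mem_closedBall_zero_iff.2 hz)).trans
      ((le_max_left _ _).trans (le_max_right _ _)), fun z z' hz hz' => ?_⟩
  have := hL.dist_le_mul z (mem_closedBall_zero_iff.2 hz) z' (mem_closedBall_zero_iff.2 hz')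
  rw [dist_eq_norm, dist_eq_norm] at this
  refine this.trans ?_
  gcongr
  exact (le_max_right _ _).trans (le_max_right _ _)

end BallBound

/-- Limits of sequences whose increments decay geometrically, with a locally bounded constant. -/
theorem exists_limit_of_geometric {X H : Type*} [TopologicalSpace X] [NormedAddCommGroup H] [CompleteSpace H]
    {f : ℕ → X → H} {C : ℝ → ℝ} {ρ : X → ℝ} (hC : Monotone C) (hρ : Continuous ρ)
    (hf : ∀ n, Continuous (f n)) (hd : ∀ n p, ‖f (n + 1) p - f n p‖ ≤ C (ρ p) / 2 / 2 ^ n) :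
    ∃ g : X → H, Continuous g ∧ (∀ n p, ‖f n p - g p‖ ≤ C (ρ p) / 2 ^ n) ∧
      ∀ p, Tendsto (fun n => f n p) atTop (nhds (g p)) := by
  have hd' : ∀ p n, dist (f n p) (f (n + 1) p) ≤ C (ρ p) / 2 / 2 ^ n := fun p n => by
    rw [dist_comm, dist_eq_norm]
    exact hd n p
  choose g hg using fun p => cauchySeq_tendsto_of_complete (cauchySeq_of_le_geometric_two (hd' p))
  have hle : ∀ n p, ‖f n p - g p‖ ≤ C (ρ p) / 2 ^ n := fun n p => by
    rw [← dist_eq_norm]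
    exact dist_le_of_le_geometric_two_of_tendsto (hd' p) (hg p) n
  refine ⟨g, ?_, hle, hg⟩
  have hloc : TendstoLocallyUniformly f g atTop := by
    rw [Metric.tendstoLocallyUniformly_iff]
    intro ε hε p
    refine ⟨{x | ρ x < ρ p + 1}, (isOpen_lt hρ continuous_const).mem_nhds (by simp), ?_⟩
    have h1 : Tendsto (fun n : ℕ => C (ρ p + 1) / 2 ^ n) atTop (nhds 0) :=
      tendsto_const_nhds.div_atTop (tendsto_pow_atTop_atTop_of_one_lt one_lt_two)
    filter_upwards [h1.eventually (gt_mem_nhds hε)] with n hn x hx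
    rw [dist_comm, dist_eq_norm]
    refine (hle n x).trans_lt (lt_of_le_of_lt ?_ hn)
    gcongr
    exact hC (le_of_lt hx)
  exact hloc.continuous (Frequently.of_forall hf)

/-- A pointwise limit of differentiable functions whose derivatives converge locally uniformly. -/
theorem hasDerivAt_of_geometric {H : Type*} [NormedAddCommGroup H] [NormedSpace ℝ H]
    {f f' : ℕ → ℝ → H} {g g' : ℝ → H} {C : ℝ → ℝ} {ρ : ℝ → ℝ} (hC : Monotone C) (hρ : Continuous ρ)
    (hd : ∀ n x, HasDerivAt (f n) (f' n x) x) (hf : ∀ x, Tendsto (fun n => f n x) atTop (nhds (g x)))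
    (hle : ∀ n x, ‖f' n x - g' x‖ ≤ C (ρ x) / 2 ^ n) (x : ℝ) : HasDerivAt g (g' x) x := by
  refine hasDerivAt_of_tendstoLocallyUniformlyOn (f := f) (f' := f') isOpen_univ ?_
    (Eventually.of_forall fun n x _ => hd n x) (fun x _ => hf x) (mem_univ x)
  rw [tendstoLocallyUniformlyOn_univ, Metric.tendstoLocallyUniformly_iff]
  intro ε hε p
  refine ⟨{x | ρ x < ρ p + 1}, (isOpen_lt hρ continuous_const).mem_nhds (by simp), ?_⟩
  have h1 : Tendsto (fun n : ℕ => C (ρ p + 1) / 2 ^ n) atTop (nhds 0) :=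
    tendsto_const_nhds.div_atTop (tendsto_pow_atTop_atTop_of_one_lt one_lt_two)
  filter_upwards [h1.eventually (gt_mem_nhds hε)] with n hn x hx
  rw [dist_comm, dist_eq_norm]
  refine (hle n x).trans_lt (lt_of_le_of_lt ?_ hn)
  gcongr
  exact hC (le_of_lt hx)

section Transport

variable {χ : ℝ → ℝ} {σ Λ Λ' : ℝ} {lam lam' : ℝ × ℝ → ℝ} {φ : ℝ × ℝ × ℝ → ℝ}

/-- The solution of `f_t + χ lam f_x = χ g`, `f (0, x) = f₀ x`, along the characteristics `φ`. -/
def transport (χ : ℝ → ℝ) (φ : ℝ × ℝ × ℝ → ℝ) (f₀ : ℝ → ℝ) (g : ℝ × ℝ → ℝ) (p : ℝ × ℝ) : ℝ :=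
  f₀ (φ (0, p)) + ∫ s in (0 : ℝ)..p.1, χ s * g (s, φ (s, p))

/-- The `x`-derivative of `transport`. -/
def transportDeriv (χ : ℝ → ℝ) (lam' : ℝ × ℝ → ℝ) (φ : ℝ × ℝ × ℝ → ℝ) (f₀' : ℝ → ℝ) (g' : ℝ × ℝ → ℝ)
    (p : ℝ × ℝ) : ℝ :=
  f₀' (φ (0, p)) * flowJac χ lam' φ (0, p) +
    ∫ s in (0 : ℝ)..p.1, χ s * (g' (s, φ (s, p)) * flowJac χ lam' φ (s, p))

theorem continuous_transport (hφ : IsFlow χ lam φ) (hχ : Clock χ σ) {f₀ : ℝ → ℝ} {g : ℝ × ℝ → ℝ}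
    (hf : Continuous f₀) (hg : Continuous g) : Continuous (transport χ φ f₀ g) := by
  have h1 := hφ.cont
  have h2 := hχ.cont
  refine Continuous.add (by fun_prop) (continuous_intervalIntegral_prod
    (f := fun (p : ℝ × ℝ) s => χ s * g (s, φ (s, p))) ?_ ?_ ?_) <;> fun_prop

theorem continuous_transportDeriv (hφ : IsFlow χ lam φ) (hχ : Clock χ σ) (hs : Speed lam lam' Λ Λ')
    {f₀' : ℝ → ℝ} {g' : ℝ × ℝ → ℝ} (hf : Continuous f₀') (hg : Continuous g') :
    Continuous (transportDeriv χ lam' φ f₀' g') := by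
  have h1 := hφ.cont
  have h2 := hχ.cont
  have h3 := continuous_flowJac hφ hχ hs
  refine Continuous.add (by fun_prop) (continuous_intervalIntegral_prod
    (f := fun (p : ℝ × ℝ) s => χ s * (g' (s, φ (s, p)) * flowJac χ lam' φ (s, p))) ?_ ?_ ?_) <;> fun_prop

theorem hasDerivAt_transport (hφ : IsFlow χ lam φ) (hχ : Clock χ σ) (hs : Speed lam lam' Λ Λ')
    {f₀ f₀' : ℝ → ℝ} {g g' : ℝ × ℝ → ℝ} (hf : ∀ x, HasDerivAt f₀ (f₀' x) x) (hgc : Continuous g)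
    (hg'c : Continuous g') (hg : ∀ t x, HasDerivAt (fun y => g (t, y)) (g' (t, x)) x) (t x : ℝ) :
    HasDerivAt (fun y => transport χ φ f₀ g (t, y)) (transportDeriv χ lam' φ f₀' g' (t, x)) x := by
  have h1 := hφ.cont
  have h2 := hχ.cont
  have h3 := continuous_flowJac hφ hχ hs
  refine ((hf _).comp x (hφ.hasDerivAt hχ hs 0 t x)).add
    (hasDerivAt_intervalIntegral_of_continuous (F := fun y s => χ s * g (s, φ (s, t, y)))
      (F' := fun y s => χ s * (g' (s, φ (s, t, y)) * flowJac χ lam' φ (s, t, y))) ?_ ?_ ?_ 0 t x)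
  · fun_prop
  · fun_prop
  · exact fun y s => ((hg s _).comp y (hφ.hasDerivAt hχ hs s t y)).const_mul (χ s)

theorem transport_along (hφ : IsFlow χ lam φ) (hχ : Clock χ σ) (hs : Speed lam lam' Λ Λ')
    (f₀ : ℝ → ℝ) (g : ℝ × ℝ → ℝ) (s t x : ℝ) :
    transport χ φ f₀ g (s, φ (s, t, x)) =
      f₀ (φ (0, t, x)) + ∫ r in (0 : ℝ)..s, χ r * g (r, φ (r, t, x)) := by
  simp only [transport, hφ.comp_eq hχ hs]

theorem hasDerivAt_time_transport (hφ : IsFlow χ lam φ) (hχ : Clock χ σ) (hs : Speed lam lam' Λ Λ')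
    {f₀ : ℝ → ℝ} {f f' g : ℝ × ℝ → ℝ} (hf : ∀ p, f p = transport χ φ f₀ g p) (hgc : Continuous g)
    (hf'c : Continuous f') (hd : ∀ t x, HasDerivAt (fun y => f (t, y)) (f' (t, x)) x) (t x : ℝ) :
    HasDerivAt (fun s => f (s, x)) (χ t * (g (t, x) - lam (t, x) * f' (t, x))) t := by
  have h1 := hφ.cont
  have h2 := hχ.cont
  have e1 : HasDerivAt (fun s => f (s, φ (s, t, x))) (χ t * g (t, x)) t := by
    have hc : Continuous fun r => χ r * g (r, φ (r, t, x)) := by fun_prop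
    have e := ((hc.integral_hasStrictDerivAt 0 t).hasDerivAt).const_add (f₀ (φ (0, t, x)))
    simp only [hφ.init] at e
    refine e.congr_of_eventuallyEq (Eventually.of_forall fun s => ?_)
    simp only [hf, transport_along hφ hχ hs]
  have e2 := hasDerivWithinAt_sub_along (I := univ) (X := fun s => φ (s, t, x))
    (fun s _ y => hd s y) hf'c.continuousWithinAt (hφ.deriv t t x).hasDerivWithinAt
  rw [hasDerivWithinAt_univ] at e2
  have e3 := e1.sub e2
  simp only [hφ.init] at e3
  refine (e3.congr_of_eventuallyEq (Eventually.of_forall fun s => ?_)).congr_deriv (by ring)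
  simp

end Transport

end

section

section TransportBounds

variable {χ : ℝ → ℝ} {σ Λ Λ' : ℝ} {lam lam' : ℝ × ℝ → ℝ} {φ : ℝ × ℝ × ℝ → ℝ}

theorem transport_le (hφ : IsFlow χ lam φ) (hχ : Clock χ σ) (hs : Speed lam lam' Λ Λ')
    {f₀ : ℝ → ℝ} {g : ℝ × ℝ → ℝ} {p : ℝ × ℝ} {A C : ℝ} (hC : 0 ≤ C)
    (hf : ∀ x, |x| ≤ rad χ Λ p → |f₀ x| ≤ A)
    (hg : ∀ p', rad χ Λ p' ≤ rad χ Λ p → |g p'| ≤ C) : |transport χ φ f₀ g p| ≤ A + σ * C := by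
  obtain ⟨t, x⟩ := p
  refine (abs_add_le _ _).trans (add_le_add (hf _ ?_) ?_)
  · simpa using hφ.rad_le hχ hs (left_mem_uIcc (a := 0) (b := t)) x
  · exact hχ.norm_integral_le (g := fun s => g (s, φ (s, t, x))) hC fun s hst _ =>
      hg _ (hφ.rad_le hχ hs (uIoc_subset_uIcc hst) x)

theorem transportDeriv_le (hφ : IsFlow χ lam φ) (hχ : Clock χ σ) (hs : Speed lam lam' Λ Λ')
    (hσ : σ * Λ' ≤ 1 / 4) {f₀ : ℝ → ℝ} {g : ℝ × ℝ → ℝ} {p : ℝ × ℝ} {A C : ℝ} (hC : 0 ≤ C)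
    (hf : ∀ x, |x| ≤ rad χ Λ p → |f₀ x| ≤ A)
    (hg : ∀ p', rad χ Λ p' ≤ rad χ Λ p → |g p'| ≤ C) :
    |transportDeriv χ lam' φ f₀ g p| ≤ 2 * A + 2 * (σ * C) := by
  obtain ⟨t, x⟩ := p
  have hJ : ∀ (a : ℝ) (D : ℝ) (s : ℝ), |a| ≤ D → |a * flowJac χ lam' φ (s, t, x)| ≤ 2 * D :=
    fun a D s ha => by
      rw [abs_mul, abs_of_pos (flowJac_pos _)]
      have := flowJac_le (φ := φ) hχ hs hσ (s, t, x)
      have := abs_nonneg a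
      nlinarith
  refine (abs_add_le _ _).trans (add_le_add (hJ _ _ _ (hf _ ?_)) ?_)
  · simpa using hφ.rad_le hχ hs (left_mem_uIcc (a := 0) (b := t)) x
  · refine (hχ.norm_integral_le (g := fun s => g (s, φ (s, t, x)) * flowJac χ lam' φ (s, t, x))
      (C := 2 * C) (by positivity) fun s hst _ =>
      hJ _ _ _ (hg _ (hφ.rad_le hχ hs (uIoc_subset_uIcc hst) x))).trans_eq (by ring)

theorem transport_sub (hφ : IsFlow χ lam φ) (hχ : Clock χ σ) {f₀ : ℝ → ℝ} {g g' : ℝ × ℝ → ℝ}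
    (hg : Continuous g) (hg' : Continuous g') (p : ℝ × ℝ) :
    transport χ φ f₀ g p - transport χ φ f₀ g' p =
      transport χ φ (fun _ => 0) (fun p => g p - g' p) p := by
  have h1 := hφ.cont
  have h2 := hχ.cont
  simp only [transport, mul_sub]
  rw [intervalIntegral.integral_sub (Continuous.intervalIntegrable (by fun_prop) _ _)
    (Continuous.intervalIntegrable (by fun_prop) _ _)]
  ring

theorem transportDeriv_sub (hφ : IsFlow χ lam φ) (hχ : Clock χ σ) (hs : Speed lam lam' Λ Λ')
    {f₀ : ℝ → ℝ} {g g' : ℝ × ℝ → ℝ} (hg : Continuous g) (hg' : Continuous g') (p : ℝ × ℝ) :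
    transportDeriv χ lam' φ f₀ g p - transportDeriv χ lam' φ f₀ g' p =
      transportDeriv χ lam' φ (fun _ => 0) (fun p => g p - g' p) p := by
  have h1 := hφ.cont
  have h2 := hχ.cont
  have h3 := continuous_flowJac hφ hχ hs
  simp only [transportDeriv, mul_sub, sub_mul]
  rw [intervalIntegral.integral_sub (Continuous.intervalIntegrable (by fun_prop) _ _)
    (Continuous.intervalIntegrable (by fun_prop) _ _)]
  ring

end TransportBounds

/-- A finite family of speeds with their flows, for a small clock. -/
structure Chars {ι : Type*} (χ : ℝ → ℝ) (σ Λ Λ' : ℝ) (lam lam' : ι → ℝ × ℝ → ℝ)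
    (φ : ι → ℝ × ℝ × ℝ → ℝ) : Prop where
  clock : Clock χ σ
  speed : ∀ i, Speed (lam i) (lam' i) Λ Λ'
  flow : ∀ i, IsFlow χ (lam i) (φ i)
  small : σ * Λ' ≤ 1 / 4
  nonneg : 0 ≤ Λ

section Semilinear

variable {ι : Type*} [Fintype ι] {F : Type*} [NormedAddCommGroup F] [NormedSpace ℝ F]
  {χ : ℝ → ℝ} {σ Λ Λ' : ℝ} {lam lam' : ι → ℝ × ℝ → ℝ} {φ : ι → ℝ × ℝ × ℝ → ℝ}

/-- One Picard step for the semilinear system `w_t + χ lam w_x = χ q (S, w)`. -/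
def slStep (χ : ℝ → ℝ) (φ : ι → ℝ × ℝ × ℝ → ℝ) (q : F × (ι → ℝ) → ι → ℝ) (S : ℝ × ℝ → F)
    (w₀ : ℝ → ι → ℝ) (w : ℝ × ℝ → ι → ℝ) (p : ℝ × ℝ) : ι → ℝ := fun i =>
  transport χ (φ i) (fun x => w₀ x i) (fun p => q (S p, w p) i) p

/-- The `x`-derivative of `slStep`. -/
def slStepDeriv (χ : ℝ → ℝ) (lam' : ι → ℝ × ℝ → ℝ) (φ : ι → ℝ × ℝ × ℝ → ℝ)
    (q : F × (ι → ℝ) → ι → ℝ) (S Sx : ℝ × ℝ → F) (w₀' : ℝ → ι → ℝ)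
    (w ω : ℝ × ℝ → ι → ℝ) (p : ℝ × ℝ) : ι → ℝ := fun i =>
  transportDeriv χ (lam' i) (φ i) (fun x => w₀' x i)
    (fun p => fderiv ℝ q (S p, w p) (Sx p, ω p) i) p

/-- Bounds under which the semilinear system `w_t + χ lam w_x = χ q (S, w)` is solvable. -/
structure SLBounds (χ : ℝ → ℝ) (σ Λ Λ' : ℝ) (lam lam' : ι → ℝ × ℝ → ℝ) (φ : ι → ℝ × ℝ × ℝ → ℝ)
    (q : F × (ι → ℝ) → ι → ℝ) (S Sx : ℝ × ℝ → F) (w₀ w₀' : ℝ → ι → ℝ) (B B₀ M : ℝ) (K₀ K : ℝ → ℝ) :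
    Prop where
  chars : Chars χ σ Λ Λ' lam lam' φ
  contS : Continuous S
  contSx : Continuous Sx
  derivS : ∀ t x, HasDerivAt (fun y => S (t, y)) (Sx (t, x)) x
  ball : BallBound q B M
  contw : Continuous w₀'
  derivw : ∀ x, HasDerivAt w₀ (w₀' x) x
  boundS : ∀ p, ‖S p‖ ≤ B
  boundw : ∀ x, ‖w₀ x‖ ≤ B₀
  sum_le : B₀ + σ * M ≤ B
  small : σ * M ≤ 1 / 8
  mono₀ : Monotone K₀
  mono : Monotone K
  bound₀ : ∀ x, ‖w₀' x‖ ≤ K₀ |x|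
  boundSx : ∀ p, ‖Sx p‖ ≤ K (rad χ Λ p)
  step : ∀ r, 2 * K₀ r + 2 * (σ * (M * K r)) ≤ K r

variable {q : F × (ι → ℝ) → ι → ℝ} {S Sx : ℝ × ℝ → F} {w₀ w₀' : ℝ → ι → ℝ} {B B₀ M : ℝ}
  {K₀ K : ℝ → ℝ} {w w' ω ω' : ℝ × ℝ → ι → ℝ}

theorem continuous_slStep (hc : Chars χ σ Λ Λ' lam lam' φ) (hq : Continuous q) (hS : Continuous S)
    (hw₀ : Continuous w₀) (hw : Continuous w) : Continuous (slStep χ φ q S w₀ w) :=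
  continuous_pi fun i => continuous_transport (hc.flow i) hc.clock (by fun_prop) (by fun_prop)

theorem norm_apply_le (f : ι → ℝ) (i : ι) : |f i| ≤ ‖f‖ := norm_le_pi_norm f i

namespace SLBounds

theorem continuous_initial (h : SLBounds χ σ Λ Λ' lam lam' φ q S Sx w₀ w₀' B B₀ M K₀ K) :
    Continuous w₀ :=
  continuous_iff_continuousAt.2 fun x => (h.derivw x).continuousAt

theorem const_nonneg (h : SLBounds χ σ Λ Λ' lam lam' φ q S Sx w₀ w₀' B B₀ M K₀ K) : 0 ≤ M :=
  (norm_nonneg _).trans (h.ball.bound 0 (by simpa using (norm_nonneg _).trans (h.boundS 0)))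

theorem K_nonneg (h : SLBounds χ σ Λ Λ' lam lam' φ q S Sx w₀ w₀' B B₀ M K₀ K) {r : ℝ} (hr : 0 ≤ r) :
    0 ≤ K r := by
  refine (norm_nonneg (Sx (0, 0))).trans ((h.boundSx _).trans (h.mono ?_))
  simpa using hr

theorem rad_nonneg' (h : SLBounds χ σ Λ Λ' lam lam' φ q S Sx w₀ w₀' B B₀ M K₀ K) (p : ℝ × ℝ) :
    0 ≤ rad χ Λ p :=
  add_nonneg (abs_nonneg _) (mul_nonneg h.chars.nonneg (clk_nonneg _))

theorem le_B (h : SLBounds χ σ Λ Λ' lam lam' φ q S Sx w₀ w₀' B B₀ M K₀ K) (x : ℝ) : ‖w₀ x‖ ≤ B := by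
  have := h.boundw x
  have := h.sum_le
  have := mul_nonneg h.chars.clock.sigma_nonneg h.const_nonneg
  linarith

theorem norm_step_le (h : SLBounds χ σ Λ Λ' lam lam' φ q S Sx w₀ w₀' B B₀ M K₀ K)
    (hw : ∀ p, ‖w p‖ ≤ B) (p : ℝ × ℝ) : ‖slStep χ φ q S w₀ w p‖ ≤ B := by
  refine (pi_norm_le_iff_of_nonneg ((norm_nonneg _).trans (hw p))).2 fun i => ?_
  refine (transport_le (h.chars.flow i) h.chars.clock (h.chars.speed i) h.const_nonneg
    (fun x _ => (norm_apply_le _ i).trans (h.boundw x))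
    (fun p' _ => (norm_apply_le _ i).trans (h.ball.bound (S p', w p') ?_))).trans h.sum_le
  exact max_le (h.boundS p') (hw p')

theorem norm_stepDeriv_le (h : SLBounds χ σ Λ Λ' lam lam' φ q S Sx w₀ w₀' B B₀ M K₀ K)
    (hw : ∀ p, ‖w p‖ ≤ B) (hω : ∀ p, ‖ω p‖ ≤ K (rad χ Λ p)) (p : ℝ × ℝ) :
    ‖slStepDeriv χ lam' φ q S Sx w₀' w ω p‖ ≤
      2 * K₀ (rad χ Λ p) + 2 * (σ * (M * K (rad χ Λ p))) := by
  have hK := h.K_nonneg (h.rad_nonneg' p)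
  have hM := h.const_nonneg
  have hi : ∀ i, |slStepDeriv χ lam' φ q S Sx w₀' w ω p i| ≤
      2 * K₀ (rad χ Λ p) + 2 * (σ * (M * K (rad χ Λ p))) := fun i =>
    transportDeriv_le (h.chars.flow i) h.chars.clock (h.chars.speed i) h.chars.small
      (by positivity)
      (fun x hx => (norm_apply_le _ i).trans ((h.bound₀ x).trans (h.mono₀ hx)))
      (fun p' hp' => (norm_apply_le _ i).trans (by
        refine (ContinuousLinearMap.le_opNorm _ _).trans ?_
        refine mul_le_mul (h.ball.bound' _ (max_le (h.boundS p') (hw p'))) ?_ (norm_nonneg _) hM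
        exact (max_le (h.boundSx p') (hω p')).trans (h.mono hp')))
  have h0 : 0 ≤ K₀ (rad χ Λ p) :=
    (norm_nonneg (w₀' 0)).trans ((h.bound₀ 0).trans (h.mono₀ (by simpa using h.rad_nonneg' p)))
  have hσ := h.chars.clock.sigma_nonneg
  exact (pi_norm_le_iff_of_nonneg (by positivity)).2 hi

theorem norm_step_sub_le (h : SLBounds χ σ Λ Λ' lam lam' φ q S Sx w₀ w₀' B B₀ M K₀ K)
    (hw : ∀ p, ‖w p‖ ≤ B) (hw' : ∀ p, ‖w' p‖ ≤ B) (hwc : Continuous w) (hwc' : Continuous w')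
    {d : ℝ} (hd : ∀ p, ‖w p - w' p‖ ≤ d) (p : ℝ × ℝ) :
    ‖slStep χ φ q S w₀ w p - slStep χ φ q S w₀ w' p‖ ≤ d / 8 := by
  have hd0 : 0 ≤ d := (norm_nonneg _).trans (hd p)
  have hM := h.const_nonneg
  have hqc := h.ball.contDiff.continuous
  have hSc := h.contS
  refine (pi_norm_le_iff_of_nonneg (by positivity)).2 fun i => ?_
  have e := transport_sub (f₀ := fun x => w₀ x i) (h.chars.flow i) h.chars.clock
    (g := fun p => q (S p, w p) i) (g' := fun p => q (S p, w' p) i)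
    (by fun_prop) (by fun_prop) p
  simp only [Pi.sub_apply, slStep, Real.norm_eq_abs, e]
  refine (transport_le (A := 0) (C := M * d) (h.chars.flow i) h.chars.clock (h.chars.speed i) (by positivity)
    (by simp) (fun p' _ => (norm_apply_le (q (S p', w p') - q (S p', w' p')) i).trans ?_)).trans ?_
  · refine (h.ball.lip (max_le (h.boundS p') (hw p')) (max_le (h.boundS p') (hw' p'))).trans ?_
    refine mul_le_mul_of_nonneg_left ?_ hM
    simpa using hd p'
  · have := h.small
    nlinarith

theorem norm_stepDeriv_sub_le (h : SLBounds χ σ Λ Λ' lam lam' φ q S Sx w₀ w₀' B B₀ M K₀ K)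
    (hw : ∀ p, ‖w p‖ ≤ B) (hw' : ∀ p, ‖w' p‖ ≤ B) (hwc : Continuous w) (hwc' : Continuous w')
    (hω : ∀ p, ‖ω p‖ ≤ K (rad χ Λ p)) (hωc : Continuous ω) (hωc' : Continuous ω')
    {d : ℝ} {e : ℝ → ℝ} (hd : ∀ p, ‖w p - w' p‖ ≤ d) (he : Monotone e)
    (hωe : ∀ p, ‖ω p - ω' p‖ ≤ e (rad χ Λ p)) (p : ℝ × ℝ) :
    ‖slStepDeriv χ lam' φ q S Sx w₀' w ω p - slStepDeriv χ lam' φ q S Sx w₀' w' ω' p‖ ≤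
      (d * K (rad χ Λ p) + e (rad χ Λ p)) / 4 := by
  have hd0 : 0 ≤ d := (norm_nonneg _).trans (hd p)
  have he0 : 0 ≤ e (rad χ Λ p) := (norm_nonneg _).trans (hωe p)
  have hK := h.K_nonneg (h.rad_nonneg' p)
  have hM := h.const_nonneg
  have hqc := h.ball.continuous_fderiv
  have hSc := h.contS
  have hSxc := h.contSx
  refine (pi_norm_le_iff_of_nonneg (by positivity)).2 fun i => ?_
  have hsub := transportDeriv_sub (f₀ := fun x => w₀' x i) (h.chars.flow i) h.chars.clock (h.chars.speed i)
    (g := fun p => fderiv ℝ q (S p, w p) (Sx p, ω p) i)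
    (g' := fun p => fderiv ℝ q (S p, w' p) (Sx p, ω' p) i)
    (by fun_prop) (by fun_prop) p
  simp only [Pi.sub_apply, slStepDeriv, Real.norm_eq_abs, hsub]
  refine (transportDeriv_le (A := 0) (h.chars.flow i) h.chars.clock (h.chars.speed i) h.chars.small
    (C := M * (d * K (rad χ Λ p) + e (rad χ Λ p))) (by positivity) (by simp) (fun p' hp' =>
    (norm_apply_le (fderiv ℝ q (S p', w p') (Sx p', ω p') -
      fderiv ℝ q (S p', w' p') (Sx p', ω' p')) i).trans ?_)).trans ?_
  · have hz := max_le (h.boundS p') (hw p')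
    have hz' := max_le (h.boundS p') (hw' p')
    have e1 : fderiv ℝ q (S p', w p') (Sx p', ω p') - fderiv ℝ q (S p', w' p') (Sx p', ω' p') =
        (fderiv ℝ q (S p', w p') - fderiv ℝ q (S p', w' p')) (Sx p', ω p') +
        fderiv ℝ q (S p', w' p') (0, ω p' - ω' p') := by
      rw [sub_apply, show ((0 : F), ω p' - ω' p') =
        (Sx p', ω p') - (Sx p', ω' p') by simp, map_sub]
      abel
    rw [e1, mul_add, ← mul_assoc]
    refine (norm_add_le _ _).trans (add_le_add ?_ ?_)
    · refine (ContinuousLinearMap.le_opNorm _ _).trans (mul_le_mul ?_ ?_ (norm_nonneg _) (by positivity))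
      · refine (h.ball.lip' (S p', w p') (S p', w' p') hz hz').trans (mul_le_mul_of_nonneg_left ?_ hM)
        simpa using hd p'
      · exact (max_le (h.boundSx p') (hω p')).trans (h.mono hp')
    · refine (ContinuousLinearMap.le_opNorm _ _).trans
        (mul_le_mul (h.ball.bound' _ hz') ?_ (norm_nonneg _) hM)
      exact max_le (by simpa using he0) ((hωe p').trans (he hp'))
  · have := h.small
    nlinarith [add_nonneg (mul_nonneg hd0 hK) he0]

end SLBounds

end Semilinear

end

section

section SemilinearSolution

variable {ι : Type*} [Fintype ι] {F : Type*} [NormedAddCommGroup F] [NormedSpace ℝ F]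
  {χ : ℝ → ℝ} {σ Λ Λ' : ℝ} {lam lam' : ι → ℝ × ℝ → ℝ} {φ : ι → ℝ × ℝ × ℝ → ℝ}
  {q : F × (ι → ℝ) → ι → ℝ} {S Sx : ℝ × ℝ → F} {w₀ w₀' : ℝ → ι → ℝ} {B B₀ M : ℝ}
  {K₀ K : ℝ → ℝ} {w w' ω ω' : ℝ × ℝ → ι → ℝ}

/-- A `C¹` solution `w` of `w_t + χ lam w_x = χ q (S, w)` with `w_x = ω`. -/
structure SLSol (χ : ℝ → ℝ) (lam' : ι → ℝ × ℝ → ℝ) (φ : ι → ℝ × ℝ × ℝ → ℝ)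
    (q : F × (ι → ℝ) → ι → ℝ) (S Sx : ℝ × ℝ → F) (w₀ w₀' : ℝ → ι → ℝ) (w ω : ℝ × ℝ → ι → ℝ) :
    Prop where
  cont : Continuous w
  contx : Continuous ω
  deriv : ∀ t x, HasDerivAt (fun y => w (t, y)) (ω (t, x)) x
  eq : ∀ p, w p = slStep χ φ q S w₀ w p
  eqx : ∀ p, ω p = slStepDeriv χ lam' φ q S Sx w₀' w ω p

theorem SLSol.initial (hc : Chars χ σ Λ Λ' lam lam' φ) (h : SLSol χ lam' φ q S Sx w₀ w₀' w ω)
    (x : ℝ) : w (0, x) = w₀ x := by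
  rw [h.eq]
  funext i
  simp [slStep, transport, (hc.flow i).init]

/-- The Picard iterates of the semilinear system, with their `x`-derivatives. -/
def slSeq (χ : ℝ → ℝ) (lam' : ι → ℝ × ℝ → ℝ) (φ : ι → ℝ × ℝ × ℝ → ℝ)
    (q : F × (ι → ℝ) → ι → ℝ) (S Sx : ℝ × ℝ → F) (w₀ w₀' : ℝ → ι → ℝ) :
    ℕ → (ℝ × ℝ → ι → ℝ) × (ℝ × ℝ → ι → ℝ)
  | 0 => (fun p => w₀ p.2, fun p => w₀' p.2)
  | n + 1 => (slStep χ φ q S w₀ (slSeq χ lam' φ q S Sx w₀ w₀' n).1,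
      slStepDeriv χ lam' φ q S Sx w₀' (slSeq χ lam' φ q S Sx w₀ w₀' n).1
        (slSeq χ lam' φ q S Sx w₀ w₀' n).2)

namespace SLBounds

theorem continuous_step (h : SLBounds χ σ Λ Λ' lam lam' φ q S Sx w₀ w₀' B B₀ M K₀ K)
    (hw : Continuous w) : Continuous (slStep χ φ q S w₀ w) :=
  continuous_slStep h.chars h.ball.contDiff.continuous h.contS h.continuous_initial hw

theorem continuous_stepDeriv (h : SLBounds χ σ Λ Λ' lam lam' φ q S Sx w₀ w₀' B B₀ M K₀ K)
    (hw : Continuous w) (hω : Continuous ω) : Continuous (slStepDeriv χ lam' φ q S Sx w₀' w ω) := by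
  have h1 := h.contS
  have h2 := h.contSx
  have h3 := h.ball.continuous_fderiv
  have h4 := h.contw
  exact continuous_pi fun i => continuous_transportDeriv (h.chars.flow i) h.chars.clock
    (h.chars.speed i) (by fun_prop) (by fun_prop)

theorem hasDerivAt_step (h : SLBounds χ σ Λ Λ' lam lam' φ q S Sx w₀ w₀' B B₀ M K₀ K)
    (hw : Continuous w) (hω : Continuous ω) (hd : ∀ t x, HasDerivAt (fun y => w (t, y)) (ω (t, x)) x)
    (t x : ℝ) : HasDerivAt (fun y => slStep χ φ q S w₀ w (t, y))
      (slStepDeriv χ lam' φ q S Sx w₀' w ω (t, x)) x := by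
  have h1 := h.contS
  have h2 := h.contSx
  have h3 := h.ball.continuous_fderiv
  have h4 := h.ball.contDiff.continuous
  refine hasDerivAt_pi.2 fun i => hasDerivAt_transport (h.chars.flow i) h.chars.clock
    (h.chars.speed i) (fun x => hasDerivAt_pi.1 (h.derivw x) i) (by fun_prop) (by fun_prop)
    (fun t x => ?_) t x
  exact hasDerivAt_pi.1 ((h.ball.hasFDerivAt (S (t, x), w (t, x))).comp_hasDerivAt x
    ((h.derivS t x).prodMk (hd t x))) i

theorem K₀_le (h : SLBounds χ σ Λ Λ' lam lam' φ q S Sx w₀ w₀' B B₀ M K₀ K) {r : ℝ} (hr : 0 ≤ r) :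
    K₀ r ≤ K r := by
  have h0 : 0 ≤ K₀ r := (norm_nonneg (w₀' 0)).trans ((h.bound₀ 0).trans (h.mono₀ (by simpa using hr)))
  have := mul_nonneg h.chars.clock.sigma_nonneg (mul_nonneg h.const_nonneg (h.K_nonneg hr))
  linarith [h.step r]

theorem exists_solution (h : SLBounds χ σ Λ Λ' lam lam' φ q S Sx w₀ w₀' B B₀ M K₀ K) :
    ∃ w ω, SLSol χ lam' φ q S Sx w₀ w₀' w ω ∧ (∀ p, ‖w p‖ ≤ B) ∧
      ∀ p, ‖ω p‖ ≤ 2 * K₀ (rad χ Λ p) + 2 * (σ * (M * K (rad χ Λ p))) := by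
  have hB : 0 ≤ B := (norm_nonneg _).trans (h.boundS 0)
  set s := slSeq χ lam' φ q S Sx w₀ w₀' with hs
  have hinv : ∀ n, Continuous (s n).1 ∧ Continuous (s n).2 ∧ (∀ p, ‖(s n).1 p‖ ≤ B) ∧
      (∀ p, ‖(s n).2 p‖ ≤ K (rad χ Λ p)) ∧
      ∀ t x, HasDerivAt (fun y => (s n).1 (t, y)) ((s n).2 (t, x)) x := fun n => by
    induction n with
    | zero =>
      refine ⟨h.continuous_initial.comp continuous_snd, h.contw.comp continuous_snd,
        fun p => h.le_B p.2, fun p => ?_, fun t x => h.derivw x⟩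
      refine (h.bound₀ p.2).trans ((h.mono₀ ?_).trans (h.K₀_le (h.rad_nonneg' p)))
      exact le_add_of_nonneg_right (mul_nonneg h.chars.nonneg (clk_nonneg _))
    | succ n ih =>
      obtain ⟨h1, h2, h3, h4, h5⟩ := ih
      exact ⟨h.continuous_step h1, h.continuous_stepDeriv h1 h2, h.norm_step_le h3,
        fun p => (h.norm_stepDeriv_le h3 h4 p).trans (h.step _), h.hasDerivAt_step h1 h2 h5⟩
  have hdw : ∀ n p, ‖(s (n + 1)).1 p - (s n).1 p‖ ≤ 4 * B / 2 / 2 ^ n := fun n => by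
    induction n with
    | zero =>
      intro p
      refine (norm_sub_le _ _).trans ((add_le_add ((hinv 1).2.2.1 p) ((hinv 0).2.2.1 p)).trans_eq ?_)
      ring
    | succ n ih =>
      intro p
      refine (h.norm_step_sub_le (hinv (n + 1)).2.2.1 (hinv n).2.2.1 (hinv (n + 1)).1 (hinv n).1 ih p).trans ?_
      rw [pow_succ, ← div_div _ _ (2 : ℝ)]
      have : 0 ≤ 4 * B / 2 / 2 ^ n := by positivity
      linarith
  have hmono : Monotone fun r => 4 * (1 + B) * K r := h.mono.const_mul (by positivity)
  have hdω : ∀ n p, ‖(s (n + 1)).2 p - (s n).2 p‖ ≤ 4 * (1 + B) * K (rad χ Λ p) / 2 / 2 ^ n := fun n => by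
    induction n with
    | zero =>
      intro p
      refine (norm_sub_le _ _).trans ((add_le_add ((hinv 1).2.2.2.1 p) ((hinv 0).2.2.2.1 p)).trans ?_)
      have := mul_nonneg hB (h.K_nonneg (h.rad_nonneg' p))
      simp only [pow_zero]
      linarith
    | succ n ih =>
      intro p
      refine (h.norm_stepDeriv_sub_le (e := fun r => 4 * (1 + B) * K r / 2 / 2 ^ n)
        (hinv (n + 1)).2.2.1 (hinv n).2.2.1 (hinv (n + 1)).1 (hinv n).1
        (hinv (n + 1)).2.2.2.1 (hinv (n + 1)).2.1 (hinv n).2.1 (hdw n) ?_ ih p).trans ?_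
      · exact fun r r' hr => by
          have := hmono hr
          dsimp only at this ⊢
          gcongr
      · have hK := h.K_nonneg (h.rad_nonneg' p)
        have : 0 ≤ K (rad χ Λ p) / 2 ^ n := by positivity
        rw [pow_succ]
        have e : 4 * (1 + B) * K (rad χ Λ p) / 2 / (2 ^ n * 2) -
          (4 * B / 2 / 2 ^ n * K (rad χ Λ p) + 4 * (1 + B) * K (rad χ Λ p) / 2 / 2 ^ n) / 4 =
          (1 / 2) * (K (rad χ Λ p) / 2 ^ n) := by
          field_simp
          ring
        linarith
  have hrad := h.chars.clock.continuous_rad (Λ := Λ)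
  obtain ⟨w, hwc, hwle, hwt⟩ := exists_limit_of_geometric (C := fun _ => 4 * B) monotone_const hrad
    (fun n => (hinv n).1) hdw
  obtain ⟨ω, hωc, hωle, hωt⟩ := exists_limit_of_geometric (C := fun r => 4 * (1 + B) * K r) hmono hrad
    (fun n => (hinv n).2.1) hdω
  have hwB : ∀ p, ‖w p‖ ≤ B := fun p =>
    le_of_tendsto (hwt p).norm (Eventually.of_forall fun n => (hinv n).2.2.1 p)
  have hωB : ∀ p, ‖ω p‖ ≤ K (rad χ Λ p) := fun p =>
    le_of_tendsto (hωt p).norm (Eventually.of_forall fun n => (hinv n).2.2.2.1 p)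
  have hlim : ∀ c : ℝ, Tendsto (fun n : ℕ => c / 2 ^ n) atTop (nhds 0) := fun c =>
    tendsto_const_nhds.div_atTop (tendsto_pow_atTop_atTop_of_one_lt one_lt_two)
  have hweq : ∀ p, w p = slStep χ φ q S w₀ w p := fun p => by
    refine tendsto_nhds_unique ((hwt p).comp (tendsto_add_atTop_nat 1)) ?_
    rw [tendsto_iff_norm_sub_tendsto_zero]
    refine squeeze_zero (fun _ => norm_nonneg _) (fun n => ?_) (hlim (4 * B / 8))
    refine (h.norm_step_sub_le (hinv n).2.2.1 hwB (hinv n).1 hwc (hwle n) p).trans_eq ?_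
    ring
  have hωeq : ∀ p, ω p = slStepDeriv χ lam' φ q S Sx w₀' w ω p := fun p => by
    refine tendsto_nhds_unique ((hωt p).comp (tendsto_add_atTop_nat 1)) ?_
    rw [tendsto_iff_norm_sub_tendsto_zero]
    refine squeeze_zero (fun _ => norm_nonneg _) (fun n => ?_)
      (hlim ((4 * B * K (rad χ Λ p) + 4 * (1 + B) * K (rad χ Λ p)) / 4))
    refine (h.norm_stepDeriv_sub_le (e := fun r => 4 * (1 + B) * K r / 2 ^ n)
        (hinv n).2.2.1 hwB (hinv n).1 hwc (hinv n).2.2.2.1 (hinv n).2.1 hωc (hwle n) ?_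
        (hωle n) p).trans_eq ?_
    · exact fun r r' hr => by
        have := hmono hr
        dsimp only at this ⊢
        gcongr
    · ring
  refine ⟨w, ω, ⟨hwc, hωc, fun t x => ?_, hweq, hωeq⟩, hwB, fun p => ?_⟩
  · exact hasDerivAt_of_geometric (f := fun n y => (s n).1 (t, y)) (f' := fun n y => (s n).2 (t, y))
      (g' := fun y => ω (t, y)) (C := fun r => 4 * (1 + B) * K r) (ρ := fun y => rad χ Λ (t, y)) hmono
      (by fun_prop) (fun n y => (hinv n).2.2.2.2 t y) (fun y => hwt (t, y)) (fun n y => hωle n (t, y)) x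
  · rw [hωeq p]
    exact h.norm_stepDeriv_le hwB hωB p

end SLBounds

end SemilinearSolution

end

section

/-- A quasilinear system `Y_t + A(Y) Y_x = b Y` with smooth coefficients, diagonalised by `L`:
`L(Y) A(Y) = diag (lam(Y)) L(Y)`. -/
structure HypSys (ι : Type*) [Fintype ι] where
  A : (ι → ℝ) → (ι → ℝ) →L[ℝ] (ι → ℝ)
  L : (ι → ℝ) → (ι → ℝ) →L[ℝ] (ι → ℝ)
  Linv : (ι → ℝ) → (ι → ℝ) →L[ℝ] (ι → ℝ)
  lam : ι → (ι → ℝ) → ℝ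
  b : (ι → ℝ) →L[ℝ] (ι → ℝ)
  smooth_A : ContDiff ℝ 3 A
  smooth_L : ContDiff ℝ 3 L
  smooth_Linv : ContDiff ℝ 3 Linv
  smooth_lam : ∀ i, ContDiff ℝ 3 (lam i)
  Linv_L : ∀ Y z, Linv Y (L Y z) = z
  L_Linv : ∀ Y z, L Y (Linv Y z) = z
  diag : ∀ Y z i, L Y (A Y z) i = lam i Y * L Y z i

namespace HypSys

variable {ι : Type*} [Fintype ι]

/-- The forcing of the diagonal variables `w = L(Y) Y_x`, where `s = (Y, Y_x, Y_t)` is frozen. -/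
def force (H : HypSys ι) (z : ((ι → ℝ) × (ι → ℝ) × (ι → ℝ)) × (ι → ℝ)) : ι → ℝ := fun i =>
  fderiv ℝ H.L z.1.1 z.1.2.2 (H.Linv z.1.1 z.2) i +
    H.lam i z.1.1 * fderiv ℝ H.L z.1.1 z.1.2.1 (H.Linv z.1.1 z.2) i -
    H.L z.1.1 (fderiv ℝ H.A z.1.1 z.1.2.1 (H.Linv z.1.1 z.2)) i + H.L z.1.1 (H.b z.1.2.1) i

/-- The time derivative prescribed by the system. -/
def rate (H : HypSys ι) (Y V : ι → ℝ) : ι → ℝ := -H.A Y V + H.b Y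

/-- The triple `(Y, Y_x, Y_t)` determined by `Y` and `w = L(Y) Y_x`. -/
def lift (H : HypSys ι) (z : (ι → ℝ) × (ι → ℝ)) : (ι → ℝ) × (ι → ℝ) × (ι → ℝ) :=
  (z.1, H.Linv z.1 z.2, H.rate z.1 (H.Linv z.1 z.2))

/-- The forcing of `w` as a function of `Y` and `w` only. -/
def force' (H : HypSys ι) (z : (ι → ℝ) × (ι → ℝ)) : ι → ℝ := H.force (H.lift z, z.2)

theorem smooth_force (H : HypSys ι) : ContDiff ℝ 2 H.force := by
  have h1 : ContDiff ℝ 2 (fderiv ℝ H.L) := H.smooth_L.fderiv_right (by norm_num)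
  have h2 : ContDiff ℝ 2 (fderiv ℝ H.A) := H.smooth_A.fderiv_right (by norm_num)
  have h3 : ContDiff ℝ 2 H.L := H.smooth_L.of_le (by norm_num)
  have h4 : ContDiff ℝ 2 H.Linv := H.smooth_Linv.of_le (by norm_num)
  have h5 : ∀ i, ContDiff ℝ 2 (H.lam i) := fun i => (H.smooth_lam i).of_le (by norm_num)
  refine contDiff_pi.2 fun i => ?_
  have h6 := h5 i
  have e : ∀ {f : ((ι → ℝ) × (ι → ℝ) × (ι → ℝ)) × (ι → ℝ) → ι → ℝ}, ContDiff ℝ 2 f →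
    ContDiff ℝ 2 fun z => f z i := fun hf => contDiff_pi.1 hf i
  have g1 : ContDiff ℝ 2 fun z : ((ι → ℝ) × (ι → ℝ) × (ι → ℝ)) × (ι → ℝ) => H.Linv z.1.1 z.2 :=
    (h4.comp (by fun_prop)).clm_apply (by fun_prop)
  have g2 : ContDiff ℝ 2 fun z : ((ι → ℝ) × (ι → ℝ) × (ι → ℝ)) × (ι → ℝ) => H.L z.1.1 :=
    h3.comp (by fun_prop)
  have g3 : ContDiff ℝ 2 fun z : ((ι → ℝ) × (ι → ℝ) × (ι → ℝ)) × (ι → ℝ) => fderiv ℝ H.L z.1.1 :=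
    h1.comp (by fun_prop)
  have g4 : ContDiff ℝ 2 fun z : ((ι → ℝ) × (ι → ℝ) × (ι → ℝ)) × (ι → ℝ) => fderiv ℝ H.A z.1.1 :=
    h2.comp (by fun_prop)
  have g5 : ContDiff ℝ 2 fun z : ((ι → ℝ) × (ι → ℝ) × (ι → ℝ)) × (ι → ℝ) => H.lam i z.1.1 :=
    h6.comp (by fun_prop)
  refine (((e ((g3.clm_apply (by fun_prop)).clm_apply g1)).add
    (g5.mul (e ((g3.clm_apply (by fun_prop)).clm_apply g1)))).sub
    (e (g2.clm_apply ((g4.clm_apply (by fun_prop)).clm_apply g1)))).add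
    (e (g2.clm_apply (by fun_prop)))

theorem smooth_rate (H : HypSys ι) :
    ContDiff ℝ 2 fun z : (ι → ℝ) × (ι → ℝ) => H.rate z.1 z.2 := by
  have h3 : ContDiff ℝ 2 H.A := H.smooth_A.of_le (by norm_num)
  exact (((h3.comp (by fun_prop)).clm_apply (by fun_prop)).neg).add (by fun_prop)

theorem smooth_lift (H : HypSys ι) : ContDiff ℝ 2 H.lift := by
  have h4 : ContDiff ℝ 2 H.Linv := H.smooth_Linv.of_le (by norm_num)
  have g1 : ContDiff ℝ 2 fun z : (ι → ℝ) × (ι → ℝ) => H.Linv z.1 z.2 :=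
    (h4.comp (by fun_prop)).clm_apply (by fun_prop)
  exact contDiff_fst.prodMk (g1.prodMk (H.smooth_rate.comp (contDiff_fst.prodMk g1)))

theorem smooth_force' (H : HypSys ι) : ContDiff ℝ 2 H.force' :=
  H.smooth_force.comp (H.smooth_lift.prodMk contDiff_snd)

/-- Uniform bounds for the coefficients of a system on the ball of radius `B`. -/
structure Bounds (H : HypSys ι) (B C : ℝ) : Prop where
  one_le : 1 ≤ C
  lam : ∀ i, BallBound (H.lam i) B C
  lift : BallBound H.lift B C
  rate : BallBound (fun z : (ι → ℝ) × (ι → ℝ) => H.rate z.1 z.2) B C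
  linv : BallBound (fun z : (ι → ℝ) × (ι → ℝ) => H.Linv z.1 z.2) B C
  force : BallBound H.force B C
  force' : BallBound H.force' B C

theorem exists_bounds (H : HypSys ι) (B : ℝ) : ∃ C, H.Bounds B C := by
  have h4 : ContDiff ℝ 2 H.Linv := H.smooth_Linv.of_le (by norm_num)
  choose c hc using fun i => exists_ballBound ((H.smooth_lam i).of_le (by norm_num) : ContDiff ℝ 2 (H.lam i)) B
  obtain ⟨c1, h1⟩ := exists_ballBound H.smooth_lift B
  obtain ⟨c2, h2⟩ := exists_ballBound H.smooth_rate B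
  obtain ⟨c3, h3⟩ := exists_ballBound (q := fun z : (ι → ℝ) × (ι → ℝ) => H.Linv z.1 z.2)
    ((h4.comp (by fun_prop)).clm_apply (by fun_prop)) B
  obtain ⟨c4, h5⟩ := exists_ballBound H.smooth_force B
  obtain ⟨c5, h6⟩ := exists_ballBound H.smooth_force' B
  have hs : ∀ i, c i ≤ ∑ i, |c i| := fun i =>
    (le_abs_self _).trans (Finset.single_le_sum (fun i _ => abs_nonneg (c i)) (Finset.mem_univ i))
  have h0 : 0 ≤ ∑ i, |c i| := Finset.sum_nonneg fun i _ => abs_nonneg (c i)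
  have a1 := le_abs_self c1
  have a2 := le_abs_self c2
  have a3 := le_abs_self c3
  have a4 := le_abs_self c4
  have a5 := le_abs_self c5
  have b1 := abs_nonneg c1
  have b2 := abs_nonneg c2
  have b3 := abs_nonneg c3
  have b4 := abs_nonneg c4
  have b5 := abs_nonneg c5
  refine ⟨1 + ∑ i, |c i| + |c1| + |c2| + |c3| + |c4| + |c5|, by linarith, fun i => (hc i).mono ?_,
    h1.mono ?_, h2.mono ?_, h3.mono ?_, h5.mono ?_, h6.mono ?_⟩
  · have := hs i
    linarith
  all_goals linarith

end HypSys

end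

section

/-- A space-time function `Y` together with its derivatives `V = Y_x`, `P = Y_t`, `V' = V_x`,
`P' = P_x`. -/
structure Jet (ι : Type*) where
  Y : ℝ × ℝ → ι → ℝ
  V : ℝ × ℝ → ι → ℝ
  P : ℝ × ℝ → ι → ℝ
  V' : ℝ × ℝ → ι → ℝ
  P' : ℝ × ℝ → ι → ℝ

/-- The first order part of a jet. -/
def Jet.S {ι : Type*} (j : Jet ι) (p : ℝ × ℝ) : (ι → ℝ) × (ι → ℝ) × (ι → ℝ) := (j.Y p, j.V p, j.P p)

/-- The `x`-derivative of `Jet.S`. -/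
def Jet.Sx {ι : Type*} (j : Jet ι) (p : ℝ × ℝ) : (ι → ℝ) × (ι → ℝ) × (ι → ℝ) := (j.V p, j.V' p, j.P' p)

/-- Constants entering the iteration for a quasilinear system. -/
structure Consts where
  σ : ℝ
  b₀ : ℝ
  B₂ : ℝ
  B₃ : ℝ
  B : ℝ
  C : ℝ
  K₀ : ℝ → ℝ

/-- The bound for second derivatives in the iteration. -/
def Consts.K (c : Consts) (r : ℝ) : ℝ := 4 * c.C ^ 2 * (c.B + 2 * c.K₀ r)

variable {ι : Type*} [Fintype ι]

/-- Admissible initial data, clock and constants for the iteration. -/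
structure HypSys.Setup (H : HypSys ι) (c : Consts) (χ : ℝ → ℝ) (Y₀ Y₀' w₀' : ℝ → ι → ℝ) : Prop where
  clock : Clock χ c.σ
  bounds : H.Bounds c.B c.C
  deriv₀ : ∀ x, HasDerivAt Y₀ (Y₀' x) x
  derivw₀ : ∀ x, HasDerivAt (fun x => H.L (Y₀ x) (Y₀' x)) (w₀' x) x
  cont₀' : Continuous Y₀'
  contw₀' : Continuous w₀'
  bound₀ : ∀ x, ‖Y₀ x‖ ≤ c.b₀
  boundw₀ : ∀ x, ‖H.L (Y₀ x) (Y₀' x)‖ ≤ c.b₀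
  boundw₀' : ∀ x, ‖w₀' x‖ ≤ c.K₀ |x|
  mono₀ : Monotone c.K₀
  boundV : ∀ Y w, ‖Y‖ ≤ c.b₀ + 1 → ‖w‖ ≤ c.b₀ + 1 → ‖H.Linv Y w‖ ≤ c.B₂
  boundP : ∀ Y V, ‖Y‖ ≤ c.b₀ + 1 → ‖V‖ ≤ c.B₂ → ‖H.rate Y V‖ ≤ c.B₃
  le_B : c.b₀ + 1 ≤ c.B
  le_B₂ : c.B₂ ≤ c.B
  le_B₃ : c.B₃ ≤ c.B
  small : c.σ * (8 * c.C ^ 3) ≤ 1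
  small' : c.σ * (4 * c.C * c.B) ≤ 1

/-- A jet in the invariant set of the iteration. -/
structure Jet.Good (j : Jet ι) (c : Consts) (χ : ℝ → ℝ) (Y₀ : ℝ → ι → ℝ) : Prop where
  contY : Continuous j.Y
  contV : Continuous j.V
  contP : Continuous j.P
  contV' : Continuous j.V'
  contP' : Continuous j.P'
  derivY : ∀ t x, HasDerivAt (fun y => j.Y (t, y)) (j.V (t, x)) x
  derivV : ∀ t x, HasDerivAt (fun y => j.V (t, y)) (j.V' (t, x)) x
  derivP : ∀ t x, HasDerivAt (fun y => j.P (t, y)) (j.P' (t, x)) x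
  time : ∀ t x, HasDerivAt (fun s => j.Y (s, x)) (χ t • j.P (t, x)) t
  init : ∀ x, j.Y (0, x) = Y₀ x
  boundY : ∀ p, ‖j.Y p‖ ≤ c.b₀ + 1
  boundV : ∀ p, ‖j.V p‖ ≤ c.B₂
  boundP : ∀ p, ‖j.P p‖ ≤ c.B₃
  boundV' : ∀ p, ‖j.V' p‖ ≤ c.K (rad χ c.C p)
  boundP' : ∀ p, ‖j.P' p‖ ≤ c.K (rad χ c.C p)

/-- The diagonal variables `w` solve the transport system with speeds `lam (Y)` and forcing
`force (S, w)`. -/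
structure HypSys.Sol (H : HypSys ι) (c : Consts) (χ : ℝ → ℝ) (w₀ : ℝ → ι → ℝ) (Y V : ℝ × ℝ → ι → ℝ)
    (S : ℝ × ℝ → (ι → ℝ) × (ι → ℝ) × (ι → ℝ)) (φ : ι → ℝ × ℝ × ℝ → ℝ) (w ω : ℝ × ℝ → ι → ℝ) :
    Prop where
  chars : Chars χ c.σ c.C (c.C * c.B) (fun i p => H.lam i (Y p))
    (fun i p => fderiv ℝ (H.lam i) (Y p) (V p)) φ
  contS : Continuous S
  cont : Continuous w
  contx : Continuous ω
  deriv : ∀ t x, HasDerivAt (fun y => w (t, y)) (ω (t, x)) x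
  eq : ∀ p i, w p i = transport χ (φ i) (fun x => w₀ x i) (fun p => H.force (S p, w p) i) p
  bound : ∀ p, ‖w p‖ ≤ c.b₀ + 1
  boundx : ∀ p, ‖ω p‖ ≤ c.K (rad χ c.C p)
  boundx' : ∀ p, 2 * c.C ^ 2 * (c.B + ‖ω p‖) ≤ c.K (rad χ c.C p)

namespace HypSys.Setup

variable {H : HypSys ι} {c : Consts} {χ : ℝ → ℝ} {Y₀ Y₀' w₀' : ℝ → ι → ℝ}

theorem K₀_nonneg (h : H.Setup c χ Y₀ Y₀' w₀') {r : ℝ} (hr : 0 ≤ r) : 0 ≤ c.K₀ r :=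
  (norm_nonneg (w₀' 0)).trans ((h.boundw₀' 0).trans (h.mono₀ (by simpa using hr)))

theorem b₀_nonneg (h : H.Setup c χ Y₀ Y₀' w₀') : 0 ≤ c.b₀ := (norm_nonneg _).trans (h.bound₀ 0)

theorem B_nonneg (h : H.Setup c χ Y₀ Y₀' w₀') : 0 ≤ c.B := by
  have := h.b₀_nonneg
  have := h.le_B
  linarith

theorem rad_nonneg (h : H.Setup c χ Y₀ Y₀' w₀') (p : ℝ × ℝ) : 0 ≤ rad χ c.C p :=
  add_nonneg (abs_nonneg _) (mul_nonneg (zero_le_one.trans h.bounds.one_le) (clk_nonneg _))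

theorem mono_K (h : H.Setup c χ Y₀ Y₀' w₀') : Monotone c.K := fun r s hrs => by
  have := h.mono₀ hrs
  unfold Consts.K
  gcongr

theorem σC_le (h : H.Setup c χ Y₀ Y₀' w₀') : c.σ * c.C ≤ 1 / 8 := by
  have h1 := h.bounds.one_le
  have h2 := h.clock.sigma_nonneg
  have h3 := h.small
  have h4 : c.C ≤ c.C ^ 3 := le_self_pow₀ h1 (by norm_num)
  nlinarith

theorem step_le (h : H.Setup c χ Y₀ Y₀' w₀') {r : ℝ} (hr : 0 ≤ r) :
    2 * c.C ^ 2 * (c.B + (2 * c.K₀ r + 2 * (c.σ * (c.C * c.K r)))) ≤ c.K r := by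
  have h0 := h.K₀_nonneg hr
  have h1 := h.bounds.one_le
  have h3 := h.small
  have hB := h.B_nonneg
  have hK : 0 ≤ c.K r := by unfold Consts.K; positivity
  have e : 2 * c.C ^ 2 * (c.B + (2 * c.K₀ r + 2 * (c.σ * (c.C * c.K r)))) =
    c.K r / 2 + (c.σ * (8 * c.C ^ 3)) * (c.K r / 2) := by
    unfold Consts.K
    ring
  rw [e]
  nlinarith

theorem le_K (h : H.Setup c χ Y₀ Y₀' w₀') {r : ℝ} (hr : 0 ≤ r) :
    c.B + (2 * c.K₀ r + 2 * (c.σ * (c.C * c.K r))) ≤ c.K r := by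
  have h0 := h.K₀_nonneg hr
  have h1 := h.bounds.one_le
  have hB := h.B_nonneg
  have hσ := h.clock.sigma_nonneg
  have hK : 0 ≤ c.K r := by unfold Consts.K; positivity
  refine le_trans ?_ (h.step_le hr)
  have : 0 ≤ c.B + (2 * c.K₀ r + 2 * (c.σ * (c.C * c.K r))) := by positivity
  nlinarith [one_le_pow₀ h1 (n := 2)]

theorem chars (h : H.Setup c χ Y₀ Y₀' w₀') {Y V : ℝ × ℝ → ι → ℝ} (hY : Continuous Y)
    (hV : Continuous V) (hd : ∀ t x, HasDerivAt (fun y => Y (t, y)) (V (t, x)) x)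
    (hYb : ∀ p, ‖Y p‖ ≤ c.b₀ + 1) (hVb : ∀ p, ‖V p‖ ≤ c.B₂) :
    ∃ φ, Chars χ c.σ c.C (c.C * c.B) (fun i p => H.lam i (Y p))
      (fun i p => fderiv ℝ (H.lam i) (Y p) (V p)) φ := by
  have hC : 0 ≤ c.C := zero_le_one.trans h.bounds.one_le
  have hs : ∀ i, Speed (fun p => H.lam i (Y p)) (fun p => fderiv ℝ (H.lam i) (Y p) (V p))
      c.C (c.C * c.B) := fun i => by
    have h1 := (h.bounds.lam i).contDiff.continuous
    have h2 := (h.bounds.lam i).continuous_fderiv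
    refine ⟨by fun_prop, by fun_prop, fun t x => ((h.bounds.lam i).hasFDerivAt _).comp_hasDerivAt x (hd t x),
      fun p => (h.bounds.lam i).bound _ ((hYb p).trans h.le_B), fun p => ?_⟩
    exact (ContinuousLinearMap.le_opNorm _ _).trans (mul_le_mul
      ((h.bounds.lam i).bound' _ ((hYb p).trans h.le_B)) ((hVb p).trans h.le_B₂) (norm_nonneg _) hC)
  have hσ : c.σ * (c.C * c.B) ≤ 1 / 4 := by linarith [h.small']
  choose φ hφ using fun i => exists_flow h.clock (hs i) hσ
  exact ⟨φ, h.clock, hs, hφ, hσ, hC⟩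

theorem exists_sol {F : Type*} [NormedAddCommGroup F] [NormedSpace ℝ F]
    (h : H.Setup c χ Y₀ Y₀' w₀') {Y V : ℝ × ℝ → ι → ℝ} (hY : Continuous Y)
    (hV : Continuous V) (hd : ∀ t x, HasDerivAt (fun y => Y (t, y)) (V (t, x)) x)
    (hYb : ∀ p, ‖Y p‖ ≤ c.b₀ + 1) (hVb : ∀ p, ‖V p‖ ≤ c.B₂)
    {q : F × (ι → ℝ) → ι → ℝ} (hq : BallBound q c.B c.C) {S Sx : ℝ × ℝ → F} (hS : Continuous S)
    (hSx : Continuous Sx) (hdS : ∀ t x, HasDerivAt (fun y => S (t, y)) (Sx (t, x)) x)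
    (hSb : ∀ p, ‖S p‖ ≤ c.B) (hSxb : ∀ p, ‖Sx p‖ ≤ c.K (rad χ c.C p))
    {Φ : F → (ι → ℝ) → (ι → ℝ) × (ι → ℝ) × (ι → ℝ)} (hΦ : Continuous fun z : F × (ι → ℝ) => Φ z.1 z.2)
    (hqΦ : ∀ s z, q (s, z) = H.force (Φ s z, z)) :
    ∃ φ w ω, H.Sol c χ (fun x => H.L (Y₀ x) (Y₀' x)) Y V (fun p => Φ (S p) (w p)) φ w ω := by
  obtain ⟨φ, hφ⟩ := h.chars hY hV hd hYb hVb
  have hσ := h.σC_le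
  have hb := h.le_B
  have hbd : SLBounds χ c.σ c.C (c.C * c.B) (fun i p => H.lam i (Y p))
    (fun i p => fderiv ℝ (H.lam i) (Y p) (V p)) φ q S Sx (fun x => H.L (Y₀ x) (Y₀' x)) w₀'
      c.B c.b₀ c.C (fun r => c.K₀ (max r 0)) (fun r => c.K (max r 0)) :=
    { chars := hφ, contS := hS, contSx := hSx, derivS := hdS, ball := hq, contw := h.contw₀'
      derivw := h.derivw₀, boundS := hSb, boundw := h.boundw₀, sum_le := by linarith, small := hσ
      mono₀ := fun r s hrs => h.mono₀ (max_le_max_right 0 hrs)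
      mono := fun r s hrs => h.mono_K (max_le_max_right 0 hrs)
      bound₀ := fun x => by simpa using h.boundw₀' x
      boundSx := fun p => by rw [max_eq_left (h.rad_nonneg p)]; exact hSxb p
      step := fun r => by
        have := h.le_K (le_max_right r 0)
        have := h.B_nonneg
        linarith }
  obtain ⟨w, ω, hsol, hw, hω⟩ := hbd.exists_solution
  have hω' : ∀ p, ‖ω p‖ ≤ 2 * c.K₀ (rad χ c.C p) + 2 * (c.σ * (c.C * c.K (rad χ c.C p))) := fun p => by
    simpa only [max_eq_left (h.rad_nonneg p)] using hω p
  have hwc := hsol.cont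
  have heq : ∀ p i, w p i = transport χ (φ i) (fun x => H.L (Y₀ x) (Y₀' x) i)
      (fun p => q (S p, w p) i) p := fun p i => congrFun (hsol.eq p) i
  refine ⟨φ, w, ω, hφ, by fun_prop, hwc, hsol.contx, hsol.deriv, fun p i => ?_, fun p => ?_,
    fun p => ?_, fun p => ?_⟩
  · simpa only [hqΦ] using heq p i
  · refine (pi_norm_le_iff_of_nonneg (by linarith [h.b₀_nonneg])).2 fun i => ?_
    rw [heq, Real.norm_eq_abs]
    refine (transport_le (hφ.flow i) h.clock (hφ.speed i) (zero_le_one.trans h.bounds.one_le)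
      (fun x _ => (norm_apply_le _ i).trans (h.boundw₀ x))
      (fun p' _ => (norm_apply_le _ i).trans (hq.bound _ (max_le (hSb p') (hw p'))))).trans ?_
    linarith
  · have := h.le_K (h.rad_nonneg p)
    linarith [hω' p, h.B_nonneg]
  · refine le_trans ?_ (h.step_le (h.rad_nonneg p))
    have := hω' p
    gcongr

end HypSys.Setup

end

section

variable {ι : Type*} [Fintype ι]

/-- The next jet of the iteration, built from the diagonal variables `w` with `w_x = ω`. -/
def HypSys.next (H : HypSys ι) (χ : ℝ → ℝ) (Y₀ : ℝ → ι → ℝ) (Y V w ω : ℝ × ℝ → ι → ℝ) : Jet ι where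
  V p := H.Linv (Y p) (w p)
  V' p := fderiv ℝ (fun z : (ι → ℝ) × (ι → ℝ) => H.Linv z.1 z.2) (Y p, w p) (V p, ω p)
  P p := H.rate (Y p) (H.Linv (Y p) (w p))
  P' p := fderiv ℝ (fun z : (ι → ℝ) × (ι → ℝ) => H.rate z.1 z.2) (Y p, H.Linv (Y p) (w p))
    (V p, fderiv ℝ (fun z : (ι → ℝ) × (ι → ℝ) => H.Linv z.1 z.2) (Y p, w p) (V p, ω p))
  Y p := Y₀ p.2 + ∫ s in (0 : ℝ)..p.1, χ s • H.rate (Y (s, p.2)) (H.Linv (Y (s, p.2)) (w (s, p.2)))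

namespace HypSys.Setup

variable {H : HypSys ι} {c : Consts} {χ : ℝ → ℝ} {Y₀ Y₀' w₀' : ℝ → ι → ℝ}
  {S : ℝ × ℝ → (ι → ℝ) × (ι → ℝ) × (ι → ℝ)} {φ : ι → ℝ × ℝ × ℝ → ℝ} {Y V w ω : ℝ × ℝ → ι → ℝ}

theorem continuous_V (h : H.Setup c χ Y₀ Y₀' w₀') (hY : Continuous Y) (hw : Continuous w) :
    Continuous (H.next χ Y₀ Y V w ω).V :=
  h.bounds.linv.contDiff.continuous.comp (hY.prodMk hw)

theorem continuous_P (h : H.Setup c χ Y₀ Y₀' w₀') (hY : Continuous Y) (hw : Continuous w) :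
    Continuous (H.next χ Y₀ Y V w ω).P :=
  h.bounds.rate.contDiff.continuous.comp (hY.prodMk (h.continuous_V (V := V) (ω := ω) hY hw))

theorem continuous_V' (h : H.Setup c χ Y₀ Y₀' w₀') (hY : Continuous Y) (hV : Continuous V)
    (hw : Continuous w) (hω : Continuous ω) : Continuous (H.next χ Y₀ Y V w ω).V' := by
  have h1 := h.bounds.linv.continuous_fderiv
  exact (h1.comp (hY.prodMk hw)).clm_apply (hV.prodMk hω)

theorem continuous_P' (h : H.Setup c χ Y₀ Y₀' w₀') (hY : Continuous Y) (hV : Continuous V)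
    (hw : Continuous w) (hω : Continuous ω) : Continuous (H.next χ Y₀ Y V w ω).P' := by
  have h1 := h.bounds.rate.continuous_fderiv
  exact (h1.comp (hY.prodMk (h.continuous_V (V := V) (ω := ω) hY hw))).clm_apply
    (hV.prodMk (h.continuous_V' hY hV hw hω))

theorem derivV (h : H.Setup c χ Y₀ Y₀' w₀')
    (hd : ∀ t x, HasDerivAt (fun y => Y (t, y)) (V (t, x)) x)
    (hdw : ∀ t x, HasDerivAt (fun y => w (t, y)) (ω (t, x)) x) (t x : ℝ) :
    HasDerivAt (fun y => (H.next χ Y₀ Y V w ω).V (t, y)) ((H.next χ Y₀ Y V w ω).V' (t, x)) x := by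
  have e := (h.bounds.linv.hasFDerivAt (Y (t, x), w (t, x))).comp_hasDerivAt x
    ((hd t x).prodMk (hdw t x))
  exact e

theorem derivP (h : H.Setup c χ Y₀ Y₀' w₀')
    (hd : ∀ t x, HasDerivAt (fun y => Y (t, y)) (V (t, x)) x)
    (hdw : ∀ t x, HasDerivAt (fun y => w (t, y)) (ω (t, x)) x) (t x : ℝ) :
    HasDerivAt (fun y => (H.next χ Y₀ Y V w ω).P (t, y)) ((H.next χ Y₀ Y V w ω).P' (t, x)) x := by
  have e := (h.bounds.rate.hasFDerivAt (Y (t, x), H.Linv (Y (t, x)) (w (t, x)))).comp_hasDerivAt x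
    ((hd t x).prodMk (h.derivV (χ := χ) (Y₀ := Y₀) hd hdw t x))
  exact e

theorem boundV' (h : H.Setup c χ Y₀ Y₀' w₀') (hYb : ∀ p, ‖Y p‖ ≤ c.b₀ + 1)
    (hVb : ∀ p, ‖V p‖ ≤ c.B₂) (hw : ∀ p, ‖w p‖ ≤ c.b₀ + 1) (p : ℝ × ℝ) :
    ‖(H.next χ Y₀ Y V w ω).V' p‖ ≤ c.C * (c.B + ‖ω p‖) := by
  have hB := h.B_nonneg
  have := h.le_B
  refine (ContinuousLinearMap.le_opNorm _ _).trans (mul_le_mul (h.bounds.linv.bound' _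
    (max_le ((hYb p).trans h.le_B) ((hw p).trans h.le_B))) (max_le ?_ ?_) (norm_nonneg _)
    (zero_le_one.trans h.bounds.one_le))
  · linarith [hVb p, h.le_B₂, norm_nonneg (ω p)]
  · linarith

theorem boundP' (h : H.Setup c χ Y₀ Y₀' w₀') (hYb : ∀ p, ‖Y p‖ ≤ c.b₀ + 1)
    (hVb : ∀ p, ‖V p‖ ≤ c.B₂) (hw : ∀ p, ‖w p‖ ≤ c.b₀ + 1) (p : ℝ × ℝ) :
    ‖(H.next χ Y₀ Y V w ω).P' p‖ ≤ 2 * c.C ^ 2 * (c.B + ‖ω p‖) := by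
  have hB := h.B_nonneg
  have h1 := h.bounds.one_le
  have hV' := h.boundV' (χ := χ) (Y₀ := Y₀) (ω := ω) hYb hVb hw p
  have h0 : c.B + ‖ω p‖ ≤ c.C * (c.B + ‖ω p‖) := by nlinarith [norm_nonneg (ω p)]
  refine (ContinuousLinearMap.le_opNorm _ _).trans ((mul_le_mul (h.bounds.rate.bound' _
    (max_le ((hYb p).trans h.le_B) ((h.boundV _ _ (hYb p) (hw p)).trans h.le_B₂)))
    (max_le (c := c.C * (c.B + ‖ω p‖)) ?_ hV') (le_max_of_le_left (norm_nonneg _)) (by linarith)).trans ?_)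
  · linarith [hVb p, h.le_B₂, norm_nonneg (ω p)]
  · nlinarith [norm_nonneg (ω p), sq_nonneg c.C, mul_nonneg (sq_nonneg c.C) (add_nonneg hB (norm_nonneg (ω p)))]

theorem _root_.HypSys.Sol.init {w₀ : ℝ → ι → ℝ} (hs : H.Sol c χ w₀ Y V S φ w ω) (x : ℝ) :
    w (0, x) = w₀ x := by
  funext i
  rw [hs.eq]
  simp [transport, (hs.chars.flow i).init]

theorem sol_time (h : H.Setup c χ Y₀ Y₀' w₀') {w₀ : ℝ → ι → ℝ} (hs : H.Sol c χ w₀ Y V S φ w ω) (t x : ℝ) :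
    HasDerivAt (fun s => w (s, x)) (fun i => χ t * (H.force (S (t, x), w (t, x)) i -
      H.lam i (Y (t, x)) * ω (t, x) i)) t := by
  have h1 := h.bounds.force.contDiff.continuous
  have h2 := hs.contS
  have h3 := hs.cont
  have h4 := hs.contx
  exact hasDerivAt_pi.2 fun i => hasDerivAt_time_transport (hs.chars.flow i) h.clock
    (hs.chars.speed i) (f := fun p => w p i) (f' := fun p => ω p i)
    (fun p => hs.eq p i) (by fun_prop) (by fun_prop) (fun t x => hasDerivAt_pi.1 (hs.deriv t x) i) t x

/-- The compatibility `V_t = χ P_x` of the next jet. -/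
theorem time_V {j : Jet ι} (h : H.Setup c χ Y₀ Y₀' w₀') (hj : j.Good c χ Y₀) {w₀ : ℝ → ι → ℝ}
    (hs : H.Sol c χ w₀ j.Y j.V j.S φ w ω) (t x : ℝ) :
    HasDerivAt (fun s => (H.next χ Y₀ j.Y j.V w ω).V (s, x))
      (χ t • (H.next χ Y₀ j.Y j.V w ω).P' (t, x)) t := by
  set n := H.next χ Y₀ j.Y j.V w ω with hn
  have hL : ∀ Y, HasFDerivAt H.L (fderiv ℝ H.L Y) Y := fun Y =>
    (H.smooth_L.differentiable (by norm_num) Y).hasFDerivAt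
  have hA : ∀ Y, HasFDerivAt H.A (fderiv ℝ H.A Y) Y := fun Y =>
    (H.smooth_A.differentiable (by norm_num) Y).hasFDerivAt
  have hwV : ∀ p, H.L (j.Y p) (n.V p) = w p := fun p => H.L_Linv _ _
  have hVx := h.derivV (χ := χ) (Y₀ := Y₀) hj.derivY hs.deriv t x
  have hPx := h.derivP (χ := χ) (Y₀ := Y₀) hj.derivY hs.deriv t x
  have hVt := (h.bounds.linv.hasFDerivAt (j.Y (t, x), w (t, x))).comp_hasDerivAt t
    ((hj.time t x).prodMk (h.sol_time hs t x))
  set Vt := fderiv ℝ (fun z : (ι → ℝ) × (ι → ℝ) => H.Linv z.1 z.2) (j.Y (t, x), w (t, x))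
    (χ t • j.P (t, x), fun i => χ t * (H.force (j.S (t, x), w (t, x)) i -
      H.lam i (j.Y (t, x)) * ω (t, x) i)) with hVt_def
  have ex : fderiv ℝ H.L (j.Y (t, x)) (j.V (t, x)) (n.V (t, x)) + H.L (j.Y (t, x)) (n.V' (t, x)) =
      ω (t, x) := by
    have e := ((hL _).comp_hasDerivAt x (hj.derivY t x)).clm_apply hVx
    refine e.unique ((hs.deriv t x).congr_of_eventuallyEq (Eventually.of_forall fun y => ?_))
    exact hwV (t, y)
  have eP : n.P' (t, x) = -(fderiv ℝ H.A (j.Y (t, x)) (j.V (t, x)) (n.V (t, x)) +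
      H.A (j.Y (t, x)) (n.V' (t, x))) + H.b (j.V (t, x)) := by
    have e := (((hA _).comp_hasDerivAt x (hj.derivY t x)).clm_apply hVx).neg.add
      (H.b.hasFDerivAt.comp_hasDerivAt x (hj.derivY t x))
    exact hPx.unique e
  have et : fderiv ℝ H.L (j.Y (t, x)) (χ t • j.P (t, x)) (n.V (t, x)) + H.L (j.Y (t, x)) Vt =
      fun i => χ t * (H.force (j.S (t, x), w (t, x)) i - H.lam i (j.Y (t, x)) * ω (t, x) i) := by
    have e := ((hL _).comp_hasDerivAt t (hj.time t x)).clm_apply hVt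
    refine e.unique ((h.sol_time hs t x).congr_of_eventuallyEq (Eventually.of_forall fun s => ?_))
    exact hwV (s, x)
  have key : H.L (j.Y (t, x)) Vt = H.L (j.Y (t, x)) (χ t • n.P' (t, x)) := by
    rw [eP]
    funext i
    have e1 := congrFun et i
    have e2 := congrFun ex i
    have e3 := H.diag (j.Y (t, x)) (n.V' (t, x)) i
    simp only [HypSys.force, Jet.S, map_smul, map_add, map_neg, Pi.add_apply, Pi.smul_apply,
      Pi.neg_apply, smul_eq_mul, _root_.smul_apply] at e1 e2 e3 ⊢
    rw [← e2] at e1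
    change _ = χ t * (fderiv ℝ H.L (j.Y (t, x)) (j.P (t, x)) (n.V (t, x)) i +
      H.lam i (j.Y (t, x)) * fderiv ℝ H.L (j.Y (t, x)) (j.V (t, x)) (n.V (t, x)) i -
      H.L (j.Y (t, x)) (fderiv ℝ H.A (j.Y (t, x)) (j.V (t, x)) (n.V (t, x))) i +
      H.L (j.Y (t, x)) (H.b (j.V (t, x))) i - _) at e1
    rw [e3]
    linear_combination e1
  have := congrArg (H.Linv (j.Y (t, x))) key
  rw [H.Linv_L, H.Linv_L] at this
  rw [← this]
  exact hVt

theorem good_next {j : Jet ι} (h : H.Setup c χ Y₀ Y₀' w₀') (hj : j.Good c χ Y₀)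
    (hs : H.Sol c χ (fun x => H.L (Y₀ x) (Y₀' x)) j.Y j.V j.S φ w ω) :
    (H.next χ Y₀ j.Y j.V w ω).Good c χ Y₀ := by
  have hB := h.B_nonneg
  have h1 := h.bounds.one_le
  have hχ := h.clock.cont
  have hPc := h.continuous_P (χ := χ) (Y₀ := Y₀) (V := j.V) (ω := ω) hj.contY hs.cont
  have hP'c := h.continuous_P' (χ := χ) (Y₀ := Y₀) hj.contY hj.contV hs.cont hs.contx
  have hPb : ∀ p, ‖(H.next χ Y₀ j.Y j.V w ω).P p‖ ≤ c.B₃ := fun p =>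
    h.boundP _ _ (hj.boundY p) (h.boundV _ _ (hj.boundY p) (hs.bound p))
  have hB3 : 0 ≤ c.B₃ := (norm_nonneg _).trans (hPb 0)
  have h0c : Continuous Y₀ := continuous_iff_continuousAt.2 fun x => (h.deriv₀ x).continuousAt
  refine
    { contY := ?_
      contV := h.continuous_V hj.contY hs.cont
      contP := hPc
      contV' := h.continuous_V' hj.contY hj.contV hs.cont hs.contx
      contP' := hP'c
      derivY := fun t x => ?_
      derivV := h.derivV hj.derivY hs.deriv
      derivP := h.derivP hj.derivY hs.deriv
      time := fun t x => ?_
      init := fun x => by simp [HypSys.next]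
      boundY := fun p => ?_
      boundV := fun p => h.boundV _ _ (hj.boundY p) (hs.bound p)
      boundP := hPb
      boundV' := fun p => ?_
      boundP' := fun p => (h.boundP' hj.boundY hj.boundV hs.bound p).trans (hs.boundx' p) }
  · refine Continuous.add (h0c.comp continuous_snd) (continuous_intervalIntegral_prod
      (f := fun (p : ℝ × ℝ) s => χ s • (H.next χ Y₀ j.Y j.V w ω).P (s, p.2))
      ((hχ.comp continuous_snd).smul (hPc.comp (by fun_prop))) continuous_const continuous_fst)
  · have e := (h.deriv₀ x).add (hasDerivAt_intervalIntegral_of_continuous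
      (F := fun y s => χ s • (H.next χ Y₀ j.Y j.V w ω).P (s, y))
      (F' := fun y s => χ s • (H.next χ Y₀ j.Y j.V w ω).P' (s, y)) ((hχ.comp continuous_snd).smul (hPc.comp (by fun_prop)))
      ((hχ.comp continuous_snd).smul (hP'c.comp (by fun_prop))) (fun y s => (h.derivP hj.derivY hs.deriv s y).const_smul (χ s)) 0 t x)
    refine e.congr_deriv ?_
    rw [integral_eq_sub_of_hasDerivAt (fun s _ => h.time_V hj hs s x)
      ((hχ.smul (hP'c.comp (by fun_prop))).intervalIntegrable _ _)]
    simp only [HypSys.next, hj.init, hs.init, H.Linv_L]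
    abel
  · have hc : Continuous fun s => χ s • (H.next χ Y₀ j.Y j.V w ω).P (s, x) :=
      hχ.smul (hPc.comp (by fun_prop))
    exact ((hc.integral_hasStrictDerivAt 0 t).hasDerivAt).const_add (Y₀ x)
  · have e := h.clock.norm_integral_le (g := fun s => (H.next χ Y₀ j.Y j.V w ω).P (s, p.2)) hB3
      (a := 0) (b := p.1) fun s _ _ => hPb _
    have e2 : c.σ * c.B₃ ≤ 1 := by
      have := h.small'
      have h3 := h.le_B₃
      have h4 := h.clock.sigma_nonneg
      have h5 : c.B₃ ≤ 4 * c.C * c.B := by nlinarith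
      nlinarith
    exact (norm_add_le _ _).trans (add_le_add (h.bound₀ _) (e.trans e2))
  · refine (h.boundV' hj.boundY hj.boundV hs.bound p).trans (le_trans ?_ (hs.boundx' p))
    have : 0 ≤ c.B + ‖ω p‖ := add_nonneg hB (norm_nonneg _)
    exact mul_le_mul_of_nonneg_right (by nlinarith) this

end HypSys.Setup

end

section

variable {ι : Type*} [Fintype ι]

theorem Clock.rad_time_le {χ : ℝ → ℝ} {σ Λ : ℝ} (h : Clock χ σ) (hΛ : 0 ≤ Λ) {s t : ℝ} (hs : s ∈ uIcc 0 t)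
    (x : ℝ) : rad χ Λ (s, x) ≤ rad χ Λ (t, x) := by
  have := h.clk_add hs
  have := abs_nonneg (∫ r in s..t, χ r)
  simp only [rad]
  gcongr
  linarith

/-- The exponential rate of the weights on the cone of radius `R`. -/
def Consts.N (c : Consts) (R : ℝ) : ℝ := 16 * c.C * (c.C + c.K R)

namespace HypSys.Setup

variable {H : HypSys ι} {c : Consts} {χ : ℝ → ℝ} {Y₀ Y₀' w₀' : ℝ → ι → ℝ}

theorem K_nonneg (h : H.Setup c χ Y₀ Y₀' w₀') {R : ℝ} (hR : 0 ≤ R) : 0 ≤ c.K R := by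
  have := h.K₀_nonneg hR
  have := h.B_nonneg
  unfold Consts.K
  positivity

theorem le_N (h : H.Setup c χ Y₀ Y₀' w₀') {R : ℝ} (hR : 0 ≤ R) : 16 * c.C ≤ c.N R := by
  have h1 := h.bounds.one_le
  have h2 := h.K_nonneg hR
  unfold Consts.N
  nlinarith

theorem mono_N (h : H.Setup c χ Y₀ Y₀' w₀') : Monotone c.N := fun r s hrs => by
  have := h.mono_K hrs
  have h1 := h.bounds.one_le
  unfold Consts.N
  gcongr

theorem sol_along (h : H.Setup c χ Y₀ Y₀' w₀') {w₀ : ℝ → ι → ℝ} {Y V w ω : ℝ × ℝ → ι → ℝ}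
    {S : ℝ × ℝ → (ι → ℝ) × (ι → ℝ) × (ι → ℝ)} {φ : ι → ℝ × ℝ × ℝ → ℝ} (hY : Continuous Y)
    (hs : H.Sol c χ w₀ Y V S φ w ω) {lam : ℝ × ℝ → ℝ} (hlam : Continuous lam) {ψ : ℝ × ℝ × ℝ → ℝ}
    (hψ : IsFlow χ lam ψ) (i : ι) (t x : ℝ) :
    w (t, x) i = w₀ (ψ (0, t, x)) i + ∫ s in (0 : ℝ)..t, χ s *
      (H.force (S (s, ψ (s, t, x)), w (s, ψ (s, t, x))) i +
      (lam (s, ψ (s, t, x)) - H.lam i (Y (s, ψ (s, t, x)))) * ω (s, ψ (s, t, x)) i) := by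
  have h1 := h.bounds.force.contDiff.continuous
  have h2 := (h.bounds.lam i).contDiff.continuous
  have h3 := hs.contS
  have h4 := hs.cont
  have h5 := hs.contx
  have h6 := hψ.cont
  have h7 := h.clock.cont
  have hd : ∀ s, HasDerivAt (fun s => w (s, ψ (s, t, x)) i) (χ s *
      (H.force (S (s, ψ (s, t, x)), w (s, ψ (s, t, x))) i +
      (lam (s, ψ (s, t, x)) - H.lam i (Y (s, ψ (s, t, x)))) * ω (s, ψ (s, t, x)) i)) s := fun s => by
    have e2 := hasDerivWithinAt_sub_along (I := univ) (f := fun p => w p i) (f' := fun p => ω p i)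
      (X := fun s => ψ (s, t, x)) (fun s _ y => hasDerivAt_pi.1 (hs.deriv s y) i)
      (by fun_prop) (hψ.deriv s t x).hasDerivWithinAt
    rw [hasDerivWithinAt_univ] at e2
    have e3 := (hasDerivAt_pi.1 (h.sol_time hs s (ψ (s, t, x))) i).add e2
    refine (e3.congr_of_eventuallyEq (Eventually.of_forall fun r => ?_)).congr_deriv (by ring)
    simp
  rw [integral_eq_sub_of_hasDerivAt (fun s _ => hd s) (Continuous.intervalIntegrable (by fun_prop) _ _),
    hψ.init, hs.init]
  ring

section Difference

variable {w₀ : ℝ → ι → ℝ} {Y V w ω Y' V' w' ω' : ℝ × ℝ → ι → ℝ}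
    {S S' : ℝ × ℝ → (ι → ℝ) × (ι → ℝ) × (ι → ℝ)} {φ φ' : ι → ℝ × ℝ × ℝ → ℝ}

theorem diff_sol (h : H.Setup c χ Y₀ Y₀' w₀') (hY : Continuous Y) (hY' : Continuous Y')
    (hYb : ∀ p, ‖Y p‖ ≤ c.B) (hYb' : ∀ p, ‖Y' p‖ ≤ c.B)
    (hSb : ∀ p, ‖S p‖ ≤ c.B) (hSb' : ∀ p, ‖S' p‖ ≤ c.B) (hs : H.Sol c χ w₀ Y V S φ w ω)
    (hs' : H.Sol c χ w₀ Y' V' S' φ' w' ω') {R E : ℝ} (hR : 0 ≤ R) (hE : 0 ≤ E)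
    (hdS : ∀ p, rad χ c.C p ≤ R → ‖S p - S' p‖ ≤ E * Real.exp (c.N R * clk χ p.1))
    (hdY : ∀ p, rad χ c.C p ≤ R → ‖Y p - Y' p‖ ≤ E / (8 * c.C) * Real.exp (c.N R * clk χ p.1))
    {p : ℝ × ℝ} (hp : rad χ c.C p ≤ R) :
    ‖w p - w' p‖ ≤ E / (8 * c.C) * Real.exp (c.N R * clk χ p.1) := by
  have h1 := h.bounds.one_le
  have hN := h.le_N hR
  have hK := h.K_nonneg hR
  have hc1 := hs.cont
  have hc2 := hs'.cont
  have hC : 0 ≤ c.C := by linarith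
  have key := cone_gronwall (f := fun p => w p - w' p) (R := R) (a := 0) (A := c.C)
    (D := c.C * E + c.K R * (E / 8)) (N := c.N R) (I := univ) h.clock hs.chars.speed hs.chars.flow hC
    ordConnected_univ (mem_univ 0) (by fun_prop) hC (by positivity) le_rfl (by linarith)
    (by linarith) (fun t _ x hx i => by
      refine ⟨fun s => H.force (S (s, φ i (s, t, x)), w (s, φ i (s, t, x))) i -
        (H.force (S' (s, φ i (s, t, x)), w' (s, φ i (s, t, x))) i +
        (H.lam i (Y (s, φ i (s, t, x))) - H.lam i (Y' (s, φ i (s, t, x)))) * ω' (s, φ i (s, t, x)) i),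
        fun s hs0 => ?_, ?_⟩
      · have hr := ((hs.chars.flow i).rad_le h.clock (hs.chars.speed i) hs0 x).trans hx
        beta_reduce
        generalize hz : (s, φ i (s, t, x)) = z at hr ⊢
        have hz1 : z.1 = s := by rw [← hz]
        have e1 : |H.force (S z, w z) i - H.force (S' z, w' z) i| ≤
            c.C * (E * Real.exp (c.N R * clk χ s) + ‖w z - w' z‖) := by
          refine (norm_apply_le (H.force (S z, w z) - H.force (S' z, w' z)) i).trans
            ((h.bounds.force.lip (max_le (hSb z) ((hs.bound z).trans h.le_B))
              (max_le (hSb' z) ((hs'.bound z).trans h.le_B))).trans ?_)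
          refine mul_le_mul_of_nonneg_left (max_le ?_ ?_) hC
          · have := hdS z hr
            rw [hz1] at this
            have := norm_nonneg (w z - w' z)
            dsimp only [Prod.fst_sub]
            linarith
          · have : 0 ≤ E * Real.exp (c.N R * clk χ s) := by positivity
            dsimp only [Prod.snd_sub]
            linarith
        have e2 : |H.lam i (Y z) - H.lam i (Y' z)| ≤ E / 8 * Real.exp (c.N R * clk χ s) := by
          refine ((h.bounds.lam i).lip (hYb z) (hYb' z)).trans
            ((mul_le_mul_of_nonneg_left (hdY z hr) hC).trans_eq ?_)
          rw [hz1]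
          field_simp
        have e3 : |ω' z i| ≤ c.K R :=
          (norm_apply_le _ i).trans ((hs'.boundx z).trans (h.mono_K hr))
        have e4 : |(H.lam i (Y z) - H.lam i (Y' z)) * ω' z i| ≤
            E / 8 * Real.exp (c.N R * clk χ s) * c.K R := by
          rw [abs_mul]
          gcongr
        rw [sub_add_eq_sub_sub]
        refine (abs_sub _ _).trans ((add_le_add e1 e4).trans_eq (by ring))
      · rw [zero_add]
        refine le_of_eq (congrArg abs ?_)
        have f1 := h.bounds.force.contDiff.continuous
        have f2 := (h.bounds.lam i).contDiff.continuous
        have f3 := hs.contS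
        have f3' := hs'.contS
        have f5 := hs'.contx
        have f6 := (hs.chars.flow i).cont
        have f7 := h.clock.cont
        rw [Pi.sub_apply, h.sol_along hY' hs' (hs.chars.speed i).cont (hs.chars.flow i) i t x, hs.eq]
        simp only [transport, mul_sub]
        rw [intervalIntegral.integral_sub (Continuous.intervalIntegrable (by fun_prop) _ _)
          (Continuous.intervalIntegrable (by fun_prop) _ _)]
        ring)
  have := key p.1 (mem_univ _) p.2 hp
  refine this.trans (mul_le_mul_of_nonneg_right ?_ (Real.exp_nonneg _))
  have hNp : 0 < c.N R := by linarith
  rw [mul_zero, zero_add, div_le_div_iff₀ hNp (by positivity)]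
  unfold Consts.N
  nlinarith [mul_nonneg hC (mul_nonneg hE hK), mul_nonneg hC (mul_nonneg hE hC), mul_nonneg hE hK]

theorem diff_lift (h : H.Setup c χ Y₀ Y₀' w₀') {E : ℝ} {p : ℝ × ℝ}
    (hYb : ‖Y p‖ ≤ c.B) (hYb' : ‖Y' p‖ ≤ c.B) (hw : ‖w p‖ ≤ c.b₀ + 1) (hw' : ‖w' p‖ ≤ c.b₀ + 1)
    (hdY : ‖Y p - Y' p‖ ≤ E / (8 * c.C)) (hdw : ‖w p - w' p‖ ≤ E / (8 * c.C)) :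
    ‖H.lift (Y p, w p) - H.lift (Y' p, w' p)‖ ≤ E / 8 := by
  have h1 := h.bounds.one_le
  have hC : 0 ≤ c.C := by linarith
  refine (h.bounds.lift.lip (max_le hYb (hw.trans h.le_B)) (max_le hYb' (hw'.trans h.le_B))).trans
    ((mul_le_mul_of_nonneg_left (max_le hdY hdw) hC).trans_eq ?_)
  field_simp

theorem diff_time (h : H.Setup c χ Y₀ Y₀' w₀') {j j' : Jet ι} (hj : j.Good c χ Y₀) (hj' : j'.Good c χ Y₀)
    {R E : ℝ} (hR : 0 ≤ R) (hE : 0 ≤ E)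
    (hd : ∀ p, rad χ c.C p ≤ R → ‖j.P p - j'.P p‖ ≤ E * Real.exp (c.N R * clk χ p.1))
    {p : ℝ × ℝ} (hp : rad χ c.C p ≤ R) :
    ‖j.Y p - j'.Y p‖ ≤ E / c.N R * Real.exp (c.N R * clk χ p.1) := by
  obtain ⟨t, x⟩ := p
  have h1 := h.bounds.one_le
  have hN := h.le_N hR
  have hNp : 0 < c.N R := by linarith
  have c1 := hj.contP
  have c2 := hj'.contP
  have c3 := h.clock.cont
  refine (pi_norm_le_iff_of_nonneg (by positivity)).2 fun i => ?_
  have e : (j.Y (t, x) - j'.Y (t, x)) i = ∫ s in (0 : ℝ)..t, χ s * (j.P (s, x) i - j'.P (s, x) i) := by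
    have hd : ∀ s, HasDerivAt (fun s => j.Y (s, x) i - j'.Y (s, x) i)
        (χ s * (j.P (s, x) i - j'.P (s, x) i)) s := fun s =>
      ((hasDerivAt_pi.1 (hj.time s x) i).sub (hasDerivAt_pi.1 (hj'.time s x) i)).congr_deriv
        (by simp [mul_sub])
    rw [integral_eq_sub_of_hasDerivAt (fun s _ => hd s) (Continuous.intervalIntegrable (by fun_prop) _ _),
      hj.init, hj'.init]
    simp
  rw [e, Real.norm_eq_abs]
  refine h.clock.abs_integral_le_exp hNp hE fun s hs => ?_
  exact (norm_apply_le (j.P (s, x) - j'.P (s, x)) i).trans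
    (hd (s, x) ((h.clock.rad_time_le (by linarith) hs x).trans hp))

end Difference

end HypSys.Setup

end

section

variable {ι : Type*} [Fintype ι]

namespace HypSys.Setup

variable {H : HypSys ι} {c : Consts} {χ : ℝ → ℝ} {Y₀ Y₀' w₀' : ℝ → ι → ℝ}

theorem B_le_K (h : H.Setup c χ Y₀ Y₀' w₀') {r : ℝ} (hr : 0 ≤ r) : c.B ≤ c.K r := by
  have h1 := h.bounds.one_le
  have h2 := h.le_K hr
  have := h.K₀_nonneg hr
  have := h.clock.sigma_nonneg
  have := h.K_nonneg hr
  have : 0 ≤ 2 * c.K₀ r + 2 * (c.σ * (c.C * c.K r)) := by positivity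
  linarith

/-- The jet starting the iteration. -/
def base (H : HypSys ι) (Y₀ Y₀' w₀' : ℝ → ι → ℝ) : Jet ι where
  Y p := Y₀ p.2
  V p := Y₀' p.2
  P _ := 0
  V' p := fderiv ℝ (fun z : (ι → ℝ) × (ι → ℝ) => H.Linv z.1 z.2) (Y₀ p.2, H.L (Y₀ p.2) (Y₀' p.2))
    (Y₀' p.2, w₀' p.2)
  P' _ := 0

theorem good_base (h : H.Setup c χ Y₀ Y₀' w₀') : (base H Y₀ Y₀' w₀').Good c χ Y₀ := by
  have hY : Continuous Y₀ := continuous_iff_continuousAt.2 fun x => (h.deriv₀ x).continuousAt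
  have hw : Continuous fun x => H.L (Y₀ x) (Y₀' x) :=
    continuous_iff_continuousAt.2 fun x => (h.derivw₀ x).continuousAt
  have h0 := h.cont₀'
  have h0' := h.contw₀'
  have hb := h.b₀_nonneg
  have e : ∀ x, Y₀' x = H.Linv (Y₀ x) (H.L (Y₀ x) (Y₀' x)) := fun x => (H.Linv_L _ _).symm
  have hYb : ∀ p : ℝ × ℝ, ‖Y₀ p.2‖ ≤ c.b₀ + 1 := fun p => by linarith [h.bound₀ p.2]
  have hwb : ∀ p : ℝ × ℝ, ‖H.L (Y₀ p.2) (Y₀' p.2)‖ ≤ c.b₀ + 1 := fun p => by linarith [h.boundw₀ p.2]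
  have hVb : ∀ p : ℝ × ℝ, ‖Y₀' p.2‖ ≤ c.B₂ := fun p => by
    rw [e]
    exact h.boundV _ _ (hYb p) (hwb p)
  refine ⟨hY.comp continuous_snd, h0.comp continuous_snd, continuous_const, ?_, continuous_const,
    fun t x => h.deriv₀ x, fun t x => ?_, fun t x => hasDerivAt_const _ _, fun t x => ?_, fun x => rfl,
    hYb, hVb, fun p => ?_, fun p => ?_, fun p => ?_⟩
  · exact h.continuous_V' (χ := χ) (Y₀ := Y₀) (hY.comp continuous_snd) (h0.comp continuous_snd)
      (hw.comp continuous_snd) (h0'.comp continuous_snd)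
  · have := h.derivV (χ := χ) (Y₀ := Y₀) (Y := fun p => Y₀ p.2) (V := fun p => Y₀' p.2)
      (w := fun p => H.L (Y₀ p.2) (Y₀' p.2)) (ω := fun p => w₀' p.2) (fun t x => h.deriv₀ x)
      (fun t x => h.derivw₀ x) t x
    refine this.congr_of_eventuallyEq (Eventually.of_forall fun y => ?_)
    exact e y
  · simpa [base] using hasDerivAt_const t (Y₀ x)
  · have := (norm_nonneg _).trans (h.boundP 0 0 (by simpa using by linarith)
      (by simpa using (norm_nonneg _).trans (hVb (0, 0))))
    simpa [base] using this
  · have h1 := h.bounds.one_le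
    have hr := h.rad_nonneg p
    have h2 : ‖w₀' p.2‖ ≤ c.K₀ (rad χ c.C p) := (h.boundw₀' p.2).trans (h.mono₀ (by
      have := mul_nonneg (zero_le_one.trans h1) (clk_nonneg (χ := χ) p.1)
      simp only [rad]
      linarith))
    refine (h.boundV' (χ := χ) (Y₀ := Y₀) (ω := fun p => w₀' p.2) hYb hVb hwb p).trans ?_
    have hB := h.B_nonneg
    have hK := h.K₀_nonneg hr
    unfold Consts.K
    calc c.C * (c.B + ‖w₀' p.2‖) ≤ c.C * (c.B + 2 * c.K₀ (rad χ c.C p)) := by gcongr; linarith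
      _ ≤ _ := by
        have : 0 ≤ c.B + 2 * c.K₀ (rad χ c.C p) := by positivity
        nlinarith [mul_nonneg (sub_nonneg.2 h1) this, mul_nonneg (mul_nonneg (sub_nonneg.2 h1) (zero_le_one.trans h1)) this, mul_nonneg (zero_le_one.trans h1) this]
  · simpa [base] using h.K_nonneg (h.rad_nonneg p)

theorem norm_S_le (h : H.Setup c χ Y₀ Y₀' w₀') {j : Jet ι} (hj : j.Good c χ Y₀) (p : ℝ × ℝ) :
    ‖j.S p‖ ≤ c.B :=
  max_le ((hj.boundY p).trans h.le_B)
    (max_le ((hj.boundV p).trans h.le_B₂) ((hj.boundP p).trans h.le_B₃))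

theorem exists_sol_jet (h : H.Setup c χ Y₀ Y₀' w₀') {j : Jet ι} (hj : j.Good c χ Y₀) :
    ∃ φ w ω, H.Sol c χ (fun x => H.L (Y₀ x) (Y₀' x)) j.Y j.V j.S φ w ω :=
  h.exists_sol hj.contY hj.contV hj.derivY hj.boundY hj.boundV h.bounds.force (S := j.S) (Sx := j.Sx)
    (Φ := fun s _ => s) (hj.contY.prodMk (hj.contV.prodMk hj.contP))
    (hj.contV.prodMk (hj.contV'.prodMk hj.contP'))
    (fun t x => (hj.derivY t x).prodMk ((hj.derivV t x).prodMk (hj.derivP t x))) (h.norm_S_le hj)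
    (fun p => max_le (((hj.boundV p).trans h.le_B₂).trans (h.B_le_K (h.rad_nonneg p)))
      (max_le (hj.boundV' p) (hj.boundP' p))) continuous_fst (fun _ _ => rfl)

theorem exists_iterate (h : H.Setup c χ Y₀ Y₀' w₀') :
    ∃ (j : ℕ → Jet ι) (φ : ℕ → ι → ℝ × ℝ × ℝ → ℝ) (w ω : ℕ → ℝ × ℝ → ι → ℝ), ∀ n, (j n).Good c χ Y₀ ∧
      H.Sol c χ (fun x => H.L (Y₀ x) (Y₀' x)) (j n).Y (j n).V (j n).S (φ n) (w n) (ω n) ∧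
      j (n + 1) = H.next χ Y₀ (j n).Y (j n).V (w n) (ω n) := by
  choose φ w ω hs using fun j : {j : Jet ι // j.Good c χ Y₀} => h.exists_sol_jet j.2
  let j : ℕ → {j : Jet ι // j.Good c χ Y₀} := fun n => Nat.rec ⟨_, h.good_base⟩
    (fun _ j => ⟨_, h.good_next j.2 (hs j)⟩) n
  exact ⟨fun n => (j n).1, fun n => φ (j n), fun n => w (j n), fun n => ω (j n),
    fun n => ⟨(j n).2, hs (j n), rfl⟩⟩

theorem one_le_exp (h : H.Setup c χ Y₀ Y₀' w₀') {R : ℝ} (hR : 0 ≤ R) (t : ℝ) :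
    1 ≤ Real.exp (c.N R * clk χ t) := by
  have h1 := h.bounds.one_le
  have := h.le_N hR
  exact Real.one_le_exp (mul_nonneg (by linarith) (clk_nonneg _))

/-- Comparison of the next iterates of two jets. -/
theorem diff_next (h : H.Setup c χ Y₀ Y₀' w₀') {j k : Jet ι} {Y V w ω w' ω' : ℝ × ℝ → ι → ℝ}
    {S : ℝ × ℝ → (ι → ℝ) × (ι → ℝ) × (ι → ℝ)} {φ φ' : ι → ℝ × ℝ × ℝ → ℝ}
    (hj : j.Good c χ Y₀) (hs : H.Sol c χ (fun x => H.L (Y₀ x) (Y₀' x)) j.Y j.V j.S φ w ω)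
    (hk : k = H.next χ Y₀ j.Y j.V w ω) (hY : Continuous Y)
    (hYb : ∀ p, ‖Y p‖ ≤ c.b₀ + 1) (hSb : ∀ p, ‖S p‖ ≤ c.B)
    (hs' : H.Sol c χ (fun x => H.L (Y₀ x) (Y₀' x)) Y V S φ' w' ω') {R E : ℝ} (hR : 0 ≤ R) (hE : 0 ≤ E)
    (hdS : ∀ p, rad χ c.C p ≤ R → ‖j.S p - S p‖ ≤ E * Real.exp (c.N R * clk χ p.1))
    (hdY : ∀ p, rad χ c.C p ≤ R → ‖j.Y p - Y p‖ ≤ E / (8 * c.C) * Real.exp (c.N R * clk χ p.1))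
    {p : ℝ × ℝ} (hp : rad χ c.C p ≤ R) :
    ‖k.V p - H.Linv (Y p) (w' p)‖ ≤ E / 8 * Real.exp (c.N R * clk χ p.1) ∧
    ‖k.P p - H.rate (Y p) (H.Linv (Y p) (w' p))‖ ≤ E / 8 * Real.exp (c.N R * clk χ p.1) := by
  have hw := h.diff_sol hj.contY hY (fun p => (hj.boundY p).trans h.le_B)
    (fun p => (hYb p).trans h.le_B) (h.norm_S_le hj) hSb hs hs' hR hE hdS hdY hp
  have hl := h.diff_lift (E := E * Real.exp (c.N R * clk χ p.1)) ((hj.boundY p).trans h.le_B)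
    ((hYb p).trans h.le_B) (hs.bound p) (hs'.bound p)
    ((hdY p hp).trans_eq (by ring)) (hw.trans_eq (by ring))
  have e : E * Real.exp (c.N R * clk χ p.1) / 8 = E / 8 * Real.exp (c.N R * clk χ p.1) := by ring
  rw [e] at hl
  subst hk
  exact ⟨((le_max_left _ _).trans (le_max_right _ _)).trans hl,
    ((le_max_right _ _).trans (le_max_right _ _)).trans hl⟩

end HypSys.Setup

end

section

variable {ι : Type*} [Fintype ι]

namespace HypSys.Setup

variable {H : HypSys ι} {c : Consts} {χ : ℝ → ℝ} {Y₀ Y₀' w₀' : ℝ → ι → ℝ}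

theorem iterate_diff (h : H.Setup c χ Y₀ Y₀' w₀') {j : ℕ → Jet ι} {φ : ℕ → ι → ℝ × ℝ × ℝ → ℝ}
    {w ω : ℕ → ℝ × ℝ → ι → ℝ} (hj : ∀ n, (j n).Good c χ Y₀)
    (hs : ∀ n, H.Sol c χ (fun x => H.L (Y₀ x) (Y₀' x)) (j n).Y (j n).V (j n).S (φ n) (w n) (ω n))
    (hn : ∀ n, j (n + 1) = H.next χ Y₀ (j n).Y (j n).V (w n) (ω n)) {R : ℝ} (hR : 0 ≤ R) (n : ℕ) :
    ∀ p, rad χ c.C p ≤ R →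
      ‖(j (n + 1)).S p - (j n).S p‖ ≤ 16 * c.B * c.C / 2 ^ n * Real.exp (c.N R * clk χ p.1) ∧
      ‖(j (n + 1)).Y p - (j n).Y p‖ ≤
        16 * c.B * c.C / 2 ^ n / (8 * c.C) * Real.exp (c.N R * clk χ p.1) := by
  have hB := h.B_nonneg
  have h1 := h.bounds.one_le
  induction n with
  | zero =>
    intro p _
    have he := h.one_le_exp hR p.1
    have hS : ‖(j 1).S p - (j 0).S p‖ ≤ 2 * c.B := (norm_sub_le _ _).trans
      (by linarith [h.norm_S_le (hj 1) p, h.norm_S_le (hj 0) p])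
    have hY : ‖(j 1).Y p - (j 0).Y p‖ ≤ 2 * c.B := (le_max_left _ _).trans hS
    have e : 16 * c.B * c.C / 2 ^ 0 / (8 * c.C) = 2 * c.B := by field_simp; ring
    rw [e]
    refine ⟨hS.trans ?_, hY.trans (by nlinarith)⟩
    have : 2 * c.B ≤ 16 * c.B * c.C := by nlinarith
    rw [pow_zero, div_one]
    nlinarith [mul_nonneg hB (zero_le_one.trans h1)]
  | succ n ih =>
    set E := 16 * c.B * c.C / 2 ^ n with hE
    have hE0 : 0 ≤ E := by positivity
    have e : 16 * c.B * c.C / 2 ^ (n + 1) = E / 2 := by rw [hE, pow_succ]; ring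
    rw [e]
    have hVP : ∀ p, rad χ c.C p ≤ R →
        ‖(j (n + 2)).V p - (j (n + 1)).V p‖ ≤ E / 8 * Real.exp (c.N R * clk χ p.1) ∧
        ‖(j (n + 2)).P p - (j (n + 1)).P p‖ ≤ E / 8 * Real.exp (c.N R * clk χ p.1) := fun p hp => by
      have := h.diff_next (hj (n + 1)) (hs (n + 1)) (hn (n + 1)) (hj n).contY (hj n).boundY
        (h.norm_S_le (hj n)) (hs n) hR hE0 (fun p hp => (ih p hp).1) (fun p hp => (ih p hp).2) hp
      have e : j (n + 1) = _ := hn n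
      refine ⟨this.1.trans_eq' ?_, this.2.trans_eq' ?_⟩
      · conv_rhs => rw [e]
        rfl
      · conv_rhs => rw [e]
        rfl
    intro p hp
    have hY := h.diff_time (hj (n + 2)) (hj (n + 1)) hR (E := E / 8) (by positivity)
      (fun p hp => (hVP p hp).2) hp
    have hN := h.le_N hR
    have he := h.one_le_exp hR p.1
    have hY1 : E / 8 / c.N R ≤ E / 2 / (8 * c.C) := by
      rw [div_le_div_iff₀ (by linarith) (by linarith)]
      nlinarith
    have hY2 : E / 2 / (8 * c.C) ≤ E / 2 := div_le_self (by positivity) (by linarith)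
    have hY3 := hY.trans (mul_le_mul_of_nonneg_right hY1 (zero_le_one.trans he))
    have hE8 : E / 8 * Real.exp (c.N R * clk χ p.1) ≤ E / 2 * Real.exp (c.N R * clk χ p.1) := by
      gcongr
      norm_num
    exact ⟨max_le (hY3.trans (mul_le_mul_of_nonneg_right hY2 (zero_le_one.trans he)))
      (max_le ((hVP p hp).1.trans hE8) ((hVP p hp).2.trans hE8)), hY3⟩

theorem exp_le (h : H.Setup c χ Y₀ Y₀' w₀') {R : ℝ} (hR : 0 ≤ R) (t : ℝ) :
    Real.exp (c.N R * clk χ t) ≤ Real.exp (c.N R * c.σ) := by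
  have h1 := h.bounds.one_le
  have := h.le_N hR
  have := h.clock.clk_le t
  gcongr
  linarith

/-- The iteration converges to a jet that solves the quasilinear system. -/
theorem exists_jet (h : H.Setup c χ Y₀ Y₀' w₀') :
    ∃ (j : Jet ι) (φ : ι → ℝ × ℝ × ℝ → ℝ) (w ω : ℝ × ℝ → ι → ℝ), j.Good c χ Y₀ ∧
      H.Sol c χ (fun x => H.L (Y₀ x) (Y₀' x)) j.Y j.V j.S φ w ω ∧
      (∀ p, j.V p = H.Linv (j.Y p) (w p)) ∧ ∀ p, j.P p = H.rate (j.Y p) (j.V p) := by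
  obtain ⟨j, φ, w, ω, hall⟩ := h.exists_iterate
  have hj := fun n => (hall n).1
  have hs := fun n => (hall n).2.1
  have hn := fun n => (hall n).2.2
  have hB := h.B_nonneg
  have h1 := h.bounds.one_le
  have hσ := h.clock.sigma_nonneg
  have hχ := h.clock.cont
  let M : ℝ → ℝ := fun R => 32 * c.B * c.C * Real.exp (c.N (max R 0) * c.σ)
  have hM : Monotone M := fun r s hrs => by
    have := h.mono_N (max_le_max_right 0 hrs)
    dsimp only [M]
    gcongr
  have hρ : Continuous (rad χ c.C) := h.clock.continuous_rad
  obtain ⟨g, hgc, hgle, hglim⟩ := exists_limit_of_geometric (f := fun n p => (j n).S p) hM hρ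
    (fun n => (hj n).contY.prodMk ((hj n).contV.prodMk (hj n).contP)) (fun n p => by
      have e0 := h.rad_nonneg p
      refine ((h.iterate_diff hj hs hn e0 n p le_rfl).1.trans (mul_le_mul_of_nonneg_left
        (h.exp_le e0 p.1) (by positivity))).trans_eq ?_
      simp only [M, max_eq_left e0]
      ring)
  have lY : ∀ p, Tendsto (fun n => (j n).Y p) atTop (nhds (g p).1) := fun p =>
    (continuous_fst.tendsto _).comp (hglim p)
  have lV : ∀ p, Tendsto (fun n => (j n).V p) atTop (nhds (g p).2.1) := fun p =>
    (continuous_snd.fst.tendsto _).comp (hglim p)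
  have lP : ∀ p, Tendsto (fun n => (j n).P p) atTop (nhds (g p).2.2) := fun p =>
    (continuous_snd.snd.tendsto _).comp (hglim p)
  have dY : ∀ t x, HasDerivAt (fun y => (g (t, y)).1) (g (t, x)).2.1 x := fun t x =>
    hasDerivAt_of_geometric (f := fun n y => (j n).Y (t, y)) (f' := fun n y => (j n).V (t, y))
      (g := fun y => (g (t, y)).1) (g' := fun y => (g (t, y)).2.1) (ρ := fun y => rad χ c.C (t, y)) hM
      (by fun_prop) (fun n x => (hj n).derivY t x) (fun x => lY (t, x))
      (fun n x => ((le_max_left _ _).trans (le_max_right _ _)).trans (hgle n (t, x))) x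
  have tY : ∀ t x, HasDerivAt (fun s => (g (s, x)).1) (χ t • (g (t, x)).2.2) t := fun t x =>
    hasDerivAt_of_geometric (f := fun n s => (j n).Y (s, x)) (f' := fun n s => χ s • (j n).P (s, x))
      (g := fun s => (g (s, x)).1) (g' := fun s => χ s • (g (s, x)).2.2) (ρ := fun s => rad χ c.C (s, x)) hM
      (by fun_prop) (fun n t => (hj n).time t x) (fun s => lY (s, x))
      (fun n s => by
        rw [← smul_sub, norm_smul, Real.norm_of_nonneg (h.clock.nonneg s)]
        exact (mul_le_of_le_one_left (norm_nonneg _) (h.clock.le_one s)).trans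
          (((le_max_right _ _).trans (le_max_right _ _)).trans (hgle n (s, x)))) t
  have bY : ∀ p, ‖(g p).1‖ ≤ c.b₀ + 1 := fun p =>
    le_of_tendsto (lY p).norm (Eventually.of_forall fun n => (hj n).boundY p)
  have bV : ∀ p, ‖(g p).2.1‖ ≤ c.B₂ := fun p =>
    le_of_tendsto (lV p).norm (Eventually.of_forall fun n => (hj n).boundV p)
  have bP : ∀ p, ‖(g p).2.2‖ ≤ c.B₃ := fun p =>
    le_of_tendsto (lP p).norm (Eventually.of_forall fun n => (hj n).boundP p)
  have cY : Continuous fun p => (g p).1 := by fun_prop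
  have cV : Continuous fun p => (g p).2.1 := by fun_prop
  have init : ∀ x, (g (0, x)).1 = Y₀ x := fun x =>
    tendsto_nhds_unique (lY (0, x)) (tendsto_const_nhds.congr fun n => ((hj n).init x).symm)
  obtain ⟨ψ, W, Ω, hsol⟩ := h.exists_sol cY cV dY bY bV h.bounds.force' (S := fun p => (g p).1)
    (Sx := fun p => (g p).2.1) cY cV dY (fun p => (bY p).trans h.le_B)
    (fun p => ((bV p).trans h.le_B₂).trans (h.B_le_K (h.rad_nonneg p)))
    (Φ := fun Y w => H.lift (Y, w)) h.bounds.lift.contDiff.continuous (fun s z => rfl)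
  have hSb : ∀ p, ‖H.lift ((g p).1, W p)‖ ≤ c.B := fun p => by
    have e := h.boundV _ _ (bY p) (hsol.bound p)
    exact max_le ((bY p).trans h.le_B) (max_le (e.trans h.le_B₂)
      ((h.boundP _ _ (bY p) e).trans h.le_B₃))
  have cmp : ∀ R, 0 ≤ R → ∀ n p, rad χ c.C p ≤ R →
      ‖(j n).S p - H.lift ((g p).1, W p)‖ ≤
        (8 * c.C * M R + 2 * c.B) / 2 ^ n * Real.exp (c.N R * clk χ p.1) := by
    intro R hR
    have hM0 : 0 ≤ M R := by dsimp only [M]; positivity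
    have hYn : ∀ n p, rad χ c.C p ≤ R → ‖(j n).Y p - (g p).1‖ ≤
        (8 * c.C * M R + 2 * c.B) / 2 ^ n / (8 * c.C) * Real.exp (c.N R * clk χ p.1) := fun n p hp => by
      have he := h.one_le_exp hR p.1
      have e1 : ‖(j n).Y p - (g p).1‖ ≤ M R / 2 ^ n := ((le_max_left _ _).trans (hgle n p)).trans (by
        gcongr
        exact hM hp)
      have e2 : M R / 2 ^ n ≤ (8 * c.C * M R + 2 * c.B) / 2 ^ n / (8 * c.C) := by
        rw [div_right_comm]
        refine div_le_div_of_nonneg_right ?_ (by positivity)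
        rw [le_div_iff₀ (by positivity)]
        linarith
      refine e1.trans (e2.trans (le_mul_of_one_le_right (by positivity) he))
    intro n
    induction n with
    | zero =>
      intro p _
      have he := h.one_le_exp hR p.1
      refine (norm_sub_le _ _).trans (le_trans (b := 2 * c.B) ?_ ?_)
      · linarith [hSb p, h.norm_S_le (hj 0) p]
      · have : 0 ≤ 8 * c.C * M R := by positivity
        rw [pow_zero, div_one]
        nlinarith
    | succ n ih =>
      intro p hp
      have hE : 0 ≤ (8 * c.C * M R + 2 * c.B) / 2 ^ n := by positivity
      have hd := h.diff_next (hj n) (hs n) (hn n) cY bY hSb hsol hR hE ih (hYn n) hp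
      have hy := hYn (n + 1) p hp
      have he := h.one_le_exp hR p.1
      have e : (8 * c.C * M R + 2 * c.B) / 2 ^ n = 2 * ((8 * c.C * M R + 2 * c.B) / 2 ^ (n + 1)) := by
        rw [pow_succ]
        field_simp
      have hE' : 0 ≤ (8 * c.C * M R + 2 * c.B) / 2 ^ (n + 1) := by positivity
      rw [e] at hd
      have e8 : 2 * ((8 * c.C * M R + 2 * c.B) / 2 ^ (n + 1)) / 8 * Real.exp (c.N R * clk χ p.1) ≤
          (8 * c.C * M R + 2 * c.B) / 2 ^ (n + 1) * Real.exp (c.N R * clk χ p.1) := by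
        refine mul_le_mul_of_nonneg_right ?_ (Real.exp_nonneg _)
        linarith
      refine max_le (hy.trans ?_) (max_le (hd.1.trans e8) (hd.2.trans e8))
      exact mul_le_mul_of_nonneg_right (div_le_self hE' (by linarith)) (Real.exp_nonneg _)
  have hlift : ∀ p, g p = H.lift ((g p).1, W p) := fun p => by
    have e0 := h.rad_nonneg p
    refine tendsto_nhds_unique (hglim p) (tendsto_iff_norm_sub_tendsto_zero.2 ?_)
    refine squeeze_zero (fun n => norm_nonneg _) (fun n => cmp _ e0 n p le_rfl) ?_
    have : Tendsto (fun n : ℕ => (8 * c.C * M (rad χ c.C p) + 2 * c.B) / 2 ^ n) atTop (nhds 0) :=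
      tendsto_const_nhds.div_atTop (tendsto_pow_atTop_atTop_of_one_lt one_lt_two)
    simpa using this.mul_const (Real.exp (c.N (rad χ c.C p) * clk χ p.1))
  have eV : ∀ p, (g p).2.1 = H.Linv (g p).1 (W p) := fun p => congrArg (fun z => z.2.1) (hlift p)
  have eP : ∀ p, (g p).2.2 = H.rate (g p).1 (g p).2.1 := fun p => by
    rw [eV]
    exact congrArg (fun z => z.2.2) (hlift p)
  let n := H.next χ Y₀ (fun p => (g p).1) (fun p => (g p).2.1) W Ω
  have enV : ∀ p, n.V p = (g p).2.1 := fun p => (eV p).symm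
  have enP : ∀ p, n.P p = (g p).2.2 := fun p => by
    rw [eP, eV]
    rfl
  refine ⟨⟨fun p => (g p).1, fun p => (g p).2.1, fun p => (g p).2.2, n.V', n.P'⟩, ψ, W, Ω,
    ⟨cY, cV, by fun_prop, h.continuous_V' cY cV hsol.cont hsol.contx,
      h.continuous_P' cY cV hsol.cont hsol.contx, dY, fun t x => ?_, fun t x => ?_, tY, init, bY, bV, bP,
      fun p => ?_, fun p => ?_⟩, ?_, eV, eP⟩
  · have := h.derivV (χ := χ) (Y₀ := Y₀) (Y := fun p => (g p).1) (V := fun p => (g p).2.1) dY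
      hsol.deriv t x
    exact this.congr_of_eventuallyEq (Eventually.of_forall fun y => (enV _).symm)
  · have := h.derivP (χ := χ) (Y₀ := Y₀) (Y := fun p => (g p).1) (V := fun p => (g p).2.1) dY
      hsol.deriv t x
    exact this.congr_of_eventuallyEq (Eventually.of_forall fun y => (enP _).symm)
  · refine ((h.boundV' (χ := χ) (Y₀ := Y₀) bY bV hsol.bound p).trans ?_).trans (hsol.boundx' p)
    have : 0 ≤ c.B + ‖Ω p‖ := by positivity
    gcongr
    nlinarith
  · exact (h.boundP' (χ := χ) (Y₀ := Y₀) bY bV hsol.bound p).trans (hsol.boundx' p)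
  · have : (fun p => H.lift ((g p).1, W p)) = g := funext fun p => (hlift p).symm
    rw [this] at hsol
    exact hsol

end HypSys.Setup

end

section

section Energy

variable {χ : ℝ → ℝ} {σ Λ Λ' a R : ℝ}

/-- The annulus `a ≤ |x| ≤ R`, shrunk at speed `Λ`. -/
def annulus (χ : ℝ → ℝ) (Λ a R t : ℝ) : Set ℝ := {x | a + Λ * clk χ t ≤ |x| ∧ |x| + Λ * clk χ t ≤ R}

theorem measurableSet_annulus {t : ℝ} : MeasurableSet (annulus χ Λ a R t) :=
  (measurableSet_le measurable_const continuous_abs.measurable).inter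
    (measurableSet_le (continuous_abs.measurable.add_const _) measurable_const)

theorem IsFlow.mem_annulus {lam lam' : ℝ × ℝ → ℝ} {φ : ℝ × ℝ × ℝ → ℝ} (h : IsFlow χ lam φ)
    (hχ : Clock χ σ) (hs : Speed lam lam' Λ Λ') {s t x : ℝ} (hst : s ∈ uIcc 0 t)
    (hx : x ∈ annulus χ Λ a R t) : φ (s, t, x) ∈ annulus χ Λ a R s := by
  have h1 := h.abs_sub_le hχ hs s t t x
  rw [h.init, integral_symm, abs_neg] at h1
  have h2 := hχ.clk_add hst
  have h3 := abs_sub_abs_le_abs_sub (φ (s, t, x)) x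
  have h4 := abs_sub_abs_le_abs_sub x (φ (s, t, x))
  rw [abs_sub_comm] at h4
  obtain ⟨h5, h6⟩ := hx
  rw [← h2] at h5 h6
  constructor <;> linarith

theorem IsFlow.lintegral_comp_le {lam lam' : ℝ × ℝ → ℝ} {φ : ℝ × ℝ × ℝ → ℝ} (h : IsFlow χ lam φ)
    (hχ : Clock χ σ) (hs : Speed lam lam' Λ Λ') (hσ : σ * Λ' ≤ 1 / 4) {s t : ℝ} (hst : s ∈ uIcc 0 t)
    (g : ℝ → ENNReal) : ∫⁻ x in annulus χ Λ a R t, g (φ (s, t, x)) ≤ 2 * ∫⁻ y in annulus χ Λ a R s, g y := by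
  have hJ : ∀ x, 1 ≤ 2 * flowJac χ lam' φ (s, t, x) := fun x => by
    have e := h.jac_mul hχ hs t s t x
    have e1 : flowJac χ lam' φ (t, t, x) = 1 := by simp [flowJac]
    have := flowJac_le (φ := φ) hχ hs hσ (t, s, φ (s, t, x))
    have := flowJac_pos (χ := χ) (lam' := lam') (φ := φ) (s, t, x)
    rw [e1] at e
    nlinarith
  have hinj : InjOn (fun x => φ (s, t, x)) (annulus χ Λ a R t) := fun x _ y _ hxy => by
    have := congrArg (fun z => φ (t, s, z)) hxy
    simpa [h.comp_eq hχ hs, h.init] using this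
  have hcv := lintegral_image_eq_lintegral_abs_deriv_mul (measurableSet_annulus (χ := χ) (Λ := Λ) (a := a) (R := R) (t := t))
    (fun x _ => (h.hasDerivAt hχ hs s t x).hasDerivWithinAt) hinj g
  calc ∫⁻ x in annulus χ Λ a R t, g (φ (s, t, x))
      ≤ ∫⁻ x in annulus χ Λ a R t, 2 * (ENNReal.ofReal |flowJac χ lam' φ (s, t, x)| * g (φ (s, t, x))) := by
        refine lintegral_mono fun x => ?_
        rw [← mul_assoc]
        refine le_mul_of_one_le_left (zero_le) ?_
        rw [abs_of_pos (flowJac_pos _), ← ENNReal.ofReal_ofNat, ← ENNReal.ofReal_mul (by norm_num)]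
        exact ENNReal.one_le_ofReal.2 (hJ x)
    _ = 2 * ∫⁻ y in (fun x => φ (s, t, x)) '' annulus χ Λ a R t, g y := by
        rw [hcv, lintegral_const_mul' _ _ (by norm_num)]
    _ ≤ _ := by
        gcongr
        exact image_subset_iff.2 fun x hx => h.mem_annulus hχ hs hst hx

theorem Clock.sq_integral_le (h : Clock χ σ) {g : ℝ → ℝ} (hg : Continuous g) {t : ℝ} (ht : 0 ≤ t) :
    (∫ s in (0 : ℝ)..t, χ s * g s) ^ 2 ≤ σ * ∫ s in (0 : ℝ)..t, χ s * g s ^ 2 := by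
  have hc := h.cont
  have hi : ∀ {f : ℝ → ℝ}, Continuous f → IntervalIntegrable f volume 0 t := fun hf =>
    hf.intervalIntegrable _ _
  have key : ∀ c : ℝ, 0 ≤ (∫ s in (0 : ℝ)..t, χ s) * (c * c) + (-2 * ∫ s in (0 : ℝ)..t, χ s * g s) * c +
      ∫ s in (0 : ℝ)..t, χ s * g s ^ 2 := fun c => by
    have : 0 ≤ ∫ s in (0 : ℝ)..t, χ s * (c - g s) ^ 2 :=
      intervalIntegral.integral_nonneg ht fun s _ => mul_nonneg (h.nonneg s) (sq_nonneg _)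
    have e : ∫ s in (0 : ℝ)..t, χ s * (c - g s) ^ 2 = ∫ s in (0 : ℝ)..t,
        ((c * c) * χ s + (-2 * c) * (χ s * g s) + χ s * g s ^ 2) := by
      congr 1
      ext s
      ring
    rw [e, intervalIntegral.integral_add (hi (by fun_prop)) (hi (by fun_prop)),
      intervalIntegral.integral_add (hi (by fun_prop)) (hi (by fun_prop)),
      intervalIntegral.integral_const_mul, intervalIntegral.integral_const_mul] at this
    linarith
  have hd := discrim_le_zero key
  have h1 : ∫ s in (0 : ℝ)..t, χ s ≤ σ := (le_abs_self _).trans (h.clk_le t)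
  have h2 : 0 ≤ ∫ s in (0 : ℝ)..t, χ s * g s ^ 2 :=
    intervalIntegral.integral_nonneg ht fun s _ => mul_nonneg (h.nonneg s) (sq_nonneg _)
  unfold discrim at hd
  nlinarith

end Energy

end

section

section Energy

variable {χ : ℝ → ℝ} {σ Λ Λ' a R : ℝ}

theorem annulus_subset (hΛ : 0 ≤ Λ) {t : ℝ} : annulus χ Λ a R t ⊆ Icc (-R) R := fun x hx => by
  have h1 := mul_nonneg hΛ (clk_nonneg (χ := χ) t)
  have := hx.2
  exact abs_le.1 (by linarith)

theorem Clock.ofReal_le_of_transport_le (hχ : Clock χ σ) {t n₀ m A : ℝ} {n : ℝ → ℝ} (hn : Continuous n)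
    (ht : 0 ≤ t) (hm : 0 ≤ m)
    (h : m ≤ A * n₀ + ∫ s in (0 : ℝ)..t, χ s * (A * n s)) :
    ENNReal.ofReal (m ^ 2) ≤ ENNReal.ofReal (2 * A ^ 2) * ENNReal.ofReal (n₀ ^ 2) +
      ENNReal.ofReal (2 * A ^ 2 * σ) * ∫⁻ s in Ioc 0 t, ENNReal.ofReal (χ s) * ENNReal.ofReal (n s ^ 2) := by
  have hc := hχ.cont
  have hσ := hχ.sigma_nonneg
  have h1 := hχ.sq_integral_le hn ht
  have e : ∫ s in (0 : ℝ)..t, χ s * (A * n s) = A * ∫ s in (0 : ℝ)..t, χ s * n s := by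
    rw [← intervalIntegral.integral_const_mul]
    congr 1
    ext s
    ring
  rw [e] at h
  have h2 : m ^ 2 ≤ 2 * A ^ 2 * n₀ ^ 2 + 2 * A ^ 2 * σ * ∫ s in (0 : ℝ)..t, χ s * n s ^ 2 := by
    have : m ^ 2 ≤ (A * n₀ + A * ∫ s in (0 : ℝ)..t, χ s * n s) ^ 2 := by gcongr
    nlinarith [sq_nonneg (A * n₀ - A * ∫ s in (0 : ℝ)..t, χ s * n s), mul_le_mul_of_nonneg_left h1 (sq_nonneg A)]
  have hp : ∀ s, 0 ≤ χ s * n s ^ 2 := fun s => mul_nonneg (hχ.nonneg s) (sq_nonneg _)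
  have e2 : ∫⁻ s in Ioc 0 t, ENNReal.ofReal (χ s) * ENNReal.ofReal (n s ^ 2) =
      ENNReal.ofReal (∫ s in (0 : ℝ)..t, χ s * n s ^ 2) := by
    rw [intervalIntegral.integral_of_le ht, ofReal_integral_eq_lintegral_ofReal
      ((Continuous.intervalIntegrable (by fun_prop) 0 t).1) (Eventually.of_forall hp)]
    exact lintegral_congr fun s => (ENNReal.ofReal_mul (hχ.nonneg s)).symm
  have hi : 0 ≤ ∫ s in (0 : ℝ)..t, χ s * n s ^ 2 := intervalIntegral.integral_nonneg ht fun s _ => hp s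
  rw [e2, ← ENNReal.ofReal_mul (by positivity), ← ENNReal.ofReal_mul (by positivity),
    ← ENNReal.ofReal_add (by positivity) (by positivity)]
  exact ENNReal.ofReal_le_ofReal h2

/-- Weighted `L²` estimate on shrinking annuli for quantities controlled along finitely many families
of characteristics. -/
theorem lintegral_annulus_le {κ : Type*} [Fintype κ] {lam lam' : κ → ℝ × ℝ → ℝ}
    {φ : κ → ℝ × ℝ × ℝ → ℝ} (hχ : Clock χ σ) (hs : ∀ k, Speed (lam k) (lam' k) Λ Λ')
    (hφ : ∀ k, IsFlow χ (lam k) (φ k)) (hσ : σ * Λ' ≤ 1 / 4) (hΛ : 0 ≤ Λ) {N : ℝ × ℝ → ℝ} {A : ℝ}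
    (hN : Continuous N) (hN0 : ∀ p, 0 ≤ N p)
    (hle : ∀ t x, 0 ≤ t → ∃ k, N (t, x) ≤ A * N (0, φ k (0, t, x)) +
      ∫ s in (0 : ℝ)..t, χ s * (A * N (s, φ k (s, t, x))))
    (hsmall : 8 * Fintype.card κ * A ^ 2 * σ ^ 2 ≤ 1) {t : ℝ} (ht : 0 ≤ t) :
    ∫⁻ x in annulus χ Λ a R t, ENNReal.ofReal (N (t, x) ^ 2) ≤
      ENNReal.ofReal (8 * Fintype.card κ * A ^ 2) *
        ∫⁻ x in annulus χ Λ a R 0, ENNReal.ofReal (N (0, x) ^ 2) := by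
  have hc := hχ.cont
  have hσ0 := hχ.sigma_nonneg
  have hφc := fun k => (hφ k).cont
  set E : ℝ → ENNReal := fun t => ∫⁻ x in annulus χ Λ a R t, ENNReal.ofReal (N (t, x) ^ 2) with hE
  set M : ENNReal := ⨆ s ∈ Icc 0 t, E s with hM
  have hEM : ∀ s ∈ Icc 0 t, E s ≤ M := fun s hs => le_iSup₂_of_le s hs le_rfl
  have hMfin : M ≠ ⊤ := by
    obtain ⟨D, hD⟩ := (isCompact_Icc.prod isCompact_Icc).exists_bound_of_continuousOn
      (s := Icc 0 t ×ˢ Icc (-R) R) (f := fun p => N p ^ 2) (by fun_prop)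
    refine ne_top_of_le_ne_top (b := ENNReal.ofReal D * volume (Icc (-R) R))
      (ENNReal.mul_ne_top (by simp) (by simp)) (iSup₂_le fun s hs => ?_)
    calc E s ≤ ∫⁻ _ in annulus χ Λ a R s, ENNReal.ofReal D :=
          setLIntegral_mono_ae measurable_const.aemeasurable (Eventually.of_forall fun x hx =>
            ENNReal.ofReal_le_ofReal ((le_abs_self _).trans (hD (s, x) ⟨hs, annulus_subset hΛ hx⟩)))
      _ ≤ _ := by
        rw [setLIntegral_const]
        gcongr
        exact annulus_subset hΛ
  have hmass : ∀ r, 0 ≤ r → ∫⁻ s in Ioc 0 r, ENNReal.ofReal (χ s) ≤ ENNReal.ofReal σ := fun r hr => by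
    rw [← ofReal_integral_eq_lintegral_ofReal ((hc.intervalIntegrable 0 r).1)
      (Eventually.of_forall hχ.nonneg), ← intervalIntegral.integral_of_le hr]
    exact ENNReal.ofReal_le_ofReal ((le_abs_self _).trans (hχ.clk_le r))
  have hstep : ∀ r ∈ Icc 0 t, E r ≤ Fintype.card κ * (ENNReal.ofReal (2 * A ^ 2) * (2 * E 0) +
      ENNReal.ofReal (2 * A ^ 2 * σ) * (ENNReal.ofReal σ * (2 * M))) := fun r hr => by
    have h1 : ∀ x, ENNReal.ofReal (N (r, x) ^ 2) ≤ ∑ k, (ENNReal.ofReal (2 * A ^ 2) *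
        ENNReal.ofReal (N (0, φ k (0, r, x)) ^ 2) + ENNReal.ofReal (2 * A ^ 2 * σ) *
        ∫⁻ s in Ioc 0 r, ENNReal.ofReal (χ s) * ENNReal.ofReal (N (s, φ k (s, r, x)) ^ 2)) := fun x => by
      obtain ⟨k, hk⟩ := hle r x hr.1
      have := hφc k
      refine (hχ.ofReal_le_of_transport_le (by fun_prop) hr.1 (hN0 _) hk).trans ?_
      exact Finset.single_le_sum (f := fun k => ENNReal.ofReal (2 * A ^ 2) *
        ENNReal.ofReal (N (0, φ k (0, r, x)) ^ 2) + ENNReal.ofReal (2 * A ^ 2 * σ) *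
        ∫⁻ s in Ioc 0 r, ENNReal.ofReal (χ s) * ENNReal.ofReal (N (s, φ k (s, r, x)) ^ 2))
        (fun _ _ => zero_le) (Finset.mem_univ k)
    have hm1 : ∀ k, Measurable fun x => ENNReal.ofReal (N (0, φ k (0, r, x)) ^ 2) := fun k => by
      have := hφc k
      exact ENNReal.measurable_ofReal.comp (Continuous.measurable (by fun_prop))
    have hm2 : ∀ k, Measurable fun z : ℝ × ℝ => ENNReal.ofReal (χ z.2) *
        ENNReal.ofReal (N (z.2, φ k (z.2, r, z.1)) ^ 2) := fun k => by
      have := hφc k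
      exact (ENNReal.measurable_ofReal.comp (Continuous.measurable (by fun_prop))).mul
        (ENNReal.measurable_ofReal.comp (Continuous.measurable (by fun_prop)))
    have hm3 : ∀ k, Measurable fun x => ∫⁻ s in Ioc 0 r, ENNReal.ofReal (χ s) *
        ENNReal.ofReal (N (s, φ k (s, r, x)) ^ 2) := fun k => (hm2 k).lintegral_prod_right'
    refine (lintegral_mono h1).trans ?_
    have hm4 : ∀ k, Measurable fun x => ENNReal.ofReal (2 * A ^ 2) *
        ENNReal.ofReal (N (0, φ k (0, r, x)) ^ 2) + ENNReal.ofReal (2 * A ^ 2 * σ) *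
        ∫⁻ s in Ioc 0 r, ENNReal.ofReal (χ s) * ENNReal.ofReal (N (s, φ k (s, r, x)) ^ 2) :=
      fun k => ((hm1 k).const_mul _).add ((hm3 k).const_mul _)
    rw [lintegral_finsetSum _ fun k _ => hm4 k]
    rw [← nsmul_eq_mul, ← Finset.card_univ, ← Finset.sum_const]
    refine Finset.sum_le_sum fun k _ => ?_
    rw [lintegral_add_left ((hm1 k).const_mul _), lintegral_const_mul _ (hm1 k),
      lintegral_const_mul _ (hm3 k)]
    refine add_le_add (mul_le_mul_right ?_ _) (mul_le_mul_right ?_ _)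
    · exact (hφ k).lintegral_comp_le hχ (hs k) hσ left_mem_uIcc fun y => ENNReal.ofReal (N (0, y) ^ 2)
    · rw [lintegral_lintegral_swap (hm2 k).aemeasurable]
      calc ∫⁻ s in Ioc 0 r, ∫⁻ x in annulus χ Λ a R r, ENNReal.ofReal (χ s) *
              ENNReal.ofReal (N (s, φ k (s, r, x)) ^ 2)
          ≤ ∫⁻ s in Ioc 0 r, ENNReal.ofReal (χ s) * (2 * M) := by
            refine setLIntegral_mono_ae (by fun_prop) (Eventually.of_forall fun s hs' => ?_)
            rw [lintegral_const_mul' _ _ (by simp)]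
            gcongr
            refine ((hφ k).lintegral_comp_le hχ (hs k) hσ
              (by rw [uIcc_of_le hr.1]; exact Ioc_subset_Icc_self hs')
              fun y => ENNReal.ofReal (N (s, y) ^ 2)).trans ?_
            gcongr
            exact hEM s ⟨hs'.1.le, hs'.2.trans hr.2⟩
        _ ≤ _ := by
            rw [lintegral_mul_const _ (by fun_prop)]
            gcongr
            exact hmass r hr.1
  have e1 : (Fintype.card κ : ENNReal) * (ENNReal.ofReal (2 * A ^ 2) * (2 * E 0) +
      ENNReal.ofReal (2 * A ^ 2 * σ) * (ENNReal.ofReal σ * (2 * M))) =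
      ENNReal.ofReal (4 * Fintype.card κ * A ^ 2) * E 0 +
        ENNReal.ofReal (4 * Fintype.card κ * A ^ 2 * σ ^ 2) * M := by
    have t1 : ENNReal.ofReal (4 * Fintype.card κ * A ^ 2) =
        Fintype.card κ * ENNReal.ofReal (2 * A ^ 2) * 2 := by
      rw [← ENNReal.ofReal_natCast, ← ENNReal.ofReal_ofNat 2, ← ENNReal.ofReal_mul (by positivity),
        ← ENNReal.ofReal_mul (by positivity)]
      congr 1
      ring
    have t2 : ENNReal.ofReal (4 * Fintype.card κ * A ^ 2 * σ ^ 2) =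
        Fintype.card κ * ENNReal.ofReal (2 * A ^ 2 * σ) * ENNReal.ofReal σ * 2 := by
      rw [← ENNReal.ofReal_natCast, ← ENNReal.ofReal_ofNat 2, ← ENNReal.ofReal_mul (by positivity),
        ← ENNReal.ofReal_mul (by positivity), ← ENNReal.ofReal_mul (by positivity)]
      congr 1
      ring
    rw [t1, t2]
    ring
  have hMle : M ≤ ENNReal.ofReal (4 * Fintype.card κ * A ^ 2) * E 0 + M / 2 := by
    refine iSup₂_le fun r hr => (hstep r hr).trans ?_
    rw [e1]
    gcongr
    rw [mul_comm, div_eq_mul_inv]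
    gcongr
    refine (ENNReal.ofReal_le_ofReal (show _ ≤ (2 : ℝ)⁻¹ by linarith)).trans ?_
    rw [ENNReal.ofReal_inv_of_pos (by norm_num), ENNReal.ofReal_ofNat]
  have hhalf : M / 2 ≤ ENNReal.ofReal (4 * Fintype.card κ * A ^ 2) * E 0 := by
    have : M / 2 + M / 2 ≤ ENNReal.ofReal (4 * Fintype.card κ * A ^ 2) * E 0 + M / 2 := by
      rwa [ENNReal.add_halves]
    exact (ENNReal.add_le_add_iff_right (ENNReal.div_ne_top hMfin (by norm_num))).1 this
  refine (hEM t ⟨ht, le_rfl⟩).trans ?_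
  rw [← ENNReal.add_halves M]
  refine (add_le_add hhalf hhalf).trans (le_of_eq ?_)
  rw [← add_mul, ← ENNReal.ofReal_add (by positivity) (by positivity)]
  congr 2
  ring

end Energy

end

section

section Energy

variable {χ : ℝ → ℝ} {σ Λ Λ' : ℝ}

theorem lintegral_tail_le {κ : Type*} [Fintype κ] {lam lam' : κ → ℝ × ℝ → ℝ}
    {φ : κ → ℝ × ℝ × ℝ → ℝ} (hχ : Clock χ σ) (hs : ∀ k, Speed (lam k) (lam' k) Λ Λ')
    (hφ : ∀ k, IsFlow χ (lam k) (φ k)) (hσ : σ * Λ' ≤ 1 / 4) (hΛ : 0 ≤ Λ) {N : ℝ × ℝ → ℝ} {A : ℝ}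
    (hN : Continuous N) (hN0 : ∀ p, 0 ≤ N p)
    (hle : ∀ t x, 0 ≤ t → ∃ k, N (t, x) ≤ A * N (0, φ k (0, t, x)) +
      ∫ s in (0 : ℝ)..t, χ s * (A * N (s, φ k (s, t, x))))
    (hsmall : 8 * Fintype.card κ * A ^ 2 * σ ^ 2 ≤ 1) {t : ℝ} (ht : 0 ≤ t) (a : ℝ) :
    ∫⁻ x in {x | a + Λ * σ ≤ |x|}, ENNReal.ofReal (N (t, x) ^ 2) ≤
      ENNReal.ofReal (8 * Fintype.card κ * A ^ 2) *
        ∫⁻ x in {x | a ≤ |x|}, ENNReal.ofReal (N (0, x) ^ 2) := by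
  have hclk : Λ * clk χ t ≤ Λ * σ := mul_le_mul_of_nonneg_left (hχ.clk_le t) hΛ
  have hU : {x : ℝ | a + Λ * σ ≤ |x|} ⊆ ⋃ n : ℕ, annulus χ Λ a n t := fun x hx => by
    obtain ⟨n, hn⟩ := exists_nat_ge (|x| + Λ * clk χ t)
    exact mem_iUnion.2 ⟨n, (add_le_add_right hclk a).trans hx, hn⟩
  have hd : Directed (· ⊆ ·) fun n : ℕ => annulus χ Λ a n t :=
    (monotone_nat_of_le_succ fun n x hx => ⟨hx.1, hx.2.trans (by push_cast; linarith)⟩).directed_le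
  refine (lintegral_mono_set hU).trans ?_
  rw [setLIntegral_iUnion_of_directed _ hd]
  refine iSup_le fun n => (lintegral_annulus_le hχ hs hφ hσ hΛ hN hN0 hle hsmall ht).trans ?_
  gcongr
  intro x hx
  simpa using hx.1

/-- A continuous space-time function that is square integrable in `x`, uniformly in `t ∈ I`. -/
structure L2Tight (I : Set ℝ) (f : ℝ × ℝ → ℝ) : Prop where
  cont : Continuous f
  tail : ∀ ε > 0, ∃ R, ∀ t ∈ I, ∫⁻ x in {x | R ≤ |x|}, ENNReal.ofReal (f (t, x) ^ 2) ≤ ENNReal.ofReal ε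

theorem l2Tight_of_transport {κ : Type*} [Fintype κ] {lam lam' : κ → ℝ × ℝ → ℝ}
    {φ : κ → ℝ × ℝ × ℝ → ℝ} (hχ : Clock χ σ) (hs : ∀ k, Speed (lam k) (lam' k) Λ Λ')
    (hφ : ∀ k, IsFlow χ (lam k) (φ k)) (hσ : σ * Λ' ≤ 1 / 4) (hΛ : 0 ≤ Λ) {N : ℝ × ℝ → ℝ} {A : ℝ}
    (hN : Continuous N) (hN0 : ∀ p, 0 ≤ N p)
    (hle : ∀ t x, 0 ≤ t → ∃ k, N (t, x) ≤ A * N (0, φ k (0, t, x)) +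
      ∫ s in (0 : ℝ)..t, χ s * (A * N (s, φ k (s, t, x))))
    (hsmall : 8 * Fintype.card κ * A ^ 2 * σ ^ 2 ≤ 1)
    (hi : Integrable fun x => N (0, x) ^ 2) : L2Tight (Ici 0) N := by
  refine ⟨hN, fun ε hε => ?_⟩
  set K := ENNReal.ofReal (8 * Fintype.card κ * A ^ 2)
  have ht : Tendsto (fun n : ℕ => ∫⁻ x in {x : ℝ | (n : ℝ) ≤ |x|}, ENNReal.ofReal (N (0, x) ^ 2)) atTop
      (nhds 0) := by
    have hf : ∫⁻ x, ENNReal.ofReal (N (0, x) ^ 2) ≠ ⊤ := hi.lintegral_lt_top.ne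
    have hm : ∀ n : ℕ, MeasurableSet {x : ℝ | (n : ℝ) ≤ |x|} := fun n =>
      measurableSet_le measurable_const continuous_abs.measurable
    have h0 : ⋂ n : ℕ, {x : ℝ | (n : ℝ) ≤ |x|} = ∅ := by
      ext x
      simp only [mem_iInter, Set.mem_ofPred_eq, mem_empty_iff_false, iff_false, not_forall, not_le]
      exact exists_nat_gt |x|
    have := tendsto_measure_iInter_atTop (μ := volume.withDensity fun x => ENNReal.ofReal (N (0, x) ^ 2))
      (fun n => (hm n).nullMeasurableSet) (antitone_nat_of_succ_le fun n x hx => by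
        simp only [Set.mem_ofPred_eq] at hx ⊢
        push_cast at hx
        linarith) ⟨0, by
          rw [withDensity_apply _ (hm 0)]
          exact ne_top_of_le_ne_top hf (setLIntegral_le_lintegral _ _)⟩
    rw [h0, measure_empty] at this
    simpa only [Function.comp_def, withDensity_apply _ (hm _)] using this
  have ht2 := ENNReal.Tendsto.const_mul (a := K) ht (Or.inr ENNReal.ofReal_ne_top)
  rw [mul_zero] at ht2
  obtain ⟨n, hn⟩ := (ht2.eventually_le_const (ENNReal.ofReal_pos.2 hε)).exists
  exact ⟨n + Λ * σ, fun t htI => (lintegral_tail_le hχ hs hφ hσ hΛ hN hN0 hle hsmall htI n).trans hn⟩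

namespace L2Tight

variable {I : Set ℝ} {f g : ℝ × ℝ → ℝ}

theorem of_le (h : L2Tight I f) (hg : Continuous g) {K : ℝ} (hle : ∀ t ∈ I, ∀ x, |g (t, x)| ≤ K * |f (t, x)|) :
    L2Tight I g := by
  refine ⟨hg, fun ε hε => ?_⟩
  obtain ⟨R, hR⟩ := h.tail (ε / (K ^ 2 + 1)) (by positivity)
  refine ⟨R, fun t ht => ?_⟩
  calc ∫⁻ x in {x | R ≤ |x|}, ENNReal.ofReal (g (t, x) ^ 2)
      ≤ ∫⁻ x in {x | R ≤ |x|}, ENNReal.ofReal (K ^ 2 + 1) * ENNReal.ofReal (f (t, x) ^ 2) := by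
        refine lintegral_mono fun x => ?_
        rw [← ENNReal.ofReal_mul (by positivity)]
        refine ENNReal.ofReal_le_ofReal ?_
        have h1 : g (t, x) ^ 2 ≤ (K * |f (t, x)|) ^ 2 := by
          rw [← sq_abs (g (t, x))]
          exact pow_le_pow_left₀ (abs_nonneg _) (hle t ht x) 2
        rw [mul_pow, sq_abs] at h1
        nlinarith [sq_nonneg (f (t, x))]
    _ ≤ ENNReal.ofReal (K ^ 2 + 1) * ENNReal.ofReal (ε / (K ^ 2 + 1)) := by
        rw [lintegral_const_mul' _ _ (by simp)]
        gcongr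
        exact hR t ht
    _ = ENNReal.ofReal ε := by
        rw [← ENNReal.ofReal_mul (by positivity)]
        congr 1
        field_simp

theorem mono (h : L2Tight I f) {J : Set ℝ} (hJ : J ⊆ I) : L2Tight J f :=
  ⟨h.cont, fun ε hε => (h.tail ε hε).imp fun _ hR t ht => hR t (hJ ht)⟩

theorem compl_eq (R : ℝ) : {x : ℝ | R ≤ |x|}ᶜ ⊆ Icc (-R) R := fun x hx => by
  simp only [mem_compl_iff, Set.mem_ofPred_eq, not_le] at hx
  exact abs_le.1 hx.le

theorem integrable (h : L2Tight I f) {t : ℝ} (ht : t ∈ I) : Integrable fun x => f (t, x) ^ 2 := by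
  have hc := h.cont
  obtain ⟨R, hR⟩ := h.tail 1 one_pos
  refine ⟨Continuous.aestronglyMeasurable (by fun_prop), ?_⟩
  rw [hasFiniteIntegral_iff_ofReal (Eventually.of_forall fun x => sq_nonneg _)]
  have hm : MeasurableSet {x : ℝ | R ≤ |x|} := measurableSet_le measurable_const continuous_abs.measurable
  rw [← lintegral_add_compl _ hm]
  refine ENNReal.add_lt_top.2 ⟨(hR t ht).trans_lt ENNReal.ofReal_lt_top, ?_⟩
  refine (lintegral_mono_set (compl_eq R)).trans_lt ?_
  have : IntegrableOn (fun x => f (t, x) ^ 2) (Icc (-R) R) := (Continuous.continuousOn (by fun_prop)).integrableOn_Icc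
  exact this.lintegral_lt_top

theorem sq_sub_le (p q : ℝ) : (p - q) ^ 2 ≤ 2 * p ^ 2 + 2 * q ^ 2 := by nlinarith [sq_nonneg (p + q)]

theorem integrable_sub (h : L2Tight I f) {s t : ℝ} (hs : s ∈ I) (ht : t ∈ I) :
    Integrable fun x => (f (t, x) - f (s, x)) ^ 2 := by
  have hc := h.cont
  refine (((h.integrable ht).const_mul 2).add ((h.integrable hs).const_mul 2)).mono'
    (Continuous.aestronglyMeasurable (by fun_prop)) (Eventually.of_forall fun x => ?_)
  rw [Real.norm_of_nonneg (sq_nonneg _)]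
  exact sq_sub_le _ _

theorem tendsto (h : L2Tight I f) {s : ℝ} (hs : s ∈ I) :
    Tendsto (fun t => ∫ x, (f (t, x) - f (s, x)) ^ 2) (nhdsWithin s I) (nhds 0) := by
  have hc := h.cont
  refine (Metric.tendsto_nhds).2 fun ε hε => ?_
  obtain ⟨R, hR⟩ := h.tail (ε / 8) (by positivity)
  set R' := max R 0
  have hm : MeasurableSet {x : ℝ | R ≤ |x|} := measurableSet_le measurable_const continuous_abs.measurable
  have hcont : Continuous fun t => ∫ x in (-R')..R', (f (t, x) - f (s, x)) ^ 2 :=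
    intervalIntegral.continuous_parametric_intervalIntegral_of_continuous' (by fun_prop) _ _
  have hev : ∀ᶠ t in nhds s, ∫ x in (-R')..R', (f (t, x) - f (s, x)) ^ 2 < ε / 2 := by
    refine hcont.continuousAt.eventually_lt_const ?_
    simpa using half_pos hε
  have htail : ∀ t ∈ I, ∫ x in {x | R ≤ |x|}, f (t, x) ^ 2 ≤ ε / 8 := fun t ht => by
    have := hR t ht
    rw [← ofReal_integral_eq_lintegral_ofReal (h.integrable ht).integrableOn
      (Eventually.of_forall fun x => sq_nonneg _)] at this
    exact (ENNReal.ofReal_le_ofReal_iff (by positivity)).1 this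
  filter_upwards [hev.filter_mono nhdsWithin_le_nhds, self_mem_nhdsWithin] with t h1 htI
  have hi := h.integrable_sub hs htI
  rw [Real.dist_eq, sub_zero, abs_of_nonneg (integral_nonneg fun x => sq_nonneg _),
    ← integral_add_compl hm hi]
  have h2 : ∫ x in {x | R ≤ |x|}, (f (t, x) - f (s, x)) ^ 2 ≤ 2 * (ε / 8) + 2 * (ε / 8) := by
    refine (setIntegral_mono hi.integrableOn (((h.integrable htI).const_mul 2).add
      ((h.integrable hs).const_mul 2)).integrableOn fun x => sq_sub_le _ _).trans ?_
    rw [integral_add' ((h.integrable htI).const_mul 2).integrableOn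
      ((h.integrable hs).const_mul 2).integrableOn, MeasureTheory.integral_const_mul,
      MeasureTheory.integral_const_mul]
    linarith [htail t htI, htail s hs]
  have h3 : ∫ x in {x | R ≤ |x|}ᶜ, (f (t, x) - f (s, x)) ^ 2 ≤
      ∫ x in (-R')..R', (f (t, x) - f (s, x)) ^ 2 := by
    have hR0 : 0 ≤ R' := le_max_right _ _
    rw [intervalIntegral.integral_of_le (by linarith), ← integral_Icc_eq_integral_Ioc]
    refine setIntegral_mono_set hi.integrableOn (Eventually.of_forall fun x => sq_nonneg _)
      (LE.le.eventuallyLE fun x hx => ?_)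
    have := compl_eq R hx
    exact ⟨(neg_le_neg (le_max_left R 0)).trans this.1, this.2.trans (le_max_left R 0)⟩
  linarith

end L2Tight

end Energy

end

section

variable {ι : Type*} [Fintype ι]

namespace HypSys

variable {H : HypSys ι} {c : Consts} {χ : ℝ → ℝ} {Y₀ Y₀' w₀' : ℝ → ι → ℝ}

@[simp]
theorem rate_zero (H : HypSys ι) (Y : ι → ℝ) : H.rate Y 0 = H.b Y := by simp [rate]

theorem force'_zero (H : HypSys ι) : H.force' 0 = 0 := by
  ext i
  simp [force', force, lift]

namespace Setup

theorem isFlow_zero : IsFlow χ (fun _ => 0) fun p => p.2.2 :=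
  ⟨by fun_prop, fun _ _ => rfl, fun s t x => by simpa using hasDerivAt_const s x⟩

theorem abs_add_integral_le {σ : ℝ} (hχ : Clock χ σ) {t y₀ A n₀ : ℝ} {g n : ℝ → ℝ} (ht : 0 ≤ t) (hg : Continuous g)
    (hn : Continuous n) (h0 : |y₀| ≤ A * n₀) (h : ∀ s, |g s| ≤ A * n s) :
    |y₀ + ∫ s in (0 : ℝ)..t, χ s * g s| ≤ A * n₀ + ∫ s in (0 : ℝ)..t, χ s * (A * n s) := by
  have hc := hχ.cont
  refine (abs_add_le _ _).trans (add_le_add h0 ?_)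
  refine (intervalIntegral.abs_integral_le_integral_abs ht).trans
    (intervalIntegral.integral_mono_on ht (Continuous.intervalIntegrable (by fun_prop) _ _)
      (Continuous.intervalIntegrable (by fun_prop) _ _) fun s _ => ?_)
  rw [abs_mul, abs_of_nonneg (hχ.nonneg s)]
  exact mul_le_mul_of_nonneg_left (h s) (hχ.nonneg s)

theorem tight (h : H.Setup c χ Y₀ Y₀' w₀') {j : Jet ι} {φ : ι → ℝ × ℝ × ℝ → ℝ} {w ω : ℝ × ℝ → ι → ℝ}
    (hj : j.Good c χ Y₀) (hs : H.Sol c χ (fun x => H.L (Y₀ x) (Y₀' x)) j.Y j.V j.S φ w ω)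
    (hV : ∀ p, j.V p = H.Linv (j.Y p) (w p)) (hP : ∀ p, j.P p = H.rate (j.Y p) (j.V p))
    (hsmall : 8 * Fintype.card (Option ι) * (2 * c.C ^ 2) ^ 2 * c.σ ^ 2 ≤ 1)
    (hi : Integrable fun x => ‖(Y₀ x, H.L (Y₀ x) (Y₀' x), w₀' x)‖ ^ 2) :
    L2Tight (Ici 0) fun p => ‖(j.Y p, j.V p, j.P p, j.V' p, j.P' p)‖ := by
  have hC1 := h.bounds.one_le
  have hC0 : 0 ≤ c.C := by linarith
  have hCC : c.C ≤ c.C ^ 2 := by nlinarith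
  have hYc := hj.contY
  have hVc := hj.contV
  have hPc := hj.contP
  have hV'c := hj.contV'
  have hP'c := hj.contP'
  have hwc := hs.cont
  have hωc := hs.contx
  have hχ := h.clock
  have hχc := hχ.cont
  set N : ℝ × ℝ → ℝ := fun p => ‖(j.Y p, w p, ω p)‖ with hN
  have hNc : Continuous N := by fun_prop
  have hN0 : ∀ p, 0 ≤ N p := fun p => norm_nonneg _
  have hNY : ∀ p, ‖j.Y p‖ ≤ N p := fun p => le_max_left _ _
  have hNw : ∀ p, ‖w p‖ ≤ N p := fun p => (le_max_left _ _).trans (le_max_right _ _)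
  have hNω : ∀ p, ‖ω p‖ ≤ N p := fun p => (le_max_right _ _).trans (le_max_right _ _)
  have hYB : ∀ p, ‖j.Y p‖ ≤ c.B := fun p => (hj.boundY p).trans h.le_B
  have hwB : ∀ p, ‖w p‖ ≤ c.B := fun p => (hs.bound p).trans h.le_B
  have hVB : ∀ p, ‖j.V p‖ ≤ c.B := fun p => (hj.boundV p).trans h.le_B₂
  have h0B : ‖(0 : ι → ℝ)‖ ≤ c.B := by simpa using h.B_nonneg
  have hNV : ∀ p, ‖j.V p‖ ≤ c.C * N p := fun p => by
    have := h.bounds.linv.lip (z := (j.Y p, w p)) (z' := (j.Y p, 0)) (max_le (hYB p) (hwB p))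
      (max_le (hYB p) h0B)
    simp only [map_zero, sub_zero, Prod.mk_sub_mk, sub_self] at this
    rw [hV]
    refine this.trans (mul_le_mul_of_nonneg_left ?_ hC0)
    exact max_le (by simpa using hN0 p) (hNw p)
  have hmV : ∀ p, N p ≤ c.C * N p := fun p => le_mul_of_one_le_left (hN0 p) hC1
  have hm2 : ∀ p, c.C * N p ≤ c.C ^ 2 * N p := fun p => mul_le_mul_of_nonneg_right hCC (hN0 p)
  have hNP : ∀ p, ‖j.P p‖ ≤ c.C ^ 2 * N p := fun p => by
    have := h.bounds.rate.lip (z := (j.Y p, j.V p)) (z' := 0) (max_le (hYB p) (hVB p))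
      (by simpa using h.B_nonneg)
    simp only [Prod.fst_zero, Prod.snd_zero, rate_zero, map_zero, sub_zero] at this
    rw [hP]
    refine this.trans ((mul_le_mul_of_nonneg_left (max_le ((hNY p).trans (hmV p)) (hNV p)) hC0).trans_eq ?_)
    ring
  have hVfun : ∀ t y, j.V (t, y) = H.Linv (j.Y (t, y)) (w (t, y)) := fun t y => hV _
  have hV' : ∀ p, j.V' p = fderiv ℝ (fun z : (ι → ℝ) × (ι → ℝ) => H.Linv z.1 z.2) (j.Y p, w p) (j.V p, ω p) := by
    rintro ⟨t, x⟩
    refine (hj.derivV t x).unique ?_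
    simp only [hVfun t]
    rw [← hVfun t x]
    exact (h.bounds.linv.hasFDerivAt (j.Y (t, x), w (t, x))).comp_hasDerivAt x
      ((hj.derivY t x).prodMk (hs.deriv t x))
  have hP' : ∀ p, j.P' p = fderiv ℝ (fun z : (ι → ℝ) × (ι → ℝ) => H.rate z.1 z.2) (j.Y p, j.V p) (j.V p, j.V' p) := by
    rintro ⟨t, x⟩
    refine (hj.derivP t x).unique ?_
    simp only [hP]
    exact (h.bounds.rate.hasFDerivAt (j.Y (t, x), j.V (t, x))).comp_hasDerivAt x
      ((hj.derivY t x).prodMk (hj.derivV t x))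
  have hNV' : ∀ p, ‖j.V' p‖ ≤ c.C ^ 2 * N p := fun p => by
    rw [hV']
    refine (ContinuousLinearMap.le_opNorm _ _).trans ((mul_le_mul (h.bounds.linv.bound' _
      (max_le (hYB p) (hwB p))) (max_le (hNV p) ((hNω p).trans (hmV p))) (le_max_of_le_left (norm_nonneg _)) hC0).trans_eq ?_)
    ring
  have hNP' : ∀ p, ‖j.P' p‖ ≤ c.C ^ 3 * N p := fun p => by
    rw [hP']
    refine (ContinuousLinearMap.le_opNorm _ _).trans ((mul_le_mul (h.bounds.rate.bound' _
      (max_le (hYB p) (hVB p))) (max_le ((hNV p).trans (hm2 p)) (hNV' p)) (le_max_of_le_left (norm_nonneg _)) hC0).trans_eq ?_)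
    ring
  have hforceEq : ∀ p, H.force (j.S p, w p) = H.force' (j.Y p, w p) := fun p => by
    simp only [force', lift, Jet.S, hP, hV]
  have hforce : ∀ p, ‖H.force (j.S p, w p)‖ ≤ c.C * N p := fun p => by
    have := h.bounds.force'.lip (z := (j.Y p, w p)) (z' := 0) (max_le (hYB p) (hwB p))
      (by simpa using h.B_nonneg)
    rw [force'_zero, sub_zero, sub_zero] at this
    rw [hforceEq]
    exact this.trans (mul_le_mul_of_nonneg_left (max_le (hNY p) (hNw p)) hC0)
  set G : ℝ × ℝ → ι → ℝ := fun p => fderiv ℝ H.force' (j.Y p, w p) (j.V p, ω p) with hG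
  have hGc : Continuous G := by
    have := h.bounds.force'.continuous_fderiv
    exact (this.comp (hYc.prodMk hwc)).clm_apply (hVc.prodMk hωc)
  have hfc : Continuous fun p => H.force' (j.Y p, w p) :=
    h.bounds.force'.contDiff.continuous.comp (hYc.prodMk hwc)
  have hGN : ∀ p, ‖G p‖ ≤ c.C ^ 2 * N p := fun p => by
    refine (ContinuousLinearMap.le_opNorm _ _).trans ((mul_le_mul (h.bounds.force'.bound' _
      (max_le (hYB p) (hwB p))) (max_le (hNV p) ((hNω p).trans (hmV p))) (le_max_of_le_left (norm_nonneg _)) hC0).trans_eq ?_)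
    ring
  have hω : ∀ p i, ω p i = transportDeriv χ (fun p => fderiv ℝ (H.lam i) (j.Y p) (j.V p)) (φ i)
      (fun x => w₀' x i) (fun p => G p i) p := by
    rintro ⟨t, x⟩ i
    refine (hasDerivAt_pi.1 (hs.deriv t x) i).unique ?_
    simp only [hs.eq _ i, hforceEq]
    refine hasDerivAt_transport (hs.chars.flow i) hχ (hs.chars.speed i)
      (fun x => hasDerivAt_pi.1 (h.derivw₀ x) i) (by fun_prop) (by fun_prop) (fun t x => ?_) t x
    exact hasDerivAt_pi.1 ((h.bounds.force'.hasFDerivAt (j.Y (t, x), w (t, x))).comp_hasDerivAt x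
      ((hj.derivY t x).prodMk (hs.deriv t x))) i
  have hw0 : ∀ x i, w (0, x) i = H.L (Y₀ x) (Y₀' x) i := fun x i => by
    rw [hs.eq]
    simp [transport, (hs.chars.flow i).init]
  have hw0' : ∀ x, w (0, x) = H.L (Y₀ x) (Y₀' x) := fun x => funext fun i => hw0 x i
  have hω0 : ∀ x, ω (0, x) = w₀' x := fun x => by
    refine (hs.deriv 0 x).unique ?_
    simp only [hw0']
    exact h.derivw₀ x
  have hA1 : 1 ≤ 2 * c.C ^ 2 := by nlinarith
  have hA : ∀ p, N p ≤ 2 * c.C ^ 2 * N p := fun p => le_mul_of_one_le_left (hN0 p) hA1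
  have hA' : ∀ p, c.C ^ 2 * N p ≤ 2 * c.C ^ 2 * N p := fun p => by
    nlinarith [mul_nonneg (sq_nonneg c.C) (hN0 p)]
  set Φ : Option ι → ℝ × ℝ × ℝ → ℝ := fun k => k.elim (fun p => p.2.2) φ
  have hΦ : ∀ k, IsFlow χ (k.elim (fun _ => 0) fun i p => H.lam i (j.Y p)) (Φ k) := fun k => by
    cases k with
    | none => exact isFlow_zero
    | some i => exact hs.chars.flow i
  have hS : ∀ k : Option ι, Speed (k.elim (fun _ => 0) fun i p => H.lam i (j.Y p))
      (k.elim (fun _ => 0) fun i p => fderiv ℝ (H.lam i) (j.Y p) (j.V p)) c.C (c.C * c.B) := fun k => by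
    cases k with
    | none =>
      exact ⟨continuous_const, continuous_const, fun t x => hasDerivAt_const _ _,
        fun p => by simpa using hC0, fun p => by simpa using mul_nonneg hC0 h.B_nonneg⟩
    | some i => exact hs.chars.speed i
  have hJ0 : ∀ i p, 0 < flowJac χ (fun p => fderiv ℝ (H.lam i) (j.Y p) (j.V p)) (φ i) p := fun i p =>
    flowJac_pos p
  have hJ2 : ∀ i p, flowJac χ (fun p => fderiv ℝ (H.lam i) (j.Y p) (j.V p)) (φ i) p ≤ 2 := fun i p =>
    flowJac_le hχ (hs.chars.speed i) hs.chars.small p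
  have hJc : ∀ i, Continuous (flowJac χ (fun p => fderiv ℝ (H.lam i) (j.Y p) (j.V p)) (φ i)) := fun i =>
    continuous_flowJac (hs.chars.flow i) hχ (hs.chars.speed i)
  have hφc := fun i => (hs.chars.flow i).cont
  have hmulJ : ∀ i p a q, |a| ≤ c.C ^ 2 * N q →
      |a * flowJac χ (fun p => fderiv ℝ (H.lam i) (j.Y p) (j.V p)) (φ i) p| ≤ 2 * c.C ^ 2 * N q :=
    fun i p a q ha => by
      rw [abs_mul, abs_of_pos (hJ0 i p)]
      nlinarith [mul_le_mul ha (hJ2 i p) (hJ0 i p).le ((abs_nonneg a).trans ha)]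
  have hle : ∀ t x, 0 ≤ t → ∃ k, N (t, x) ≤ 2 * c.C ^ 2 * N (0, Φ k (0, t, x)) +
      ∫ s in (0 : ℝ)..t, χ s * (2 * c.C ^ 2 * N (s, Φ k (s, t, x))) := fun t x ht => by
    by_contra! hcon
    have hpos : 0 < N (t, x) := by
      refine lt_of_le_of_lt (add_nonneg ?_ ?_) (hcon none)
      · have := hN0 (0, Φ none (0, t, x))
        positivity
      · refine intervalIntegral.integral_nonneg ht fun s _ => mul_nonneg (hχ.nonneg s) ?_
        have := hN0 (s, Φ none (s, t, x))
        positivity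
    refine lt_irrefl (N (t, x)) (max_lt ?_ (max_lt ?_ ?_))
    · refine (pi_norm_lt_iff hpos).2 fun i => lt_of_le_of_lt ?_ (hcon none)
      have e : j.Y (t, x) i = j.Y (0, x) i + ∫ s in (0 : ℝ)..t, χ s * j.P (s, x) i := by
        have := intervalIntegral.integral_eq_sub_of_hasDerivAt (a := 0) (b := t)
          (fun s _ => hasDerivAt_pi.1 (hj.time s x) i)
          (Continuous.intervalIntegrable (by fun_prop) _ _)
        simp only [Pi.smul_apply, smul_eq_mul] at this
        rw [this]
        ring
      simp only [Real.norm_eq_abs, e]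
      exact abs_add_integral_le hχ ht (n := fun s => N (s, x)) (n₀ := N (0, x)) (by fun_prop) (by fun_prop)
        ((norm_apply_le _ i).trans ((hNY _).trans (hA _)))
        fun s => (norm_apply_le _ i).trans ((hNP _).trans (hA' _))
    · refine (pi_norm_lt_iff hpos).2 fun i => lt_of_le_of_lt ?_ (hcon (some i))
      have := hφc i
      simp only [Real.norm_eq_abs, hs.eq, hforceEq]
      refine abs_add_integral_le hχ ht (g := fun s => H.force' (j.Y (s, φ i (s, t, x)), w (s, φ i (s, t, x))) i)
        (n := fun s => N (s, φ i (s, t, x))) (n₀ := N (0, φ i (0, t, x))) ?_ (by fun_prop) ?_ fun s => ?_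
      · exact (continuous_apply i).comp (hfc.comp (by fun_prop : Continuous fun s => (s, φ i (s, t, x))))
      · simp only [← hw0]
        exact (norm_apply_le _ i).trans ((hNw _).trans (hA _))
      · rw [← hforceEq]
        exact (norm_apply_le _ i).trans ((hforce _).trans ((hm2 _).trans (hA' _)))
    · refine (pi_norm_lt_iff hpos).2 fun i => lt_of_le_of_lt ?_ (hcon (some i))
      have h1 := hφc i
      have h2 := hJc i
      simp only [Real.norm_eq_abs, hω]
      refine abs_add_integral_le hχ ht (g := fun s => G (s, φ i (s, t, x)) i * flowJac χ
          (fun p => fderiv ℝ (H.lam i) (j.Y p) (j.V p)) (φ i) (s, t, x))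
        (n := fun s => N (s, φ i (s, t, x))) (n₀ := N (0, φ i (0, t, x))) (by fun_prop) (by fun_prop) ?_ fun s => ?_
      · simp only [← hω0]
        exact hmulJ i _ _ _ ((norm_apply_le _ i).trans ((hNω _).trans ((hmV _).trans (hm2 _))))
      · exact hmulJ i _ _ _ ((norm_apply_le _ i).trans (hGN _))
  have htight : L2Tight (Ici 0) N := l2Tight_of_transport hχ hS hΦ hs.chars.small hC0 hNc hN0 hle hsmall (by
    simpa only [hN, hj.init, hw0', hω0] using hi)
  have hm3 : ∀ p, c.C ^ 2 * N p ≤ c.C ^ 3 * N p := fun p =>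
    mul_le_mul_of_nonneg_right (pow_le_pow_right₀ hC1 (by norm_num)) (hN0 p)
  refine htight.of_le (K := c.C ^ 3) (by fun_prop) fun t _ x => ?_
  rw [abs_norm, abs_of_nonneg (hN0 _)]
  refine max_le ((hNY _).trans ((hmV _).trans ((hm2 _).trans (hm3 _)))) (max_le ((hNV _).trans
    ((hm2 _).trans (hm3 _))) (max_le ((hNP _).trans (hm3 _)) (max_le ((hNV' _).trans (hm3 _)) (hNP' _))))

end Setup

end HypSys

end

section

section Regularity

variable {g g₁ g₂ : ℝ → ℝ}

theorem iteratedDeriv_two_eq (h1 : ∀ x, HasDerivAt g (g₁ x) x) (h2 : ∀ x, HasDerivAt g₁ (g₂ x) x) :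
    iteratedDeriv 2 g = g₂ := by
  rw [iteratedDeriv_succ, iteratedDeriv_one, funext fun x => (h1 x).deriv]
  exact funext fun x => (h2 x).deriv

theorem hSq_one_eq (h1 : ∀ x, HasDerivAt g (g₁ x) x) :
    HSq 1 g = (∫ x, g x ^ 2) + ∫ x, g₁ x ^ 2 := by
  simp only [HSq, Finset.sum_range_succ, Finset.range_one, Finset.sum_singleton, iteratedDeriv_zero,
    iteratedDeriv_one, funext fun x => (h1 x).deriv]

theorem hSq_two_eq (h1 : ∀ x, HasDerivAt g (g₁ x) x) (h2 : ∀ x, HasDerivAt g₁ (g₂ x) x) :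
    HSq 2 g = (∫ x, g x ^ 2) + (∫ x, g₁ x ^ 2) + ∫ x, g₂ x ^ 2 := by
  rw [HSq, Finset.sum_range_succ, iteratedDeriv_two_eq h1 h2]
  exact congrArg (· + _) (hSq_one_eq h1)

theorem memH_one (h1 : ∀ x, HasDerivAt g (g₁ x) x) (hc : Continuous g₁) (hi : Integrable fun x => g x ^ 2)
    (hi1 : Integrable fun x => g₁ x ^ 2) : MemH 1 g := by
  have e : deriv g = g₁ := funext fun x => (h1 x).deriv
  refine ⟨contDiff_one_iff_deriv.2 ⟨fun x => (h1 x).differentiableAt, e ▸ hc⟩, fun j hj => ?_⟩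
  interval_cases j
  · simpa using hi
  · simpa [iteratedDeriv_one, e] using hi1

theorem memH_two (h1 : ∀ x, HasDerivAt g (g₁ x) x) (h2 : ∀ x, HasDerivAt g₁ (g₂ x) x) (hc : Continuous g₂)
    (hi : Integrable fun x => g x ^ 2) (hi1 : Integrable fun x => g₁ x ^ 2)
    (hi2 : Integrable fun x => g₂ x ^ 2) : MemH 2 g := by
  have e : deriv g = g₁ := funext fun x => (h1 x).deriv
  refine ⟨?_, fun j hj => ?_⟩
  · refine (contDiff_succ_iff_deriv (n := 1)).2 ⟨fun x => (h1 x).differentiableAt, by simp, ?_⟩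
    rw [e]
    exact (memH_one h2 hc hi1 hi2).1
  · interval_cases j
    · simpa using hi
    · simpa [iteratedDeriv_one, e] using hi1
    · rw [iteratedDeriv_two_eq h1 h2]
      exact hi2

variable {I : Set ℝ} {f f₁ f₂ p p₁ : ℝ × ℝ → ℝ}

theorem regH_of_tight (hf : L2Tight I f) (hf₁ : L2Tight I f₁) (hf₂ : L2Tight I f₂) (hp : L2Tight I p)
    (hp₁ : L2Tight I p₁) (h1 : ∀ t x, HasDerivAt (fun y => f (t, y)) (f₁ (t, x)) x)
    (h2 : ∀ t x, HasDerivAt (fun y => f₁ (t, y)) (f₂ (t, x)) x)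
    (h3 : ∀ t x, HasDerivAt (fun y => p (t, y)) (p₁ (t, x)) x)
    (h4 : ∀ t ∈ I, ∀ x, HasDerivAt (fun s => f (s, x)) (p (t, x)) t) : RegH 2 I fun t x => f (t, x) := by
  have hc₂ := hf₂.cont
  have hcp := hp₁.cont
  have hpt : ∀ t ∈ I, (fun x => pt (fun t x => f (t, x)) t x) = fun x => p (t, x) := fun t ht =>
    funext fun x => (h4 t ht x).deriv
  refine ⟨fun t ht => memH_two (h1 t) (h2 t) (by fun_prop) (hf.integrable ht) (hf₁.integrable ht)
    (hf₂.integrable ht), fun s hs => ?_, fun x t ht => (h4 t ht x).differentiableAt, fun t ht => ?_,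
    fun s hs => ?_⟩
  · have := ((hf.tendsto hs).add (hf₁.tendsto hs)).add (hf₂.tendsto hs)
    simp only [add_zero] at this
    refine this.congr fun t => (hSq_two_eq (fun x => (h1 t x).sub (h1 s x)) fun x => (h2 t x).sub (h2 s x)).symm
  · rw [hpt t ht]
    exact memH_one (h3 t) (by fun_prop) (hp.integrable ht) (hp₁.integrable ht)
  · have := (hp.tendsto hs).add (hp₁.tendsto hs)
    simp only [add_zero] at this
    refine this.congr' ?_
    filter_upwards [self_mem_nhdsWithin] with t ht
    simp only [fun x => congrFun (hpt t ht) x, fun x => congrFun (hpt s hs) x]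
    exact (hSq_one_eq fun x => (h3 t x).sub (h3 s x)).symm

end Regularity

end

section

variable {ι : Type*} [Fintype ι]

namespace HypSys

/-- A jet that solves the system on `[0,T]`, starting from `Y₀` and staying `δ`-close to it. -/
structure LocalSol (H : HypSys ι) (T δ : ℝ) (Y₀ : ℝ → ι → ℝ) (j : Jet ι) : Prop where
  contY : Continuous j.Y
  contV : Continuous j.V
  contP : Continuous j.P
  contV' : Continuous j.V'
  contP' : Continuous j.P'
  tight : L2Tight (Ici 0) fun p => ‖(j.Y p, j.V p, j.P p, j.V' p, j.P' p)‖
  derivY : ∀ t x, HasDerivAt (fun y => j.Y (t, y)) (j.V (t, x)) x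
  derivV : ∀ t x, HasDerivAt (fun y => j.V (t, y)) (j.V' (t, x)) x
  derivP : ∀ t x, HasDerivAt (fun y => j.P (t, y)) (j.P' (t, x)) x
  time : ∀ t ∈ Icc 0 T, ∀ x, HasDerivAt (fun s => j.Y (s, x)) (j.P (t, x)) t
  init : ∀ x, j.Y (0, x) = Y₀ x
  near : ∀ p, ‖j.Y p - Y₀ p.2‖ ≤ δ
  rate : ∀ p, j.P p = H.rate (j.Y p) (j.V p)
  chars : ∃ σ Λ Λ' lam' φ, Chars (hat T) σ Λ Λ' (fun i p => H.lam i (j.Y p)) lam' φ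

theorem exists_localSol (H : HypSys ι) {Y₀ Y₀' Y₀'' : ℝ → ι → ℝ} {b δ : ℝ} (hδ : 0 < δ)
    (h1 : ∀ x, HasDerivAt Y₀ (Y₀' x) x) (h2 : ∀ x, HasDerivAt Y₀' (Y₀'' x) x) (hc : Continuous Y₀'')
    (hb : ∀ x, ‖Y₀ x‖ ≤ b) (hb' : ∀ x, ‖Y₀' x‖ ≤ b)
    (hi : Integrable fun x => ‖(Y₀ x, Y₀' x, Y₀'' x)‖ ^ 2) : ∃ T > 0, ∃ j, H.LocalSol T δ Y₀ j := by
  have hYc : Continuous Y₀ := continuous_iff_continuousAt.2 fun x => (h1 x).continuousAt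
  have hY'c : Continuous Y₀' := continuous_iff_continuousAt.2 fun x => (h2 x).continuousAt
  have hb0 : 0 ≤ b := (norm_nonneg _).trans (hb 0)
  obtain ⟨M, hM⟩ := exists_ballBound (q := fun z : (ι → ℝ) × (ι → ℝ) => H.L z.1 z.2)
    (((H.smooth_L.of_le (by norm_num)).comp (by fun_prop)).clm_apply (by fun_prop)) b
  have hM0 : 0 ≤ M := (norm_nonneg _).trans (hM.bound 0 (by simpa using hb0))
  set w₀' : ℝ → ι → ℝ := fun x => fderiv ℝ (fun z : (ι → ℝ) × (ι → ℝ) => H.L z.1 z.2) (Y₀ x, Y₀' x)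
    (Y₀' x, Y₀'' x) with hw₀'
  have hdw : ∀ x, HasDerivAt (fun x => H.L (Y₀ x) (Y₀' x)) (w₀' x) x := fun x => by
    have e := (hM.hasFDerivAt (Y₀ x, Y₀' x)).comp_hasDerivAt x ((h1 x).prodMk (h2 x))
    exact e
  have hw'c : Continuous w₀' :=
    (hM.continuous_fderiv.comp (hYc.prodMk hY'c)).clm_apply (hY'c.prodMk hc)
  have hwc : Continuous fun x => H.L (Y₀ x) (Y₀' x) :=
    continuous_iff_continuousAt.2 fun x => (hdw x).continuousAt
  have hball : ∀ x, ‖(Y₀ x, Y₀' x)‖ ≤ b := fun x => max_le (hb x) (hb' x)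
  set b₀ := b + M with hb₀
  obtain ⟨B₂, hB₂⟩ := exists_ballBound (q := fun z : (ι → ℝ) × (ι → ℝ) => H.Linv z.1 z.2)
    (((H.smooth_Linv.of_le (by norm_num)).comp (by fun_prop)).clm_apply (by fun_prop)) (b₀ + 1)
  obtain ⟨B₃, hB₃⟩ := exists_ballBound H.smooth_rate (max (b₀ + 1) B₂)
  have hB₂0 : 0 ≤ B₂ := (norm_nonneg _).trans (hB₂.bound 0 (by rw [norm_zero]; positivity))
  have hB₃0 : 0 ≤ B₃ := (norm_nonneg _).trans (hB₃.bound 0 (by rw [norm_zero]; positivity))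
  set B := b₀ + 1 + B₂ + B₃ with hB
  have hBpos : 0 ≤ B := by positivity
  obtain ⟨C, hC⟩ := H.exists_bounds B
  have hC1 := hC.one_le
  have hC0 : 0 < C := by linarith
  set Q := 2 + 32 * C ^ 3 + 16 * C * B + 4 * B₃ / δ + 512 * Fintype.card (Option ι) * C ^ 4 with hQ
  have q1 : 0 ≤ 32 * C ^ 3 := by positivity
  have q2 : 0 ≤ 16 * C * B := by positivity
  have q3 : 0 ≤ 4 * B₃ / δ := by positivity
  have q4 : 0 ≤ 512 * Fintype.card (Option ι) * C ^ 4 := by positivity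
  have hQ0 : 0 < Q := by positivity
  have hT : ∀ {r : ℝ}, r ≤ Q → r * Q⁻¹ ≤ 1 := fun hr => by
    rw [← div_eq_mul_inv]
    exact (div_le_one hQ0).2 hr
  have hQi : 0 < Q⁻¹ := inv_pos.2 hQ0
  have hQ1 : 2 * Q⁻¹ ≤ 1 := hT (by linarith)
  set K₀ : ℝ → ℝ := fun r => sSup ((fun x => ‖w₀' x‖) '' Icc (-r) r) with hK₀
  have hbdd : ∀ r, BddAbove ((fun x => ‖w₀' x‖) '' Icc (-r) r) := fun r =>
    (isCompact_Icc.image hw'c.norm).bddAbove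
  set c : Consts := ⟨4 * Q⁻¹, b₀, B₂, B₃, B, C, K₀⟩ with hcdef
  have hchi := clock_hat hQi (by linarith)
  have hset : H.Setup c (hat Q⁻¹) Y₀ Y₀' w₀' :=
    { clock := hchi
      bounds := hC
      deriv₀ := h1
      derivw₀ := hdw
      cont₀' := hY'c
      contw₀' := hw'c
      bound₀ := fun x => (hb x).trans (by simp only [hcdef]; linarith)
      boundw₀ := fun x => (hM.bound _ (hball x)).trans (by simp only [hcdef]; linarith)
      boundw₀' := fun x => le_csSup (hbdd _) ⟨x, abs_le.1 le_rfl, rfl⟩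
      mono₀ := fun r s hrs => by
        rcases lt_or_ge r 0 with hr | hr
        · have : Icc (-r) r = ∅ := Icc_eq_empty (by linarith)
          simp only [hcdef, hK₀, this, image_empty, Real.sSup_empty]
          exact Real.sSup_nonneg (by rintro _ ⟨x, _, rfl⟩; exact norm_nonneg _)
        · exact csSup_le_csSup (hbdd s) ((nonempty_Icc.2 (by linarith)).image _)
            (image_mono (Icc_subset_Icc (neg_le_neg hrs) hrs))
      boundV := fun Y w hY hw => hB₂.bound (Y, w) (max_le hY hw)
      boundP := fun Y V hY hV => hB₃.bound (Y, V) (max_le (hY.trans (le_max_left _ _)) (hV.trans (le_max_right _ _)))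
      le_B := by simp only [hcdef]; linarith
      le_B₂ := by simp only [hcdef]; linarith
      le_B₃ := by simp only [hcdef]; linarith
      small := by
        have : 32 * C ^ 3 * Q⁻¹ ≤ 1 := hT (by linarith)
        simp only [hcdef]
        linarith
      small' := by
        have : 16 * C * B * Q⁻¹ ≤ 1 := hT (by linarith)
        simp only [hcdef]
        linarith }
  obtain ⟨j, φ, w, ω, hj, hs, hV, hP⟩ := hset.exists_jet
  have hsmall : 8 * Fintype.card (Option ι) * (2 * c.C ^ 2) ^ 2 * c.σ ^ 2 ≤ 1 := by
    have h5 : 512 * Fintype.card (Option ι) * C ^ 4 * Q⁻¹ ≤ 1 := hT (by linarith)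
    have e : 8 * Fintype.card (Option ι) * (2 * c.C ^ 2) ^ 2 * c.σ ^ 2 =
      512 * Fintype.card (Option ι) * C ^ 4 * Q⁻¹ * Q⁻¹ := by
      simp only [hcdef]
      ring
    rw [e]
    nlinarith
  have hw₀ : ∀ x, ‖H.L (Y₀ x) (Y₀' x)‖ ≤ M * ‖Y₀' x‖ := fun x => by
    have := hM.lip (z := (Y₀ x, Y₀' x)) (z' := (Y₀ x, 0)) (hball x) (max_le (hb x) (by simpa using hb0))
    simp only [map_zero, sub_zero, Prod.mk_sub_mk, sub_self] at this
    exact this.trans (mul_le_mul_of_nonneg_left (max_le (by simp) le_rfl) hM0)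
  have hint : Integrable fun x => ‖(Y₀ x, H.L (Y₀ x) (Y₀' x), w₀' x)‖ ^ 2 := by
    refine (hi.const_mul ((1 + M) ^ 2)).mono' (Continuous.aestronglyMeasurable (by fun_prop))
      (Eventually.of_forall fun x => ?_)
    rw [Real.norm_of_nonneg (by positivity), ← mul_pow]
    refine pow_le_pow_left₀ (norm_nonneg _) ?_ 2
    set n := ‖(Y₀ x, Y₀' x, Y₀'' x)‖
    have n0 : 0 ≤ n := norm_nonneg _
    have n1 : ‖Y₀ x‖ ≤ n := le_max_left _ _
    have n23 : ‖(Y₀' x, Y₀'' x)‖ ≤ n := le_max_right _ _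
    have n2 : ‖Y₀' x‖ ≤ n := (le_max_left _ _).trans n23
    refine max_le (by nlinarith) (max_le ((hw₀ x).trans (by nlinarith)) ?_)
    refine (ContinuousLinearMap.le_opNorm _ _).trans ?_
    have := mul_le_mul (hM.bound' _ (hball x)) n23 (norm_nonneg _) hM0
    nlinarith
  have htight := hset.tight hj hs hV hP hsmall hint
  refine ⟨Q⁻¹, hQi, j, hj.contY, hj.contV, hj.contP, hj.contV', hj.contP', htight, hj.derivY, hj.derivV,
    hj.derivP, fun t ht x => ?_, hj.init, fun p => ?_, hP, c.σ, c.C, c.C * c.B, _, φ, hs.chars⟩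
  · simpa [hat_eq_one hQi (show |t| ≤ Q⁻¹ by rw [abs_of_nonneg ht.1]; exact ht.2)] using hj.time t x
  · obtain ⟨t, x⟩ := p
    refine (pi_norm_le_iff_of_nonneg hδ.le).2 fun i => ?_
    have hPc := hj.contP
    have hχc := hchi.cont
    have := intervalIntegral.integral_eq_sub_of_hasDerivAt (a := 0) (b := t)
      (fun s _ => hasDerivAt_pi.1 (hj.time s x) i) (Continuous.intervalIntegrable (by fun_prop) _ _)
    simp only [Pi.smul_apply, smul_eq_mul] at this
    rw [Pi.sub_apply, ← hj.init, ← this]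
    refine (hchi.norm_integral_le (g := fun s => j.P (s, x) i) hB₃0 fun s _ _ =>
      (norm_apply_le _ i).trans (hj.boundP _)).trans ?_
    have h6 : 4 * B₃ / δ * Q⁻¹ ≤ 1 := hT (by linarith)
    rw [div_mul_eq_mul_div, div_le_one hδ] at h6
    linarith

end HypSys

end

section

theorem hasDerivWithinAt_along {ι : Type*} {Y V : ℝ × ℝ → ι → ℝ} {P : ι → ℝ} {I : Set ℝ} {X : ℝ → ℝ} {X' t : ℝ} (htI : t ∈ I)
    (hd : ∀ s ∈ I, ∀ y, HasDerivAt (fun y => Y (s, y)) (V (s, y)) y) (hc : ContinuousOn V (I ×ˢ univ))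
    (hP : HasDerivAt (fun s => Y (s, X t)) P t) (hX : HasDerivWithinAt X X' I t) :
    HasDerivWithinAt (fun s => Y (s, X s)) (P + X' • V (t, X t)) I t := by
  refine hasDerivWithinAt_pi.2 fun i => ?_
  have h1 := hasDerivWithinAt_sub_along (f := fun p => Y p i) (f' := fun p => V p i)
    (fun s hs y => hasDerivAt_pi.1 (hd s hs y) i)
    ((continuousWithinAt_pi.1 (hc (t, X t) ⟨htI, mem_univ _⟩)) i) hX
  refine ((h1.add (hasDerivAt_pi.1 hP i).hasDerivWithinAt).congr_deriv ?_).congr_of_eventuallyEq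
    (Eventually.of_forall fun s => ?_) ?_
  · simp only [Pi.add_apply, Pi.smul_apply, smul_eq_mul]
    ring
  all_goals simp

namespace HypSys

variable {ι : Type*} [Fintype ι]

/-- A `C¹` function solving the system on `[0,T] × [-R,R]`. -/
structure SolvesOn (H : HypSys ι) (T R : ℝ) (Y V : ℝ × ℝ → ι → ℝ) : Prop where
  contY : ContinuousOn Y (Icc 0 T ×ˢ univ)
  contV : ContinuousOn V (Icc 0 T ×ˢ univ)
  derivY : ∀ t ∈ Icc 0 T, ∀ x, HasDerivAt (fun y => Y (t, y)) (V (t, x)) x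
  time : ∀ t ∈ Icc 0 T, ∀ x ∈ Icc (-R) R, HasDerivAt (fun s => Y (s, x)) (H.rate (Y (t, x)) (V (t, x))) t

theorem SolvesOn.exists_bound {H : HypSys ι} {T R : ℝ} {Y V : ℝ × ℝ → ι → ℝ} (h : H.SolvesOn T R Y V) :
    ∃ B, ∀ p ∈ Icc 0 T ×ˢ Icc (-R) R, ‖Y p‖ ≤ B ∧ ‖V p‖ ≤ B := by
  have hs : Icc 0 T ×ˢ Icc (-R) R ⊆ Icc 0 T ×ˢ (univ : Set ℝ) := prod_mono le_rfl (subset_univ _)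
  obtain ⟨B, hB⟩ := (isCompact_Icc.prod isCompact_Icc).exists_bound_of_continuousOn
    ((h.contY.mono hs).prodMk (h.contV.mono hs))
  exact ⟨B, fun p hp => ⟨(le_max_left _ _).trans (hB p hp), (le_max_right _ _).trans (hB p hp)⟩⟩

/-- Uniqueness on cones of determinacy. -/
theorem SolvesOn.eq_of_rad_le {H : HypSys ι} {T R σ Λ Λ' : ℝ} (hT : 0 < T) {Y V Y' V' : ℝ × ℝ → ι → ℝ}
    {lam' : ι → ℝ × ℝ → ℝ} {φ : ι → ℝ × ℝ × ℝ → ℝ}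
    (hch : Chars (hat T) σ Λ Λ' (fun i p => H.lam i (Y p)) lam' φ)
    (h : H.SolvesOn T R Y V) (h' : H.SolvesOn T R Y' V') (h0 : ∀ x, Y (0, x) = Y' (0, x)) :
    ∀ t ∈ Icc 0 T, ∀ x, rad (hat T) Λ (t, x) ≤ R → Y (t, x) = Y' (t, x) := by
  obtain ⟨B₁, hB₁⟩ := h.exists_bound
  obtain ⟨B₂, hB₂⟩ := h'.exists_bound
  set B := max 0 (max B₁ B₂)
  have hB0 : 0 ≤ B := le_max_left _ _
  have hB : ∀ p ∈ Icc 0 T ×ˢ Icc (-R) R, (‖Y p‖ ≤ B ∧ ‖V p‖ ≤ B) ∧ ‖Y' p‖ ≤ B ∧ ‖V' p‖ ≤ B := fun p hp => by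
    have h1 : B₁ ≤ B := (le_max_left _ _).trans (le_max_right _ _)
    have h2 : B₂ ≤ B := (le_max_right _ _).trans (le_max_right _ _)
    exact ⟨⟨(hB₁ p hp).1.trans h1, (hB₁ p hp).2.trans h1⟩, (hB₂ p hp).1.trans h2, (hB₂ p hp).2.trans h2⟩
  obtain ⟨M₁, hM₁⟩ := exists_ballBound (H.smooth_A.of_le (by norm_num)) B
  obtain ⟨M₂, hM₂⟩ := exists_ballBound (H.smooth_L.of_le (by norm_num)) B
  obtain ⟨M₃, hM₃⟩ := exists_ballBound (H.smooth_Linv.of_le (by norm_num)) B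
  obtain ⟨M₄, hM₄⟩ := exists_ballBound H.smooth_rate B
  have z : ∀ {G : Type _} [NormedAddCommGroup G], ‖(0 : G)‖ ≤ B := by simpa using hB0
  have hM₁0 : 0 ≤ M₁ := (norm_nonneg _).trans (hM₁.bound 0 z)
  have hM₂0 : 0 ≤ M₂ := (norm_nonneg _).trans (hM₂.bound 0 z)
  have hM₃0 : 0 ≤ M₃ := (norm_nonneg _).trans (hM₃.bound 0 z)
  have hM₄0 : 0 ≤ M₄ := (norm_nonneg _).trans (hM₄.bound 0 z)
  have hΛ := hch.nonneg
  set η : ℝ × ℝ → ι → ℝ := fun p => H.L (Y p) (Y' p - Y p) with hη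
  set G : ℝ × ℝ → ι → ℝ → ι → ℝ := fun p i l =>
    fderiv ℝ H.L (Y p) (H.rate (Y p) (V p) + l • V p) (Y' p - Y p) +
      H.L (Y p) (H.b (Y' p - Y p) - (H.A (Y' p) - H.A (Y p)) (V' p)) with hG
  set C := M₂ * (M₄ + Λ * B) + M₂ * (‖H.b‖ + M₁ * B)
  have hC0 : 0 ≤ C := by positivity
  have hηd : ∀ p ∈ Icc 0 T ×ˢ Icc (-R) R, ‖Y' p - Y p‖ ≤ M₃ * ‖η p‖ := fun p hp => by
    calc ‖Y' p - Y p‖ = ‖H.Linv (Y p) (η p)‖ := by rw [hη]; simp only [H.Linv_L]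
      _ ≤ _ := (ContinuousLinearMap.le_opNorm _ _).trans
        (mul_le_mul_of_nonneg_right (hM₃.bound _ (hB p hp).1.1) (norm_nonneg _))
  have hGb : ∀ p ∈ Icc 0 T ×ˢ Icc (-R) R, ∀ i l, |l| ≤ Λ → ‖G p i l‖ ≤ C * M₃ * ‖η p‖ := fun p hp i l hl => by
    obtain ⟨⟨b1, b2⟩, b3, b4⟩ := hB p hp
    have hr : ‖H.rate (Y p) (V p)‖ ≤ M₄ := hM₄.bound (Y p, V p) (max_le b1 b2)
    have e1 : ‖H.rate (Y p) (V p) + l • V p‖ ≤ M₄ + Λ * B := (norm_add_le _ _).trans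
      (add_le_add hr (by rw [norm_smul, Real.norm_eq_abs]; gcongr))
    have e2 : ‖fderiv ℝ H.L (Y p) (H.rate (Y p) (V p) + l • V p)‖ ≤ M₂ * (M₄ + Λ * B) :=
      (ContinuousLinearMap.le_opNorm _ _).trans
        (mul_le_mul (hM₂.bound' _ b1) e1 (norm_nonneg _) hM₂0)
    have e3 : ‖(H.A (Y' p) - H.A (Y p)) (V' p)‖ ≤ M₁ * ‖Y' p - Y p‖ * B :=
      (ContinuousLinearMap.le_opNorm _ _).trans (mul_le_mul (hM₁.lip b3 b1) b4 (norm_nonneg _) (by positivity))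
    have e4 : ‖H.b (Y' p - Y p) - (H.A (Y' p) - H.A (Y p)) (V' p)‖ ≤ (‖H.b‖ + M₁ * B) * ‖Y' p - Y p‖ := by
      refine (norm_sub_le _ _).trans ?_
      have := H.b.le_opNorm (Y' p - Y p)
      linarith
    calc ‖G p i l‖ ≤ M₂ * (M₄ + Λ * B) * ‖Y' p - Y p‖ + M₂ * ((‖H.b‖ + M₁ * B) * ‖Y' p - Y p‖) :=
          (norm_add_le _ _).trans (add_le_add ((ContinuousLinearMap.le_opNorm _ _).trans
            (mul_le_mul_of_nonneg_right e2 (norm_nonneg _))) ((ContinuousLinearMap.le_opNorm _ _).trans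
            (mul_le_mul (hM₂.bound _ b1) e4 (norm_nonneg _) hM₂0)))
      _ = C * ‖Y' p - Y p‖ := by ring
      _ ≤ C * (M₃ * ‖η p‖) := by gcongr; exact hηd p hp
      _ = _ := by ring
  have hLc : Continuous H.L := H.smooth_L.continuous
  have hηc : ContinuousOn η (Icc 0 T ×ˢ univ) :=
    (hLc.comp_continuousOn h.contY).clm_apply (h'.contY.sub h.contY)
  have key := cone_gronwall (f := η) (R := R) (a := 0) (A := C * M₃) (D := 0) (N := 2 * (C * M₃) + 1)
    (I := Icc 0 T) hch.clock hch.speed hch.flow hΛ ordConnected_Icc ⟨le_rfl, hT.le⟩ hηc (by positivity) le_rfl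
    le_rfl (by positivity) (by linarith) fun t ht x hx i => by
      have htu : uIcc 0 t = Icc 0 t := uIcc_of_le ht.1
      have hsub : Icc 0 t ⊆ Icc 0 T := Icc_subset_Icc_right ht.2
      set X : ℝ → ℝ := fun s => φ i (s, t, x) with hX
      have hXc : Continuous X := (hch.flow i).cont.comp (by fun_prop)
      have hbox : ∀ s ∈ Icc 0 t, (s, X s) ∈ Icc 0 T ×ˢ Icc (-R) R := fun s hs => by
        refine ⟨hsub hs, abs_le.1 ?_⟩
        have := (hch.flow i).rad_le hch.clock (hch.speed i) (s := s) (t := t) (x := x) (by rwa [htu])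
        have h2 : 0 ≤ Λ * clk (hat T) s := mul_nonneg hΛ (clk_nonneg _)
        simp only [rad] at this hx
        simp only [hX]
        linarith
      have hat1 : ∀ s ∈ Icc 0 T, hat T s = 1 := fun s hs =>
        hat_eq_one hT (by rw [abs_of_nonneg hs.1]; exact hs.2)
      set g : ℝ → ℝ := fun s => G (s, X s) i (H.lam i (Y (s, X s))) i with hg
      refine ⟨g, fun s hs => ?_, ?_⟩
      · rw [zero_mul, add_zero]
        rw [htu] at hs
        exact (norm_apply_le _ i).trans (hGb _ (hbox s hs) i _ ((hch.speed i).bound _))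
      · have hmap : MapsTo (fun s => (s, X s)) (Icc 0 t) (Icc 0 T ×ˢ univ) := fun s hs => ⟨hsub hs, mem_univ _⟩
        have hXc' : ContinuousOn (fun s => (s, X s)) (Icc 0 t) := Continuous.continuousOn (by fun_prop)
        have cY := h.contY.comp hXc' hmap
        have cV := h.contV.comp hXc' hmap
        have cY' := h'.contY.comp hXc' hmap
        have cV' := h'.contV.comp hXc' hmap
        have hd : ∀ s ∈ Icc 0 t, HasDerivWithinAt (fun s => η (s, X s) i) (g s) (Icc 0 T) s := fun s hs => by
          have hsT := hsub hs
          have hXd : HasDerivWithinAt X (H.lam i (Y (s, X s))) (Icc 0 T) s := by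
            have := (hch.flow i).deriv s t x
            rw [hat1 s hsT, one_mul] at this
            exact this.hasDerivWithinAt
          have dY := hasDerivWithinAt_along hsT h.derivY h.contV (h.time s hsT _ (hbox s hs).2) hXd
          have dY' := hasDerivWithinAt_along hsT h'.derivY h'.contV (h'.time s hsT _ (hbox s hs).2) hXd
          have dL := (hM₂.hasFDerivAt (Y (s, X s))).comp_hasDerivWithinAt s dY
          refine (hasDerivWithinAt_pi.1 (dL.clm_apply (dY'.sub dY)) i).congr_deriv ?_
          have ed := H.diag (Y (s, X s)) (V' (s, X s) - V (s, X s)) i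
          simp only [map_sub, Pi.sub_apply] at ed
          simp only [hg, hG, Function.comp, rate, map_add, map_sub, map_neg, map_smul, Pi.add_apply, Pi.sub_apply,
            Pi.neg_apply, Pi.smul_apply, smul_eq_mul, sub_apply, add_apply, neg_apply, _root_.smul_apply]
          linarith
        have hgc : ContinuousOn g (Icc 0 t) := by
          have hb := H.b.continuous
          have hAc := H.smooth_A.continuous
          have cL := hLc.comp_continuousOn cY
          have cA := hAc.comp_continuousOn cY
          have cA' := hAc.comp_continuousOn cY'
          have cD := hM₂.continuous_fderiv.comp_continuousOn cY
          have cl := (H.smooth_lam i).continuous.comp_continuousOn cY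
          have cr : ContinuousOn (fun s => H.rate (Y (s, X s)) (V (s, X s))) (Icc 0 t) :=
            (cA.clm_apply cV).neg.add (hb.comp_continuousOn cY)
          exact (continuous_apply i).comp_continuousOn
            (((cD.clm_apply (cr.add (cl.smul cV))).clm_apply (cY'.sub cY)).add
              (cL.clm_apply ((hb.comp_continuousOn (cY'.sub cY)).sub ((cA'.sub cA).clm_apply cV'))))
        have hft := intervalIntegral.integral_eq_sub_of_hasDerivAt_of_le ht.1
          (fun s hs => ((hd s hs).mono hsub).continuousWithinAt)
          (fun s hs => (hd s (Ioo_subset_Icc_self hs)).hasDerivAt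
            (Icc_mem_nhds hs.1 (hs.2.trans_le ht.2))) (hgc.intervalIntegrable_of_Icc ht.1)
        have e0 : η (0, X 0) i = 0 := by simp [hη, h0]
        have et : X t = x := (hch.flow i).init t x
        rw [e0, et, sub_zero] at hft
        have ei : ∫ s in (0 : ℝ)..t, hat T s * g s = ∫ s in (0 : ℝ)..t, g s :=
          intervalIntegral.integral_congr fun s hs => by
            rw [htu] at hs
            simp [hat1 s (hsub hs)]
        rw [ei, hft, zero_add]
  intro t ht x hx
  have hz := key t ht x hx
  simp only [mul_zero, zero_div, add_zero, zero_mul] at hz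
  have hx' : (t, x) ∈ Icc 0 T ×ˢ Icc (-R) R := ⟨ht, abs_le.1 (by
    have h2 : 0 ≤ Λ * clk (hat T) t := mul_nonneg hΛ (clk_nonneg _)
    simp only [rad] at hx
    linarith)⟩
  have := hηd _ hx'
  have h3 : ‖Y' (t, x) - Y (t, x)‖ ≤ 0 := this.trans (by nlinarith)
  exact (sub_eq_zero.1 (norm_le_zero_iff.1 h3)).symm

end HypSys

end

section

/-- A smooth positive function equal to the identity on `[m, ∞)`. -/
def smoothFloor (m x : ℝ) : ℝ :=
  Real.smoothTransition (2 * x / m - 1) * x + (1 - Real.smoothTransition (2 * x / m - 1)) * m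

theorem smoothFloor_of_le {m x : ℝ} (hm : 0 < m) (hx : m ≤ x) : smoothFloor m x = x := by
  have : 1 ≤ 2 * x / m - 1 := by
    rw [le_sub_iff_add_le, le_div_iff₀ hm]
    linarith
  simp [smoothFloor, Real.smoothTransition.one_of_one_le this]

theorem smoothFloor_pos {m : ℝ} (hm : 0 < m) (x : ℝ) : 0 < smoothFloor m x := by
  unfold smoothFloor
  rcases le_or_gt (2 * x / m - 1) 0 with h | h
  · simpa [Real.smoothTransition.zero_of_nonpos h] using hm
  · have hx : 0 < x := by
      have : 1 < 2 * x / m := by linarith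
      rw [lt_div_iff₀ hm] at this
      linarith
    have h0 := Real.smoothTransition.pos_of_pos h
    have h1 := Real.smoothTransition.le_one (2 * x / m - 1)
    have := mul_pos h0 hx
    have := mul_nonneg (sub_nonneg.2 h1) hm.le
    linarith

theorem contDiff_smoothFloor (m : ℝ) : ContDiff ℝ 3 (smoothFloor m) := by
  have h : ContDiff ℝ 3 fun x : ℝ => Real.smoothTransition (2 * x / m - 1) :=
    Real.smoothTransition.contDiff.comp (by fun_prop)
  unfold smoothFloor
  fun_prop

/-- The operator with matrix `M`. -/
def matOp (M : Fin 3 → Fin 3 → ℝ) : (Fin 3 → ℝ) →L[ℝ] (Fin 3 → ℝ) :=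
  ∑ i, ∑ k, M i k • (ContinuousLinearMap.proj (R := ℝ) (φ := fun _ : Fin 3 => ℝ) k).smulRight (Pi.single i (1 : ℝ))

theorem matOp_apply (M : Fin 3 → Fin 3 → ℝ) (z : Fin 3 → ℝ) (i : Fin 3) :
    matOp M z i = M i 0 * z 0 + M i 1 * z 1 + M i 2 * z 2 := by
  fin_cases i <;> simp [matOp, Fin.sum_univ_three]

theorem contDiff_matOp {E : Type*} [NormedAddCommGroup E] [NormedSpace ℝ E] {M : E → Fin 3 → Fin 3 → ℝ}
    (h : ∀ i k, ContDiff ℝ 3 fun Y => M Y i k) : ContDiff ℝ 3 fun Y => matOp (M Y) :=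
  ContDiff.sum fun i _ => ContDiff.sum fun k _ => (h i k).smul contDiff_const

/-- The pressure coefficient `γ v^(-γ-1)`, with `v` floored at `m`. -/
def presCoef (m γ : ℝ) (Y : Fin 3 → ℝ) : ℝ := γ * smoothFloor m (Y 0 + 1) ^ (-γ - 1)

/-- The stress coefficient `(2aτS + μ) / (τ v)`, with numerator and `v` floored at `m`. -/
def stressCoef (m a μ τ : ℝ) (Y : Fin 3 → ℝ) : ℝ :=
  smoothFloor m (2 * τ * a * Y 2 + μ) / (τ * smoothFloor m (Y 0 + 1))

/-- The sound speed. -/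
def soundSpeed (m a μ γ τ : ℝ) (Y : Fin 3 → ℝ) : ℝ := √(presCoef m γ Y + stressCoef m a μ τ Y)

section Concrete

variable {m a μ γ τ : ℝ}

theorem presCoef_pos (hm : 0 < m) (hγ : 1 < γ) (Y : Fin 3 → ℝ) : 0 < presCoef m γ Y :=
  mul_pos (by linarith) (Real.rpow_pos_of_pos (smoothFloor_pos hm _) _)

theorem stressCoef_pos (hm : 0 < m) (hτ : 0 < τ) (Y : Fin 3 → ℝ) : 0 < stressCoef m a μ τ Y :=
  div_pos (smoothFloor_pos hm _) (mul_pos hτ (smoothFloor_pos hm _))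

theorem contDiff_presCoef (hm : 0 < m) : ContDiff ℝ 3 (presCoef m γ) :=
  contDiff_const.mul (((contDiff_smoothFloor m).comp (by fun_prop)).rpow_const_of_ne
    fun Y => (smoothFloor_pos hm _).ne')

theorem contDiff_stressCoef (hm : 0 < m) (hτ : 0 < τ) : ContDiff ℝ 3 (stressCoef m a μ τ) :=
  ((contDiff_smoothFloor m).comp (by fun_prop)).div
    (contDiff_const.mul ((contDiff_smoothFloor m).comp (by fun_prop)))
    fun Y => (mul_pos hτ (smoothFloor_pos hm _)).ne'

theorem soundSpeed_pos (hm : 0 < m) (hγ : 1 < γ) (hτ : 0 < τ) (Y : Fin 3 → ℝ) : 0 < soundSpeed m a μ γ τ Y :=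
  Real.sqrt_pos.2 (add_pos (presCoef_pos hm hγ Y) (stressCoef_pos hm hτ Y))

theorem soundSpeed_mul_self (hm : 0 < m) (hγ : 1 < γ) (hτ : 0 < τ) (Y : Fin 3 → ℝ) :
    soundSpeed m a μ γ τ Y * soundSpeed m a μ γ τ Y = presCoef m γ Y + stressCoef m a μ τ Y :=
  Real.mul_self_sqrt (add_pos (presCoef_pos hm hγ Y) (stressCoef_pos hm hτ Y)).le

theorem contDiff_soundSpeed (hm : 0 < m) (hγ : 1 < γ) (hτ : 0 < τ) : ContDiff ℝ 3 (soundSpeed m a μ γ τ) :=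
  ((contDiff_presCoef hm).add (contDiff_stressCoef hm hτ)).sqrt
    fun Y => (add_pos (presCoef_pos hm hγ Y) (stressCoef_pos hm hτ Y)).ne'

/-- The relaxed system for `Y = (v - 1, u, S)`, with coefficients floored at `m`. -/
def relaxedSys (a μ : ℝ) (hm : 0 < m) (hγ : 1 < γ) (hτ : 0 < τ) : HypSys (Fin 3) where
  A Y := matOp ![![0, -1, 0], ![-presCoef m γ Y, 0, -1], ![0, -stressCoef m a μ τ Y, 0]]
  L Y := matOp ![![presCoef m γ Y, soundSpeed m a μ γ τ Y, 1], ![presCoef m γ Y, -soundSpeed m a μ γ τ Y, 1],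
    ![-stressCoef m a μ τ Y, 0, 1]]
  Linv Y := matOp ![![1 / (2 * soundSpeed m a μ γ τ Y ^ 2), 1 / (2 * soundSpeed m a μ γ τ Y ^ 2),
      -(1 / soundSpeed m a μ γ τ Y ^ 2)],
    ![1 / (2 * soundSpeed m a μ γ τ Y), -(1 / (2 * soundSpeed m a μ γ τ Y)), 0],
    ![stressCoef m a μ τ Y / (2 * soundSpeed m a μ γ τ Y ^ 2), stressCoef m a μ τ Y / (2 * soundSpeed m a μ γ τ Y ^ 2),
      1 - stressCoef m a μ τ Y / soundSpeed m a μ γ τ Y ^ 2]]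
  lam := ![fun Y => -soundSpeed m a μ γ τ Y, soundSpeed m a μ γ τ, fun _ => 0]
  b := matOp ![0, 0, ![0, 0, -(1 / τ)]]
  smooth_A := contDiff_matOp fun i k => by
    have h1 := contDiff_presCoef (γ := γ) hm
    have h2 := contDiff_stressCoef (a := a) (μ := μ) hm hτ
    fin_cases i <;> fin_cases k <;> simp <;> fun_prop
  smooth_L := contDiff_matOp fun i k => by
    have h1 := contDiff_presCoef (γ := γ) hm
    have h2 := contDiff_stressCoef (a := a) (μ := μ) hm hτ
    have h3 := contDiff_soundSpeed (a := a) (μ := μ) hm hγ hτ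
    fin_cases i <;> fin_cases k <;> simp <;> fun_prop
  smooth_Linv := contDiff_matOp fun i k => by
    have h2 := contDiff_stressCoef (a := a) (μ := μ) hm hτ
    have h3 := contDiff_soundSpeed (a := a) (μ := μ) hm hγ hτ
    have h0 : ∀ Y, soundSpeed m a μ γ τ Y ≠ 0 := fun Y => (soundSpeed_pos hm hγ hτ Y).ne'
    fin_cases i <;> fin_cases k <;> simp <;> fun_prop (disch := simp [h0])
  smooth_lam i := by
    have h3 := contDiff_soundSpeed (a := a) (μ := μ) hm hγ hτ
    fin_cases i <;> simp <;> fun_prop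
  Linv_L Y z := by
    have h0 := (soundSpeed_pos (a := a) (μ := μ) hm hγ hτ Y).ne'
    have h1 := soundSpeed_mul_self (a := a) (μ := μ) hm hγ hτ Y
    have h2 : presCoef m γ Y = soundSpeed m a μ γ τ Y ^ 2 - stressCoef m a μ τ Y := by linarith
    ext i
    fin_cases i <;> simp [matOp_apply, h2] <;> field_simp <;> ring
  L_Linv Y z := by
    have h0 := (soundSpeed_pos (a := a) (μ := μ) hm hγ hτ Y).ne'
    have h1 := soundSpeed_mul_self (a := a) (μ := μ) hm hγ hτ Y
    have h2 : presCoef m γ Y = soundSpeed m a μ γ τ Y ^ 2 - stressCoef m a μ τ Y := by linarith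
    ext i
    fin_cases i <;> simp [matOp_apply, h2] <;> field_simp <;> ring
  diag Y z i := by
    have h1 := soundSpeed_mul_self (a := a) (μ := μ) hm hγ hτ Y
    have h2 : presCoef m γ Y = soundSpeed m a μ γ τ Y ^ 2 - stressCoef m a μ τ Y := by linarith
    fin_cases i <;> simp [matOp_apply, h2] <;> ring

end Concrete

end

section

section Sobolev

variable {f : ℝ → ℝ}

theorem MemH.hasDerivAt (h : MemH 2 f) (x : ℝ) : HasDerivAt f (deriv f x) x :=
  (h.1.differentiable (by norm_num) x).hasDerivAt

theorem MemH.hasDerivAt_deriv (h : MemH 2 f) (x : ℝ) : HasDerivAt (deriv f) (deriv (deriv f) x) x :=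
  (((contDiff_succ_iff_deriv (n := 1)).1 h.1).2.2.differentiable one_ne_zero x).hasDerivAt

theorem MemH.continuous_deriv_deriv (h : MemH 2 f) : Continuous (deriv (deriv f)) :=
  ((contDiff_succ_iff_deriv (n := 1)).1 h.1).2.2.continuous_deriv le_rfl

theorem MemH.integrable_sq (h : MemH 2 f) : Integrable fun x => f x ^ 2 := by
  simpa using h.2 0 (by norm_num)

theorem MemH.integrable_deriv_sq (h : MemH 2 f) : Integrable fun x => deriv f x ^ 2 := by
  simpa using h.2 1 (by norm_num)

theorem MemH.integrable_deriv_deriv_sq (h : MemH 2 f) : Integrable fun x => deriv (deriv f) x ^ 2 := by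
  simpa [iteratedDeriv_two_eq h.hasDerivAt h.hasDerivAt_deriv] using h.2 2 le_rfl

theorem MemH.const_mul (h : MemH 2 f) (c : ℝ) : MemH 2 fun x => c * f x := by
  refine memH_two (fun x => (h.hasDerivAt x).const_mul c) (fun x => (h.hasDerivAt_deriv x).const_mul c)
    (h.continuous_deriv_deriv.const_mul c) ?_ ?_ ?_ <;> simp only [mul_pow]
  exacts [h.integrable_sq.const_mul _, h.integrable_deriv_sq.const_mul _, h.integrable_deriv_deriv_sq.const_mul _]

theorem integrable_sub_sq {f g : ℝ → ℝ} (hf : Continuous f) (hg : Continuous g) (hi : Integrable fun x => f x ^ 2)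
    (hi' : Integrable fun x => g x ^ 2) : Integrable fun x => (f x - g x) ^ 2 :=
  ((hi.const_mul 2).add (hi'.const_mul 2)).mono' (Continuous.aestronglyMeasurable (by fun_prop))
    (Eventually.of_forall fun x => by
      rw [Real.norm_of_nonneg (sq_nonneg _)]
      simp only [Pi.add_apply]
      nlinarith [sq_nonneg (f x + g x)])

theorem MemH.sub {g : ℝ → ℝ} (hf : MemH 2 f) (hg : MemH 2 g) : MemH 2 fun x => f x - g x := by
  have c : ∀ {h : ℝ → ℝ}, MemH 2 h → Continuous h ∧ Continuous (deriv h) := fun hh =>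
    ⟨hh.1.continuous, hh.1.continuous_deriv (by norm_num)⟩
  exact memH_two (fun x => (hf.hasDerivAt x).sub (hg.hasDerivAt x))
    (fun x => (hf.hasDerivAt_deriv x).sub (hg.hasDerivAt_deriv x))
    (hf.continuous_deriv_deriv.sub hg.continuous_deriv_deriv)
    (integrable_sub_sq (c hf).1 (c hg).1 hf.integrable_sq hg.integrable_sq)
    (integrable_sub_sq (c hf).2 (c hg).2 hf.integrable_deriv_sq hg.integrable_deriv_sq)
    (integrable_sub_sq hf.continuous_deriv_deriv hg.continuous_deriv_deriv hf.integrable_deriv_deriv_sq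
      hg.integrable_deriv_deriv_sq)

theorem sq_le_integral_add {f f' : ℝ → ℝ} (h : ∀ x, HasDerivAt f (f' x) x) (hc : Continuous f')
    (hi : Integrable fun x => f x ^ 2) (hi' : Integrable fun x => f' x ^ 2) (x : ℝ) :
    f x ^ 2 ≤ (∫ y, f y ^ 2) + ∫ y, f' y ^ 2 := by
  have hf : Continuous f := continuous_iff_continuousAt.2 fun x => (h x).continuousAt
  have hle : ∀ y, 2 * f y * f' y ≤ f y ^ 2 + f' y ^ 2 := fun y => two_mul_le_add_sq (f y) (f' y)
  have hd : ∀ y ∈ Iic x, HasDerivAt (fun y => f y ^ 2) (2 * f y * f' y) y := fun y _ =>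
    ((h y).fun_pow 2).congr_deriv (by norm_num)
  have hint : Integrable fun y => 2 * f y * f' y :=
    (hi.add hi').mono' (Continuous.aestronglyMeasurable (by fun_prop)) (Eventually.of_forall fun y => by
      rw [Real.norm_eq_abs, abs_le]
      simp only [Pi.add_apply]
      exact ⟨by nlinarith [sq_nonneg (f y + f' y)], hle y⟩)
  have ht := tendsto_zero_of_hasDerivAt_of_integrableOn_Iic hd hint.integrableOn hi.integrableOn
  have := integral_Iic_of_hasDerivAt_of_tendsto' hd hint.integrableOn ht
  rw [sub_zero] at this
  rw [← this, ← MeasureTheory.integral_add hi hi']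
  exact (setIntegral_mono hint.integrableOn (hi.add hi').integrableOn hle).trans
    (setIntegral_le_integral (hi.add hi') (Eventually.of_forall fun y => by simp only [Pi.add_apply, Pi.zero_apply]; positivity))

theorem MemH.sq_le (h : MemH 2 f) (x : ℝ) : f x ^ 2 ≤ HSq 2 f ∧ deriv f x ^ 2 ≤ HSq 2 f := by
  have h1 := sq_le_integral_add h.hasDerivAt (h.1.continuous_deriv (by norm_num)) h.integrable_sq
    h.integrable_deriv_sq x
  have h2 := sq_le_integral_add h.hasDerivAt_deriv h.continuous_deriv_deriv h.integrable_deriv_sq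
    h.integrable_deriv_deriv_sq x
  have p0 : 0 ≤ ∫ y, f y ^ 2 := MeasureTheory.integral_nonneg fun _ => sq_nonneg _
  have p2 : 0 ≤ ∫ y, deriv (deriv f) y ^ 2 := MeasureTheory.integral_nonneg fun _ => sq_nonneg _
  rw [hSq_two_eq h.hasDerivAt h.hasDerivAt_deriv]
  exact ⟨by linarith, by linarith⟩

theorem continuousOn_of_sq_le {F E : ℝ → ℝ → ℝ} {I : Set ℝ} (hc : ∀ s ∈ I, Continuous (F s))
    (hE : ∀ s ∈ I, ∀ t ∈ I, ∀ x, (F t x - F s x) ^ 2 ≤ E s t)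
    (hl : ∀ s ∈ I, Tendsto (E s) (nhdsWithin s I) (nhds 0)) :
    ContinuousOn (fun p : ℝ × ℝ => F p.1 p.2) (I ×ˢ univ) := by
  rintro ⟨s, x⟩ ⟨hs, -⟩
  have h1 : Tendsto (fun p : ℝ × ℝ => √(E s p.1)) (nhdsWithin (s, x) (I ×ˢ univ)) (nhds 0) := by
    have h2 : Tendsto (fun p : ℝ × ℝ => p.1) (nhdsWithin (s, x) (I ×ˢ univ)) (nhdsWithin s I) :=
      tendsto_nhdsWithin_iff.2 ⟨continuous_fst.continuousWithinAt, by
        filter_upwards [self_mem_nhdsWithin] with p hp using hp.1⟩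
    simpa [Function.comp_def] using ((Real.continuous_sqrt.tendsto 0).comp (hl s hs)).comp h2
  have h2 : Tendsto (fun p : ℝ × ℝ => F p.1 p.2 - F s p.2) (nhdsWithin (s, x) (I ×ˢ univ)) (nhds 0) := by
    refine squeeze_zero_norm' ?_ h1
    filter_upwards [self_mem_nhdsWithin] with p hp
    exact Real.abs_le_sqrt (hE s hs p.1 hp.1 p.2)
  have h3 : Tendsto (fun p : ℝ × ℝ => F s p.2) (nhdsWithin (s, x) (I ×ˢ univ)) (nhds (F s x)) :=
    ((hc s hs).comp continuous_snd).continuousWithinAt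
  simpa [ContinuousWithinAt] using h2.add h3

theorem RegH.continuousOn {F : ℝ → ℝ → ℝ} {I : Set ℝ} (h : RegH 2 I F) :
    ContinuousOn (fun p : ℝ × ℝ => F p.1 p.2) (I ×ˢ univ) ∧
    ContinuousOn (fun p : ℝ × ℝ => deriv (F p.1) p.2) (I ×ˢ univ) := by
  have hle := fun s hs t ht x => ((h.1 t ht).sub (h.1 s hs)).sq_le x
  refine ⟨continuousOn_of_sq_le (fun s hs => (h.1 s hs).1.continuous) (fun s hs t ht x => (hle s hs t ht x).1) h.2.1,
    continuousOn_of_sq_le (F := fun t x => deriv (F t) x) (fun s hs => (h.1 s hs).1.continuous_deriv (by norm_num))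
      (fun s hs t ht x => ?_) h.2.1⟩
  have := (hle s hs t ht x).2
  rwa [(((h.1 t ht).hasDerivAt x).fun_sub ((h.1 s hs).hasDerivAt x)).deriv] at this

end Sobolev

/-- The relaxed system in quasilinear form. -/
theorem relaxedSystem_iff {a μ γ τ t x vt ut St vx ux Sx : ℝ} {v u S : ℝ → ℝ → ℝ} (hτ : 0 < τ) (hv : 0 < v t x)
    (h1 : HasDerivAt (fun s => v s x) vt t) (h2 : HasDerivAt (fun s => u s x) ut t)
    (h3 : HasDerivAt (fun s => S s x) St t) (h4 : HasDerivAt (v t) vx x) (h5 : HasDerivAt (u t) ux x)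
    (h6 : HasDerivAt (S t) Sx x) :
    RelaxedSystem a μ γ τ v u S t x ↔ vt = ux ∧ ut = γ * v t x ^ (-γ - 1) * vx + Sx ∧
      St = (2 * τ * a * S t x + μ) / (τ * v t x) * ux - S t x / τ := by
  have e := (h4.rpow_const (p := -γ) (Or.inl hv.ne')).deriv
  simp only [RelaxedSystem, pt, px, h1.deriv, h2.deriv, h3.deriv, h5.deriv, h6.deriv, e]
  refine and_congr Iff.rfl (and_congr ⟨fun h => by linarith, fun h => by linarith⟩ ?_)
  field_simp
  exact ⟨fun h => by linarith, fun h => by linarith⟩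

end

section

section Floor

variable {m m' a μ γ τ : ℝ} {Y V : Fin 3 → ℝ}

theorem presCoef_of_le (hm : 0 < m) (h0 : m ≤ Y 0 + 1) : presCoef m γ Y = γ * (Y 0 + 1) ^ (-γ - 1) := by
  rw [presCoef, smoothFloor_of_le hm h0]

theorem stressCoef_of_le (hm : 0 < m) (h0 : m ≤ Y 0 + 1) (h2 : m ≤ 2 * τ * a * Y 2 + μ) :
    stressCoef m a μ τ Y = (2 * τ * a * Y 2 + μ) / (τ * (Y 0 + 1)) := by
  rw [stressCoef, smoothFloor_of_le hm h0, smoothFloor_of_le hm h2]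

theorem relaxedSys_rate (hm : 0 < m) (hγ : 1 < γ) (hτ : 0 < τ) (h0 : m ≤ Y 0 + 1) (h2 : m ≤ 2 * τ * a * Y 2 + μ) :
    (relaxedSys a μ hm hγ hτ).rate Y V = ![V 1, γ * (Y 0 + 1) ^ (-γ - 1) * V 0 + V 2,
      (2 * τ * a * Y 2 + μ) / (τ * (Y 0 + 1)) * V 1 - Y 2 / τ] := by
  ext i
  fin_cases i <;>
    simp [HypSys.rate, relaxedSys, matOp_apply, presCoef_of_le hm h0, stressCoef_of_le hm h0 h2] <;> ring

theorem relaxedSys_lam_congr (hm : 0 < m) (hm' : 0 < m') (hγ : 1 < γ) (hτ : 0 < τ) (hle : m' ≤ m)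
    (h0 : m ≤ Y 0 + 1) (h2 : m ≤ 2 * τ * a * Y 2 + μ) (i : Fin 3) :
    (relaxedSys a μ hm' hγ hτ).lam i Y = (relaxedSys a μ hm hγ hτ).lam i Y := by
  have e : soundSpeed m' a μ γ τ Y = soundSpeed m a μ γ τ Y := by
    rw [soundSpeed, soundSpeed, presCoef_of_le hm h0, presCoef_of_le hm' (hle.trans h0),
      stressCoef_of_le hm h0 h2, stressCoef_of_le hm' (hle.trans h0) (hle.trans h2)]
  fin_cases i <;> simp [relaxedSys, e]

end Floor

section Solutions

variable {a μ γ τ T : ℝ} {v₀ u₀ S₀ : ℝ → ℝ} {v u S : ℝ → ℝ → ℝ}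

theorem RegH.of_const_mul {F : ℝ → ℝ → ℝ} {I : Set ℝ} {c : ℝ} (hc : c ≠ 0)
    (h : RegH 2 I fun t x => c * F t x) :
    ContinuousOn (fun p : ℝ × ℝ => F p.1 p.2) (I ×ˢ univ) ∧
    ContinuousOn (fun p : ℝ × ℝ => deriv (F p.1) p.2) (I ×ˢ univ) ∧
    (∀ t ∈ I, ∀ x, HasDerivAt (F t) (deriv (F t) x) x) ∧
    ∀ t ∈ I, ∀ x, HasDerivAt (fun s => F s x) (pt F t x) t := by
  have e : ∀ r, c⁻¹ * (c * r) = r := fun r => by field_simp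
  have hx : ∀ t ∈ I, ∀ x, HasDerivAt (F t) (c⁻¹ * deriv (fun y => c * F t y) x) x := fun t ht x => by
    simpa only [e] using ((h.1 t ht).hasDerivAt x).const_mul c⁻¹
  refine ⟨by simpa only [e] using h.continuousOn.1.const_mul c⁻¹, ?_, fun t ht x => ?_, fun t ht x => ?_⟩
  · exact (h.continuousOn.2.const_mul c⁻¹).congr fun p hp => (hx p.1 hp.1 p.2).deriv
  · exact (hx t ht x).differentiableAt.hasDerivAt
  · have : DifferentiableAt ℝ (fun s => F s x) t := by simpa only [e] using (h.2.2.1 x t ht).const_mul c⁻¹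
    exact this.hasDerivAt

/-- The unknowns of the quasilinear system. -/
def unknowns (v u S : ℝ → ℝ → ℝ) (p : ℝ × ℝ) : Fin 3 → ℝ := ![v p.1 p.2 - 1, u p.1 p.2, S p.1 p.2]

/-- The space derivatives of the unknowns. -/
def unknowns' (v u S : ℝ → ℝ → ℝ) (p : ℝ × ℝ) : Fin 3 → ℝ := ![px v p.1 p.2, px u p.1 p.2, px S p.1 p.2]

theorem IsLocalSolution.solvesOn (hγ : 1 < γ) (hτ : 0 < τ) (h : IsLocalSolution a μ γ τ T v₀ u₀ S₀ v u S) (R : ℝ) :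
    ∃ m₀ > 0, ∀ m (hm : 0 < m), m ≤ m₀ →
      (relaxedSys a μ hm hγ hτ).SolvesOn T R (unknowns v u S) (unknowns' v u S) := by
  obtain ⟨-, heq, rv, ru, rS⟩ := h
  obtain ⟨cv, cv', dv, tv⟩ := RegH.of_const_mul (F := fun t x => v t x - 1) one_ne_zero (by simpa only [one_mul] using rv)
  obtain ⟨cu, cu', du, tu⟩ := RegH.of_const_mul one_ne_zero (by simpa only [one_mul] using ru)
  obtain ⟨cS, cS', dS, tS⟩ := rS.of_const_mul (Real.sqrt_pos.2 hτ).ne'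
  simp only [deriv_sub_const_fun] at cv' dv
  have dv' : ∀ t ∈ Icc 0 T, ∀ x, HasDerivAt (v t) (deriv (v t) x) x := fun t ht x => by
    simpa using (dv t ht x).add_const 1
  have tv' : ∀ t ∈ Icc 0 T, ∀ x, HasDerivAt (fun s => v s x) (pt (fun t x => v t x - 1) t x) t := fun t ht x => by
    simpa using (tv t ht x).add_const 1
  have hK := (isCompact_Icc (a := 0) (b := T)).prod (isCompact_Icc (a := -R) (b := R))
  have hs : Icc 0 T ×ˢ Icc (-R) R ⊆ Icc 0 T ×ˢ (univ : Set ℝ) := prod_mono le_rfl (subset_univ _)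
  obtain ⟨m₁, h1, hm₁⟩ := hK.exists_forall_le' (f := fun p : ℝ × ℝ => v p.1 p.2 - 1 + 1) (a := 0)
    ((cv.mono hs).add_const 1) fun p hp => by simpa using (heq p.1 hp.1 p.2).1
  obtain ⟨m₂, h2, hm₂⟩ := hK.exists_forall_le' (f := fun p : ℝ × ℝ => 2 * τ * a * S p.1 p.2 + μ) (a := 0)
    (((cS.mono hs).const_mul _).add_const μ) fun p hp => (heq p.1 hp.1 p.2).2.1
  refine ⟨min m₁ m₂, lt_min h1 h2, fun m hm hle => ⟨?_, ?_, fun t ht x => ?_, fun t ht x hx => ?_⟩⟩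
  · refine continuousOn_pi.2 fun i => ?_
    fin_cases i
    exacts [cv, cu, cS]
  · refine continuousOn_pi.2 fun i => ?_
    fin_cases i
    exacts [cv', cu', cS']
  · refine hasDerivAt_pi.2 fun i => ?_
    fin_cases i
    exacts [dv t ht x, du t ht x, dS t ht x]
  · obtain ⟨hv, -, hsys⟩ := heq t ht x
    rw [relaxedSystem_iff hτ hv (tv' t ht x) (tu t ht x) (tS t ht x) (dv' t ht x) (du t ht x) (dS t ht x)] at hsys
    rw [relaxedSys_rate hm hγ hτ ((hle.trans (min_le_left _ _)).trans (hm₁ (t, x) ⟨ht, hx⟩))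
      ((hle.trans (min_le_right _ _)).trans (hm₂ (t, x) ⟨ht, hx⟩))]
    have e : v t x - 1 + 1 = v t x := by ring
    refine hasDerivAt_pi.2 fun i => ?_
    fin_cases i
    · exact (tv t ht x).congr_deriv hsys.1
    · exact (tu t ht x).congr_deriv (by simpa [unknowns, unknowns', e, px] using hsys.2.1)
    · exact (tS t ht x).congr_deriv (by simpa [unknowns, unknowns', e, px] using hsys.2.2)

end Solutions

end

section

section Existence

variable {a μ γ τ T : ℝ} {v₀ u₀ S₀ : ℝ → ℝ}

theorem regH_component {ι : Type*} [Fintype ι] {H : HypSys ι} {δ : ℝ} {Y₀ : ℝ → ι → ℝ} {j : Jet ι}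
    (hj : H.LocalSol T δ Y₀ j) (i : ι) (c : ℝ) : RegH 2 (Icc 0 T) fun t x => c * j.Y (t, x) i := by
  have ht := hj.tight.mono (J := Icc 0 T) fun s hs => hs.1
  have hle : ∀ {f : ℝ × ℝ → ι → ℝ}, Continuous f →
      (∀ p, ‖f p‖ ≤ ‖(j.Y p, j.V p, j.P p, j.V' p, j.P' p)‖) → L2Tight (Icc 0 T) fun p => c * f p i := fun hf hb =>
    ht.of_le (continuous_const.mul ((continuous_apply i).comp hf)) (K := |c|) fun t _ x => by
      rw [abs_mul, abs_of_nonneg (norm_nonneg _)]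
      exact mul_le_mul_of_nonneg_left ((norm_apply_le _ i).trans (hb (t, x))) (abs_nonneg c)
  exact regH_of_tight (f := fun p => c * j.Y p i)
    (hle hj.contY fun p => le_max_left _ _)
    (hle hj.contV fun p => le_max_of_le_right (le_max_left _ _))
    (hle hj.contV' fun p => le_max_of_le_right (le_max_of_le_right (le_max_of_le_right (le_max_left _ _))))
    (hle hj.contP fun p => le_max_of_le_right (le_max_of_le_right (le_max_left _ _)))
    (hle hj.contP' fun p => le_max_of_le_right (le_max_of_le_right (le_max_of_le_right (le_max_right _ _))))
    (fun t x => (hasDerivAt_pi.1 (hj.derivY t x) i).const_mul c)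
    (fun t x => (hasDerivAt_pi.1 (hj.derivV t x) i).const_mul c)
    (fun t x => (hasDerivAt_pi.1 (hj.derivP t x) i).const_mul c)
    (fun t ht x => (hasDerivAt_pi.1 (hj.time t ht x) i).const_mul c)

theorem isLocalSolution_of_localSol {m δ : ℝ} (hm : 0 < m) (hγ : 1 < γ) (hτ : 0 < τ) {j : Jet (Fin 3)}
    (hj : (relaxedSys a μ hm hγ hτ).LocalSol T δ (fun x => ![v₀ x - 1, u₀ x, S₀ x]) j)
    (hlow : ∀ p, m ≤ j.Y p 0 + 1 ∧ m ≤ 2 * τ * a * j.Y p 2 + μ) :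
    IsLocalSolution a μ γ τ T v₀ u₀ S₀ (fun t x => j.Y (t, x) 0 + 1) (fun t x => j.Y (t, x) 1)
      (fun t x => j.Y (t, x) 2) := by
  refine ⟨fun x => by simp [hj.init], fun t ht x => ?_, ?_, ?_, regH_component hj 2 _⟩
  · obtain ⟨h0, h2⟩ := hlow (t, x)
    have hv : 0 < j.Y (t, x) 0 + 1 := hm.trans_le h0
    refine ⟨hv, hm.trans_le h2, ?_⟩
    have dt := fun i => hasDerivAt_pi.1 (hj.time t ht x) i
    have dx := fun i => hasDerivAt_pi.1 (hj.derivY t x) i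
    rw [relaxedSystem_iff (v := fun t x => j.Y (t, x) 0 + 1) (u := fun t x => j.Y (t, x) 1)
      (S := fun t x => j.Y (t, x) 2) hτ hv ((dt 0).add_const 1) (dt 1) (dt 2) ((dx 0).add_const 1) (dx 1) (dx 2), hj.rate,
      relaxedSys_rate hm hγ hτ h0 h2]
    exact ⟨rfl, rfl, rfl⟩
  · simpa using regH_component hj 0 1
  · simpa using regH_component hj 1 1

theorem exists_isLocalSolution (ha : a ∈ Icc (-1 : ℝ) 1) (hγ : 1 < γ) (hτ : τ ∈ Ioo (0 : ℝ) 1)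
    (hv₀ : MemH 2 fun x => v₀ x - 1) (hu₀ : MemH 2 u₀) (hS₀ : MemH 2 S₀) {c₁ c₂ : ℝ} (hc₁ : 0 < c₁) (hc₂ : 0 < c₂)
    (h1 : ∀ x, c₁ ≤ v₀ x) (h2 : ∀ x, c₂ ≤ 2 * τ * a * S₀ x + μ) :
    ∃ m, ∃ hm : 0 < m, ∃ T > 0, ∃ δ j,
      (relaxedSys a μ hm hγ hτ.1).LocalSol T δ (fun x => ![v₀ x - 1, u₀ x, S₀ x]) j ∧
      ∀ p, m ≤ j.Y p 0 + 1 ∧ m ≤ 2 * τ * a * j.Y p 2 + μ := by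
  set m := min c₁ c₂ / 2 with hmdef
  have hm : 0 < m := half_pos (lt_min hc₁ hc₂)
  have hm1 : 2 * m ≤ c₁ := by linarith [min_le_left c₁ c₂]
  have hm2 : 2 * m ≤ c₂ := by linarith [min_le_right c₁ c₂]
  set F : Fin 3 → ℝ → ℝ := ![fun x => v₀ x - 1, u₀, S₀] with hF
  have hFm : ∀ i, MemH 2 (F i) := fun i => by
    fin_cases i
    exacts [hv₀, hu₀, hS₀]
  have hFe : (fun x i => F i x) = fun x => ![v₀ x - 1, u₀ x, S₀ x] := by
    ext x i
    fin_cases i <;> rfl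
  set b := ∑ i, √(HSq 2 (F i)) with hb
  have hle : ∀ i, √(HSq 2 (F i)) ≤ b := fun i =>
    Finset.single_le_sum (f := fun i => √(HSq 2 (F i))) (fun i _ => Real.sqrt_nonneg _) (Finset.mem_univ i)
  have hb0 : 0 ≤ b := (Real.sqrt_nonneg _).trans (hle 0)
  have hc0 : ∀ i, Continuous (F i) := fun i => (hFm i).1.continuous
  have hc1 : ∀ i, Continuous (deriv (F i)) := fun i => (hFm i).1.continuous_deriv (by norm_num)
  have hc2 : ∀ i, Continuous (deriv (deriv (F i))) := fun i => (hFm i).continuous_deriv_deriv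
  have hint : Integrable fun x => ‖(fun i => F i x, fun i => deriv (F i) x, fun i => deriv (deriv (F i)) x)‖ ^ 2 := by
    have hi : Integrable fun x => ∑ i, (F i x ^ 2 + deriv (F i) x ^ 2 + deriv (deriv (F i)) x ^ 2) :=
      integrable_finsetSum _ fun i _ =>
        ((hFm i).integrable_sq.add (hFm i).integrable_deriv_sq).add (hFm i).integrable_deriv_deriv_sq
    refine hi.mono' (Continuous.aestronglyMeasurable (by fun_prop)) (Eventually.of_forall fun x => ?_)
    rw [Real.norm_of_nonneg (sq_nonneg _)]
    set s := ∑ i, (F i x ^ 2 + deriv (F i) x ^ 2 + deriv (deriv (F i)) x ^ 2) with hs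
    have hsi : ∀ i, F i x ^ 2 + deriv (F i) x ^ 2 + deriv (deriv (F i)) x ^ 2 ≤ s := fun i =>
      Finset.single_le_sum (f := fun i => F i x ^ 2 + deriv (F i) x ^ 2 + deriv (deriv (F i)) x ^ 2)
        (fun i _ => by positivity) (Finset.mem_univ i)
    have hs0 : 0 ≤ s := Finset.sum_nonneg fun i _ => by positivity
    have hk : ∀ g : Fin 3 → ℝ, (∀ i, g i ^ 2 ≤ s) → ‖g‖ ≤ √s := fun g hg =>
      (pi_norm_le_iff_of_nonneg (Real.sqrt_nonneg _)).2 fun i => Real.abs_le_sqrt (hg i)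
    have hn : ‖(fun i => F i x, fun i => deriv (F i) x, fun i => deriv (deriv (F i)) x)‖ ≤ √s := by
      refine max_le (hk _ fun i => ?_) (max_le (hk _ fun i => ?_) (hk _ fun i => ?_)) <;>
        nlinarith [hsi i, sq_nonneg (F i x), sq_nonneg (deriv (F i) x), sq_nonneg (deriv (deriv (F i)) x)]
    exact (pow_le_pow_left₀ (norm_nonneg _) hn 2).trans_eq (Real.sq_sqrt hs0)
  obtain ⟨T, hT, j, hj⟩ := (relaxedSys a μ hm hγ hτ.1).exists_localSol (Y₀ := fun x i => F i x)
    (Y₀' := fun x i => deriv (F i) x) (Y₀'' := fun x i => deriv (deriv (F i)) x) (b := b) (half_pos hm)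
    (fun x => hasDerivAt_pi.2 fun i => (hFm i).hasDerivAt x)
    (fun x => hasDerivAt_pi.2 fun i => (hFm i).hasDerivAt_deriv x) (by fun_prop)
    (fun x => (pi_norm_le_iff_of_nonneg hb0).2 fun i => (Real.abs_le_sqrt ((hFm i).sq_le x).1).trans (hle i))
    (fun x => (pi_norm_le_iff_of_nonneg hb0).2 fun i => (Real.abs_le_sqrt ((hFm i).sq_le x).2).trans (hle i)) hint
  refine ⟨m, hm, T, hT, m / 2, j, hFe ▸ hj, fun p => ?_⟩
  have hn := fun i => (norm_apply_le _ i).trans (hj.near p)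
  have n0 := abs_le.1 (hn 0)
  have n2 := abs_le.1 (hn 2)
  simp only [Pi.sub_apply, hF] at n0 n2
  simp at n0 n2
  refine ⟨by linarith [h1 p.2, n0.1], ?_⟩
  have hta : |2 * τ * a| ≤ 2 := by
    rw [abs_mul, abs_of_pos (by linarith [hτ.1] : 0 < 2 * τ)]
    have := abs_le.2 ha
    nlinarith [hτ.1, hτ.2, abs_nonneg a]
  have hd : |2 * τ * a * (j.Y p 2 - S₀ p.2)| ≤ m := by
    rw [abs_mul]
    calc _ ≤ 2 * (m / 2) := mul_le_mul hta (abs_le.2 (by constructor <;> linarith [n2.1, n2.2])) (abs_nonneg _) (by norm_num)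
      _ = m := by ring
  have := (abs_le.1 hd).1
  linarith [h2 p.2]

end Existence

section Uniqueness

variable {a μ γ τ T : ℝ} {v₀ u₀ S₀ : ℝ → ℝ}

theorem IsLocalSolution.eq_of_localSol {m δ : ℝ} (hm : 0 < m) (hγ : 1 < γ) (hτ : 0 < τ) (hT : 0 < T) {j : Jet (Fin 3)}
    (hj : (relaxedSys a μ hm hγ hτ).LocalSol T δ (fun x => ![v₀ x - 1, u₀ x, S₀ x]) j)
    (hlow : ∀ p, m ≤ j.Y p 0 + 1 ∧ m ≤ 2 * τ * a * j.Y p 2 + μ) {v u S : ℝ → ℝ → ℝ}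
    (h : IsLocalSolution a μ γ τ T v₀ u₀ S₀ v u S) {t : ℝ} (ht : t ∈ Icc 0 T) (x : ℝ) :
    j.Y (t, x) = unknowns v u S (t, x) := by
  obtain ⟨σ, Λ, Λ', lam', φ, hch⟩ := hj.chars
  have hY : unknowns (fun t x => j.Y (t, x) 0 + 1) (fun t x => j.Y (t, x) 1) (fun t x => j.Y (t, x) 2) = j.Y := by
    ext p i
    fin_cases i <;> simp [unknowns]
  obtain ⟨m₁, h1, hm₁⟩ := (isLocalSolution_of_localSol hm hγ hτ hj hlow).solvesOn hγ hτ (rad (hat T) Λ (t, x))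
  obtain ⟨m₂, h2, hm₂⟩ := h.solvesOn hγ hτ (rad (hat T) Λ (t, x))
  rw [hY] at hm₁
  set m' := min m (min m₁ m₂)
  have hm' : 0 < m' := lt_min hm (lt_min h1 h2)
  have e : (fun i p => (relaxedSys a μ hm hγ hτ).lam i (j.Y p)) = fun i p => (relaxedSys a μ hm' hγ hτ).lam i (j.Y p) := by
    ext i p
    exact (relaxedSys_lam_congr hm hm' hγ hτ (min_le_left _ _) (hlow p).1 (hlow p).2 i).symm
  rw [e] at hch
  refine (hm₁ m' hm' ((min_le_right _ _).trans (min_le_left _ _))).eq_of_rad_le hT hch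
    (hm₂ m' hm' ((min_le_right _ _).trans (min_le_right _ _))) (fun y => ?_) t ht x le_rfl
  rw [hj.init]
  simp [unknowns, h.1]

end Uniqueness

end

/-- Theorem 2.1 (local existence): for any `a ∈ [-1,1]`, `μ > 0`, `γ > 1`,
`τ ∈ (0,1)` and data with `(v₀ - 1, u₀, √τ S₀) ∈ H²(ℝ)`, `inf v₀ > 0` and
`inf (2τaS₀ + μ) > 0`, there is `T > 0` such that the Cauchy problem for the relaxed
system has a unique solution on `[0,T] × ℝ` in the class
`C⁰([0,T];H²) ∩ C¹([0,T];H¹)`, with `v > 0` and `2τaS + μ > 0`. -/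
theorem local_existence
    (a μ γ : ℝ) (ha : a ∈ Icc (-1 : ℝ) 1) (hμ : 0 < μ) (hγ : 1 < γ) :
    ∀ τ ∈ Ioo (0 : ℝ) 1, ∀ v₀ u₀ S₀ : ℝ → ℝ,
      MemH 2 (fun x => v₀ x - 1) → MemH 2 u₀ →
      MemH 2 (fun x => Real.sqrt τ * S₀ x) →
      (∃ c > (0 : ℝ), ∀ x : ℝ, c ≤ v₀ x) →
      (∃ c > (0 : ℝ), ∀ x : ℝ, c ≤ 2 * τ * a * S₀ x + μ) →
      ∃ T > (0 : ℝ), ∃ v u S : ℝ → ℝ → ℝ,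
        IsLocalSolution a μ γ τ T v₀ u₀ S₀ v u S ∧
        ∀ v' u' S' : ℝ → ℝ → ℝ, IsLocalSolution a μ γ τ T v₀ u₀ S₀ v' u' S' →
          ∀ t ∈ Icc (0 : ℝ) T, ∀ x : ℝ,
            v' t x = v t x ∧ u' t x = u t x ∧ S' t x = S t x := by
  intro τ hτ v₀ u₀ S₀ hv₀ hu₀ hS₀ ⟨c₁, hc₁, h1⟩ ⟨c₂, hc₂, h2⟩
  have hS : MemH 2 S₀ := by
    have hτ' : √τ ≠ 0 := (Real.sqrt_pos.2 hτ.1).ne'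
    simpa [hτ'] using hS₀.const_mul (√τ)⁻¹
  obtain ⟨m, hm, T, hT, δ, j, hj, hlow⟩ := exists_isLocalSolution ha hγ hτ hv₀ hu₀ hS hc₁ hc₂ h1 h2
  refine ⟨T, hT, _, _, _, isLocalSolution_of_localSol hm hγ hτ.1 hj hlow, fun v' u' S' h t ht x => ?_⟩
  rw [h.eq_of_localSol hm hγ hτ.1 hT hj hlow ht x]
  simp [unknowns]
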